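/- arXiv:2103.12606 — 2 statements merged into one kernel-verified Lean document; each statement's English description precedes it below -/
import Mathlib

section
/- Let t ≥ 1, let P_1, ..., P_t ∈ ℤ[y] satisfy 0 < deg P_1 < ... < deg P_t, and let v_1, ..., v_t ∈ ℤ^D be nonzero vectors. There exist constants c, C > 0 and p_0 such that for all primes p > p_0, every subset A ⊆ F_p^D with |A| ≥ C p^{D−c} contains points x, x + v_1 P_1(y), ..., x + v_t P_t(y) for some x ∈ F_p^D and some y ∈ F_p with y ≠ 0. -/
open Finset Complex

noncomputable def avg {α : Type*} [Fintype α] (f : α → ℂ) : ℂ :=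
  (∑ x, f x) / (Fintype.card α : ℂ)

noncomputable def avgR {α : Type*} [Fintype α] (f : α → ℝ) : ℝ :=
  (∑ x, f x) / (Fintype.card α : ℝ)

noncomputable def ep (p : ℕ) [NeZero p] (x : ZMod p) : ℂ :=
  Complex.exp (2 * Real.pi * Complex.I * (x.val : ℂ) / (p : ℂ))

noncomputable def conjIt (n : ℕ) (z : ℂ) : ℂ :=
  (fun w : ℂ => (starRingEnd ℂ) w)^[n] z

/-- `2^s`-th power of the Gowers norm of degree `s` along the vector `v`. -/
noncomputable def gowersPow {p D : ℕ} [NeZero p] (s : ℕ) (v : Fin D → ZMod p)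
    (f : (Fin D → ZMod p) → ℂ) : ℂ :=
  avg fun xh : (Fin D → ZMod p) × (Fin s → ZMod p) =>
    ∏ w : Fin s → Bool,
      conjIt (Finset.univ.filter (fun i => w i = true)).card
        (f (xh.1 + (∑ i, if w i then xh.2 i else 0) • v))

/-- `2^s`-th power of the one-dimensional Gowers norm of degree `s` on `F_p`. -/
noncomputable def gowersPow1 {p : ℕ} [NeZero p] (s : ℕ) (g : ZMod p → ℂ) : ℂ :=
  avg fun xh : ZMod p × (Fin s → ZMod p) =>
    ∏ w : Fin s → Bool,
      conjIt (Finset.univ.filter (fun i => w i = true)).card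
        (g (xh.1 + ∑ i, if w i then xh.2 i else 0))

/-- Fourier transform of `f` along `v`. -/
noncomputable def ft {p D : ℕ} [NeZero p] (f : (Fin D → ZMod p) → ℂ)
    (v : Fin D → ZMod p) (x : Fin D → ZMod p) (k : ZMod p) : ℂ :=
  avg fun m : ZMod p => f (x + m • v) * ep p (-(k * m))

namespace PolySzemeredi

open scoped BigOperators ComplexConjugate

/-! ### Averages -/

section Averages

variable {α β : Type*} [Fintype α] [Fintype β]

theorem norm_expect_le_one {f : α → ℂ} (hf : ∀ x, ‖f x‖ ≤ 1) : ‖𝔼 x, f x‖ ≤ 1 := by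
  refine (RCLike.norm_expect_le (K := ℂ)).trans ?_
  rcases isEmpty_or_nonempty α with h | h
  · simp
  · exact Finset.expect_le univ_nonempty fun x _ => hf x

theorem expect_add_right {G M : Type*} [Fintype G] [AddGroup G] [AddCommMonoid M] [Module ℚ≥0 M]
    (f : G → M) (a : G) : 𝔼 x, f (x + a) = 𝔼 x, f x :=
  Fintype.expect_equiv (Equiv.addRight a) _ _ fun _ => rfl

theorem expect_mono {f g : α → ℝ} (h : ∀ x, f x ≤ g x) : 𝔼 x, f x ≤ 𝔼 x, g x :=
  Finset.expect_le_expect fun x _ => h x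

theorem expect_nonneg' {f : α → ℝ} (h : ∀ x, 0 ≤ f x) : 0 ≤ 𝔼 x, f x :=
  Finset.expect_nonneg fun x _ => h x

theorem sq_expect_le (f : α → ℝ) : (𝔼 x, f x) ^ 2 ≤ 𝔼 x, f x ^ 2 := by
  rcases isEmpty_or_nonempty α with h | h
  · simp
  · simpa using Finset.expect_mul_sq_le_sq_mul_sq univ f 1

theorem expect_pow_two_pow_le {f : α → ℝ} (hf : ∀ x, 0 ≤ f x) (n : ℕ) :
    (𝔼 x, f x) ^ 2 ^ n ≤ 𝔼 x, f x ^ 2 ^ n := by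
  induction n with
  | zero => simp
  | succ n ih =>
    calc (𝔼 x, f x) ^ 2 ^ (n + 1) = ((𝔼 x, f x) ^ 2 ^ n) ^ 2 := by rw [← pow_mul, pow_succ]
      _ ≤ (𝔼 x, f x ^ 2 ^ n) ^ 2 := by
        have := expect_nonneg' hf
        gcongr
      _ ≤ _ := by
        refine (sq_expect_le _).trans_eq (Finset.expect_congr rfl fun x _ => ?_)
        rw [← pow_mul, pow_succ]

theorem norm_sq_expect_le {b u : α → ℂ} (hb : ∀ x, ‖b x‖ ≤ 1) :
    ‖𝔼 x, b x * u x‖ ^ 2 ≤ 𝔼 x, ‖u x‖ ^ 2 := by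
  calc ‖𝔼 x, b x * u x‖ ^ 2 ≤ (𝔼 x, ‖u x‖) ^ 2 := by
        gcongr
        refine (RCLike.norm_expect_le (K := ℂ)).trans (expect_mono fun x => ?_)
        rw [norm_mul]
        exact mul_le_of_le_one_left (norm_nonneg _) (hb x)
    _ ≤ _ := sq_expect_le _

theorem conj_expect (f : α → ℂ) : conj (𝔼 x, f x) = 𝔼 x, conj (f x) := by
  rw [Fintype.expect_eq_sum_div_card, Fintype.expect_eq_sum_div_card]
  simp

theorem norm_expect_sq_eq [AddCommGroup β] (u : β → ℂ) :
    ((‖𝔼 y, u y‖ ^ 2 : ℝ) : ℂ) = 𝔼 h, 𝔼 y, u y * conj (u (y + h)) := by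
  rw [Finset.expect_comm]
  have : ∀ y, 𝔼 h, u y * conj (u (y + h)) = u y * conj (𝔼 h, u h) := by
    intro y
    rw [← Finset.mul_expect, conj_expect]
    congr 1
    exact Fintype.expect_equiv (Equiv.addLeft y) _ _ fun _ => rfl
  simp_rw [this]
  rw [← Finset.expect_mul, Complex.mul_conj, Complex.normSq_eq_norm_sq]

/-- The van der Corput inequality. -/
theorem van_der_corput [AddCommGroup β] {b : α → ℂ} (hb : ∀ x, ‖b x‖ ≤ 1) (u : α → β → ℂ) :
    ‖𝔼 x, b x * 𝔼 y, u x y‖ ^ 2 ≤ 𝔼 h, ‖𝔼 x, 𝔼 y, u x y * conj (u x (y + h))‖ := by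
  refine (norm_sq_expect_le hb).trans ?_
  have h1 : ((𝔼 x, ‖𝔼 y, u x y‖ ^ 2 : ℝ) : ℂ) =
      𝔼 h, 𝔼 x, 𝔼 y, u x y * conj (u x (y + h)) := by
    rw [Complex.ofReal_expect, Finset.expect_comm]
    exact Finset.expect_congr rfl fun x _ => norm_expect_sq_eq _
  have h2 : (𝔼 x, ‖𝔼 y, u x y‖ ^ 2 : ℝ) = ‖((𝔼 x, ‖𝔼 y, u x y‖ ^ 2 : ℝ) : ℂ)‖ := by
    rw [Complex.norm_real, Real.norm_of_nonneg (expect_nonneg' fun x => by positivity)]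
  rw [h2, h1]
  exact RCLike.norm_expect_le (K := ℂ)

theorem van_der_corput_one [AddCommGroup β] (u : β → ℂ) :
    ‖𝔼 y, u y‖ ^ 2 ≤ 𝔼 h, ‖𝔼 y, u y * conj (u (y + h))‖ := by
  have := van_der_corput (α := Unit) (b := fun _ => 1) (by simp) (fun _ => u)
  simpa using this

theorem expect_prod_type {M : Type*} [AddCommMonoid M] [Module ℚ≥0 M] (f : α × β → M) :
    𝔼 z, f z = 𝔼 x, 𝔼 y, f (x, y) := by
  rw [← Finset.univ_product_univ, Finset.expect_product]

end Averages

/-! ### Gowers norms along a vector -/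

section Gowers

variable (p : ℕ) [Fact p.Prime] {G : Type*} [AddCommGroup G] [Module (ZMod p) G]

/-- The multiplicative derivative of `F` along `a • v`. -/
noncomputable def mulDiff (v : G) (a : ZMod p) (F : G → ℂ) : G → ℂ :=
  fun x => F x * conj (F (x + a • v))

/-- The average of `F` over the line in direction `v` through the given point. -/
noncomputable def lineAvg (v : G) (F : G → ℂ) : G → ℂ := fun x => 𝔼 n : ZMod p, F (x + n • v)

/-- The `2 ^ (s + 1)`-th power of the Gowers norm of degree `s + 1` of `F` along `v`. -/
noncomputable def gowers [Fintype G] (v : G) : ℕ → (G → ℂ) → ℝ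
  | 0, F => 𝔼 x, ‖lineAvg p v F x‖ ^ 2
  | s + 1, F => 𝔼 a : ZMod p, gowers v s (mulDiff p v a F)

variable {p}

theorem norm_mulDiff_le {F : G → ℂ} (hF : ∀ x, ‖F x‖ ≤ 1) (v : G) (a : ZMod p) (x : G) :
    ‖mulDiff p v a F x‖ ≤ 1 := by
  rw [mulDiff, norm_mul, RCLike.norm_conj]
  exact mul_le_one₀ (hF _) (norm_nonneg _) (hF _)

theorem norm_lineAvg_le {F : G → ℂ} (hF : ∀ x, ‖F x‖ ≤ 1) (v : G) (x : G) :
    ‖lineAvg p v F x‖ ≤ 1 :=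
  norm_expect_le_one fun _ => hF _

theorem lineAvg_add_smul (v : G) (F : G → ℂ) (x : G) (n : ZMod p) :
    lineAvg p v F (x + n • v) = lineAvg p v F x := by
  rw [lineAvg, lineAvg, ← expect_add_right (fun m : ZMod p => F (x + m • v)) n]
  exact Finset.expect_congr rfl fun m _ => by rw [add_smul]; congr 1; abel

theorem mulDiff_conj (v : G) (a : ZMod p) (F : G → ℂ) :
    mulDiff p v a (fun x => conj (F x)) = fun x => conj (mulDiff p v a F x) := by
  funext x; simp [mulDiff]

variable [Fintype G]

theorem gowers_nonneg (v : G) (s : ℕ) (F : G → ℂ) : 0 ≤ gowers p v s F := by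
  induction s generalizing F with
  | zero => exact expect_nonneg' fun x => by positivity
  | succ s ih => exact expect_nonneg' fun a => ih _

theorem gowers_conj (v : G) (s : ℕ) (F : G → ℂ) :
    gowers p v s (fun x => conj (F x)) = gowers p v s F := by
  induction s generalizing F with
  | zero =>
    refine Finset.expect_congr rfl fun x _ => ?_
    rw [lineAvg, ← conj_expect, RCLike.norm_conj, lineAvg]
  | succ s ih => exact Finset.expect_congr rfl fun a _ => by rw [mulDiff_conj, ih]

theorem gowers_translate (v : G) (s : ℕ) (F : G → ℂ) (b : G) :
    gowers p v s (fun x => F (x + b)) = gowers p v s F := by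
  induction s generalizing F with
  | zero =>
    rw [gowers, gowers, ← expect_add_right (fun x => ‖lineAvg p v F x‖ ^ 2) b]
    refine Finset.expect_congr rfl fun x _ => ?_
    simp only [lineAvg, add_right_comm]
  | succ s ih =>
    refine Finset.expect_congr rfl fun a _ => ?_
    rw [← ih (mulDiff p v a F)]
    congr 1
    funext x
    simp only [mulDiff, add_right_comm]

theorem expect_lineAvg (v : G) (F : G → ℂ) : 𝔼 x, lineAvg p v F x = 𝔼 x, F x := by
  simp only [lineAvg]
  rw [Finset.expect_comm]
  simp_rw [expect_add_right]
  exact Fintype.expect_const _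

theorem norm_expect_pow_le_gowers (v : G) (s : ℕ) (F : G → ℂ) :
    ‖𝔼 x, F x‖ ^ 2 ^ (s + 1) ≤ gowers p v s F := by
  induction s generalizing F with
  | zero =>
    rw [← expect_lineAvg (p := p) v F]
    simpa [gowers] using norm_sq_expect_le (b := fun _ : G => 1) (u := lineAvg p v F) (by simp)
  | succ s ih =>
    have h1 : ‖𝔼 x, F x‖ ^ 2 ≤ 𝔼 a : ZMod p, ‖𝔼 x, mulDiff p v a F x‖ := by
      have h := van_der_corput (b := fun _ : G => 1) (by simp)
        (fun x (n : ZMod p) => F (x + n • v))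
      have e1 : 𝔼 x, (1 : ℂ) * 𝔼 n : ZMod p, F (x + n • v) = 𝔼 x, F x := by
        simp_rw [one_mul]; exact expect_lineAvg v F
      rw [e1] at h
      refine h.trans_eq (Finset.expect_congr rfl fun a _ => ?_)
      rw [← expect_lineAvg (p := p) v (mulDiff p v a F)]
      simp only [lineAvg, mulDiff, add_smul, add_assoc]
    calc ‖𝔼 x, F x‖ ^ 2 ^ (s + 1 + 1) = (‖𝔼 x, F x‖ ^ 2) ^ 2 ^ (s + 1) := by
          rw [← pow_mul, ← pow_succ']
      _ ≤ (𝔼 a : ZMod p, ‖𝔼 x, mulDiff p v a F x‖) ^ 2 ^ (s + 1) := by gcongr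
      _ ≤ 𝔼 a : ZMod p, ‖𝔼 x, mulDiff p v a F x‖ ^ 2 ^ (s + 1) :=
          expect_pow_two_pow_le (fun _ => norm_nonneg _) _
      _ ≤ _ := expect_mono fun a => ih _

end Gowers

/-! ### Linear averages -/

section Linear

variable {p : ℕ} [Fact p.Prime] {G : Type*} [AddCommGroup G] [Module (ZMod p) G] [Fintype G]

theorem norm_prod_le_one {ι : Type*} (s : Finset ι) {f : ι → ℂ} (hf : ∀ i, ‖f i‖ ≤ 1) :
    ‖∏ i ∈ s, f i‖ ≤ 1 := by
  rw [norm_prod]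
  exact Finset.prod_le_one (fun i _ => norm_nonneg _) fun i _ => hf i

theorem pow_two_pow_succ (x : ℝ) (m : ℕ) : x ^ 2 ^ (m + 1) = (x ^ 2) ^ 2 ^ m := by
  rw [← pow_mul, ← pow_succ']

theorem expect_mul_left {M : Type*} [AddCommMonoid M] [Module ℚ≥0 M] {c : ZMod p} (hc : c ≠ 0)
    (f : ZMod p → M) : 𝔼 y, f (c * y) = 𝔼 y, f y :=
  Fintype.expect_equiv (Equiv.mulLeft₀ c hc) _ _ fun _ => rfl

/-- Substitution `x ↦ x - a y` in a double average. -/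
theorem expect_expect_sub {α M : Type*} [Fintype α] [AddCommMonoid M] [Module ℚ≥0 M]
    (a : α → G) (F : G → α → M) : 𝔼 x, 𝔼 y, F x y = 𝔼 x, 𝔼 y, F (x - a y) y := by
  rw [Finset.expect_comm, Finset.expect_comm (f := fun x y => F (x - a y) y)]
  refine Finset.expect_congr rfl fun y _ => ?_
  simp_rw [sub_eq_add_neg]
  exact (expect_add_right (fun x => F x y) _).symm

theorem norm_linear_pow_le {ι : Type*} (v : G) (J : Finset ι) (l : ι → ZMod p) (l₀ : ZMod p)
    (hl : ∀ j ∈ J, l j ≠ l₀) (f : G → ℂ) (g : ι → G → ℂ) (hg : ∀ j x, ‖g j x‖ ≤ 1)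
    {s : ℕ} (hs : #J ≤ s) :
    ‖𝔼 x, 𝔼 y : ZMod p, f (x + (l₀ * y) • v) * ∏ j ∈ J, g j (x + (l j * y) • v)‖ ^ 2 ^ (s + 1)
      ≤ gowers p v s f := by
  classical
  induction J using Finset.induction_on generalizing f g s l l₀ with
  | empty =>
    have : 𝔼 x, 𝔼 y : ZMod p, f (x + (l₀ * y) • v) * ∏ j ∈ ∅, g j (x + (l j * y) • v)
        = 𝔼 x, f x := by
      simp only [Finset.prod_empty, mul_one]
      rw [Finset.expect_comm]
      simp_rw [expect_add_right]
      exact Fintype.expect_const _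
    rw [this]
    exact norm_expect_pow_le_gowers v s f
  | insert j₀ J hj₀ ih =>
    rw [Finset.card_insert_of_notMem hj₀] at hs
    obtain ⟨s, rfl⟩ : ∃ s', s = s' + 1 := ⟨s - 1, by omega⟩
    have hμ : l₀ - l j₀ ≠ 0 := sub_ne_zero.2 (hl j₀ (by simp)).symm
    have e1 : 𝔼 x, 𝔼 y : ZMod p, f (x + (l₀ * y) • v) *
        ∏ j ∈ insert j₀ J, g j (x + (l j * y) • v) =
        𝔼 x, g j₀ x * 𝔼 y : ZMod p, f (x + ((l₀ - l j₀) * y) • v) *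
          ∏ j ∈ J, g j (x + ((l j - l j₀) * y) • v) := by
      rw [expect_expect_sub (fun y : ZMod p => (l j₀ * y) • v)]
      refine Finset.expect_congr rfl fun x _ => ?_
      rw [Finset.mul_expect]
      refine Finset.expect_congr rfl fun y _ => ?_
      rw [Finset.prod_insert hj₀, sub_add_cancel]
      have : ∀ c : ZMod p, x - (l j₀ * y) • v + (c * y) • v = x + ((c - l j₀) * y) • v := by
        intro c; rw [sub_mul, sub_smul]; abel
      simp_rw [this]
      ring
    rw [e1, pow_two_pow_succ]
    refine (pow_le_pow_left₀ (by positivity) (van_der_corput (hg j₀) _) _).trans ?_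
    refine (expect_pow_two_pow_le (fun _ => norm_nonneg _) _).trans ?_
    rw [gowers, ← expect_mul_left hμ (fun a => gowers p v s (mulDiff p v a f))]
    refine expect_mono fun h => ?_
    refine le_trans (le_of_eq ?_) (ih (fun j => l j - l j₀) (l₀ - l j₀) ?_
      (mulDiff p v ((l₀ - l j₀) * h) f) (fun j => mulDiff p v ((l j - l j₀) * h) (g j))
      (fun j x => norm_mulDiff_le (hg j) v _ x) (s := s) (by omega))
    · congr 2
      refine Finset.expect_congr rfl fun x _ => Finset.expect_congr rfl fun y _ => ?_
      simp only [mulDiff, map_mul, map_prod, mul_add, add_smul, Finset.prod_mul_distrib, add_assoc]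
      ring
    · intro j hj
      simpa using hl j (by simp [hj])

/-- The standard additive character of `ZMod p`. -/
noncomputable abbrev echar (p : ℕ) [Fact p.Prime] : AddChar (ZMod p) ℂ := ZMod.stdAddChar

theorem norm_echar (x : ZMod p) : ‖echar p x‖ = 1 := AddChar.norm_apply _ _

theorem conj_echar (x : ZMod p) : conj (echar p x) = echar p (-x) :=
  (AddChar.map_neg_eq_conj _ _).symm

open Polynomial in
theorem natDegree_sub_taylor_le {R : Type*} [CommRing R] (q : R[X]) (r : R) {k : ℕ}
    (hq : q.natDegree ≤ k + 1) : (q - taylor r q).natDegree ≤ k := by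
  rw [natDegree_le_iff_coeff_eq_zero]
  intro N hN
  rw [coeff_sub]
  rcases lt_or_eq_of_le (Nat.succ_le_of_lt hN) with h | h
  · rw [coeff_eq_zero_of_natDegree_lt (by omega),
      coeff_eq_zero_of_natDegree_lt (by rw [natDegree_taylor]; omega), sub_zero]
  · rcases hq.lt_or_eq with h' | h'
    · rw [coeff_eq_zero_of_natDegree_lt (by omega),
        coeff_eq_zero_of_natDegree_lt (by rw [natDegree_taylor]; omega), sub_zero]
    · have hN' : N = q.natDegree := by omega
      rw [hN', coeff_taylor_natDegree, coeff_natDegree, sub_self]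

open Polynomial in
theorem norm_linear_phase_pow_le (v : G) {l₀ : ZMod p} (hl : l₀ ≠ 0) (k : ℕ) {s : ℕ}
    (hs : k + 1 ≤ s) (f : G → ℂ) (b : G → ℂ) (hb : ∀ x, ‖b x‖ ≤ 1) (R : G → (ZMod p)[X])
    (hR : ∀ x, (R x).natDegree ≤ k) :
    ‖𝔼 x, b x * 𝔼 y : ZMod p, f (x + (l₀ * y) • v) * echar p ((R x).eval y)‖ ^ 2 ^ (s + 1)
      ≤ gowers p v s f := by
  induction k generalizing s f b R with
  | zero =>
    have hc : ∀ x y, (R x).eval y = (R x).eval 0 := by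
      intro x y
      rw [eq_C_of_natDegree_le_zero (hR x)]; simp
    have := norm_linear_pow_le v ({()} : Finset Unit) (fun _ => (0 : ZMod p)) l₀
      (by simpa using hl.symm) f (fun _ x => b x * echar p ((R x).eval 0)) (by
        intro j x
        simpa [norm_mul, norm_echar] using hb x) (s := s) (by simpa using hs)
    refine le_trans (le_of_eq ?_) this
    congr 2
    refine Finset.expect_congr rfl fun x _ => ?_
    rw [Finset.mul_expect]
    refine Finset.expect_congr rfl fun y _ => ?_
    rw [hc x y]
    simp
    ring
  | succ k ih =>
    obtain ⟨s, rfl⟩ : ∃ s', s = s' + 1 := ⟨s - 1, by omega⟩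
    rw [pow_two_pow_succ]
    refine (pow_le_pow_left₀ (by positivity) (van_der_corput hb _) _).trans ?_
    refine (expect_pow_two_pow_le (fun _ => norm_nonneg _) _).trans ?_
    rw [gowers, ← expect_mul_left hl (fun a => gowers p v s (mulDiff p v a f))]
    refine expect_mono fun h => ?_
    refine le_trans (le_of_eq ?_) (ih (s := s) (by omega) (mulDiff p v (l₀ * h) f) (fun _ => 1)
      (by simp) (fun x => R x - taylor h (R x)) fun x => natDegree_sub_taylor_le _ _ (hR x))
    congr 2
    refine Finset.expect_congr rfl fun x _ => ?_
    rw [one_mul]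
    refine Finset.expect_congr rfl fun y _ => ?_
    rw [eval_sub, taylor_eval, sub_eq_add_neg, AddChar.map_add_eq_mul]
    simp only [mulDiff, map_mul, conj_echar, mul_add, add_smul, add_assoc]
    ring

end Linear

/-! ### Polynomials with leading coefficient along a vector -/

section AlongLead

open Polynomial

variable {p : ℕ} [Fact p.Prime] {G : Type*} [CommRing G] [Algebra (ZMod p) G]

variable (p) in
/-- The polynomial `q` is nonconstant and its leading coefficient is a nonzero multiple of `v`. -/
def AlongLead (v : G) (q : G[X]) : Prop :=
  1 ≤ q.natDegree ∧ ∃ c : ZMod p, c ≠ 0 ∧ q.leadingCoeff = c • v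

theorem AlongLead.add {v : G} {q r : G[X]} (hq : AlongLead p v q) (hr : AlongLead p v r)
    (h : q.natDegree = r.natDegree → q.leadingCoeff + r.leadingCoeff ≠ 0) :
    AlongLead p v (q + r) := by
  obtain ⟨hq1, c, hc, hqc⟩ := hq
  obtain ⟨hr1, c', hc', hrc⟩ := hr
  rcases lt_trichotomy q.natDegree r.natDegree with h' | h' | h'
  · refine ⟨?_, c', hc', ?_⟩
    · rwa [natDegree_add_eq_right_of_natDegree_lt h']
    · rw [leadingCoeff_add_of_degree_lt (degree_lt_degree h'), hrc]
  · have h0 := h h'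
    have hq0 : q ≠ 0 := by rintro rfl; simp at hq1
    have hr0 : r ≠ 0 := by rintro rfl; simp at hr1
    have hdeg : q.degree = r.degree := by
      rw [degree_eq_natDegree hq0, degree_eq_natDegree hr0, h']
    refine ⟨?_, c + c', ?_, ?_⟩
    · have := degree_add_eq_of_leadingCoeff_add_ne_zero h0
      rw [hdeg, max_self] at this
      rwa [natDegree_eq_of_degree_eq this]
    · rintro h1
      rw [hqc, hrc, ← add_smul, h1, zero_smul] at h0
      exact h0 rfl
    · rw [leadingCoeff_add_of_degree_eq hdeg h0, hqc, hrc, add_smul]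
  · refine ⟨?_, c, hc, ?_⟩
    · rwa [natDegree_add_eq_left_of_natDegree_lt h']
    · rw [leadingCoeff_add_of_degree_lt' (degree_lt_degree h'), hqc]

theorem alongLead_taylor_iff {v : G} {q : G[X]} (r : G) :
    AlongLead p v (taylor r q) ↔ AlongLead p v q := by
  rw [AlongLead, AlongLead, natDegree_taylor, leadingCoeff_taylor]

theorem coeff_taylor_of_natDegree_eq_succ {R : Type*} [CommRing R] {q : R[X]} {k : ℕ}
    (hq : q.natDegree = k + 1) (r : R) :
    (taylor r q).coeff k = q.coeff k + (k + 1) * q.leadingCoeff * r := by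
  rw [taylor_coeff, eval_eq_sum_range' (n := 2)
    (lt_of_le_of_lt (natDegree_hasseDeriv_le q k) (by omega))]
  simp [Finset.sum_range_succ, hasseDeriv_coeff, leadingCoeff, hq, add_comm]

theorem natCast_add_one_ne_zero {k : ℕ} (hk : k + 1 < p) : (k : ZMod p) + 1 ≠ 0 := by
  have : ((k + 1 : ℕ) : ZMod p) ≠ 0 := by
    rw [Ne, ZMod.natCast_eq_zero_iff]
    exact Nat.not_dvd_of_pos_of_lt (by omega) hk
  simpa using this

theorem natDegree_leadingCoeff_taylor_sub {v : G} (hv : v ≠ 0) {q : G[X]} {k : ℕ}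
    (hq : q.natDegree = k + 1) (hk : k + 1 < p) {c : ZMod p} (hc : c ≠ 0)
    (hqc : q.leadingCoeff = c • v) {h : ZMod p} (hh : h ≠ 0) :
    (taylor (algebraMap (ZMod p) G h) q - q).natDegree = k ∧
      (taylor (algebraMap (ZMod p) G h) q - q).leadingCoeff = ((k + 1) * c * h) • v := by
  have hcast := natCast_add_one_ne_zero hk
  have hcoeff : (taylor (algebraMap (ZMod p) G h) q - q).coeff k = ((k + 1) * c * h) • v := by
    rw [coeff_sub, coeff_taylor_of_natDegree_eq_succ hq, hqc, add_sub_cancel_left]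
    simp only [Algebra.smul_def, map_mul, map_add, map_one, map_natCast]
    ring
  have hne : ((k + 1) * c * h) • v ≠ 0 := smul_ne_zero (by simp [hcast, hc, hh]) hv
  have hdeg : (taylor (algebraMap (ZMod p) G h) q - q).natDegree = k := by
    refine le_antisymm ?_ (le_natDegree_of_ne_zero (hcoeff ▸ hne))
    rw [← neg_sub, natDegree_neg]
    exact natDegree_sub_taylor_le _ _ hq.le
  refine ⟨hdeg, ?_⟩
  rw [leadingCoeff, hdeg, hcoeff]

theorem exists_forall_alongLead_taylor_sub {v : G} (hv : v ≠ 0) {q r : G[X]}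
    (hq : AlongLead p v q) (h2 : 2 ≤ q.natDegree) (hp : q.natDegree < p)
    (hr : r = q ∨ AlongLead p v (q - r)) :
    ∃ h₀ : ZMod p, ∀ h, h ≠ 0 → h ≠ h₀ →
      AlongLead p v (taylor (algebraMap (ZMod p) G h) q - r) := by
  obtain ⟨k, hk⟩ : ∃ k, q.natDegree = k + 1 := ⟨q.natDegree - 1, by omega⟩
  obtain ⟨-, c, hc, hqc⟩ := hq
  have hcast := natCast_add_one_ne_zero (hk ▸ hp : k + 1 < p)
  have key : ∀ h : ZMod p, h ≠ 0 →
      AlongLead p v (taylor (algebraMap (ZMod p) G h) q - q) := fun h hh => by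
    obtain ⟨h3, h4⟩ := natDegree_leadingCoeff_taylor_sub hv hk (hk ▸ hp) hc hqc hh
    exact ⟨by omega, _, by simp [hcast, hc, hh], h4⟩
  rcases hr with rfl | hr
  · exact ⟨0, fun h hh _ => key h hh⟩
  · obtain ⟨-, c', hc', hrc⟩ := id hr
    refine ⟨-c' / ((k + 1) * c), fun h hh hh' => ?_⟩
    have := hr.add (key h hh) fun _ h0 => ?_
    · convert this using 1; ring
    · rw [hrc, (natDegree_leadingCoeff_taylor_sub hv hk (hk ▸ hp) hc hqc hh).2, ← add_smul,
        smul_eq_zero, or_iff_left hv] at h0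
      apply hh'
      field_simp
      linear_combination h0

end AlongLead

/-! ### PET induction -/

section PET

open Polynomial

variable {p : ℕ} [Fact p.Prime] {G : Type*} [CommRing G] [Algebra (ZMod p) G]
  {ι : Type*}

variable (p) in
/-- The polynomial average of the functions `g` along the polynomials `a`. -/
noncomputable def polyOp [Fintype ι] [Fintype G] (a : ι → G[X]) (g : ι → G → ℂ) : ℂ :=
  𝔼 x, 𝔼 y : ZMod p, ∏ j, g j (x + (a j).eval (algebraMap (ZMod p) G y))

variable (p) in
/-- The family `a` can be differenced until only the function with index `i₀` remains, which is
then differenced in the direction `v`. -/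
structure Nondeg (v : G) (a : ι → G[X]) (i₀ : ι) : Prop where
  lead : AlongLead p v (a i₀)
  sub : ∀ j, j ≠ i₀ → AlongLead p v (a i₀ - a j)
  natDegree_le : ∀ j, (a j).natDegree ≤ (a i₀).natDegree

/-- The member `a j` or its translate by `h`. -/
noncomputable def shiftIf (a : ι → G[X]) (h : G) (j : ι) (b : Bool) : G[X] :=
  if b then taylor h (a j) else a j

/-- The family obtained from `a` by van der Corput differencing, relative to the member `j₀`. -/
noncomputable def petFamily (a : ι → G[X]) (j₀ : ι) (h : G) :
    {j // (a j).natDegree ≠ 0} × Bool → G[X] :=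
  fun q => shiftIf a h q.1 q.2 - a j₀

/-- The functions accompanying a differenced family. -/
noncomputable def conjIf {X : Type*} (g : ι → X → ℂ) (q : ι × Bool) (x : X) : ℂ :=
  if q.2 then conj (g q.1 x) else g q.1 x

theorem norm_conjIf {X : Type*} (g : ι → X → ℂ) (q : ι × Bool) (x : X) :
    ‖conjIf g q x‖ = ‖g q.1 x‖ := by
  rw [conjIf]; split_ifs <;> simp

theorem natDegree_shiftIf (a : ι → G[X]) (h : G) (j : ι) (b : Bool) :
    (shiftIf a h j b).natDegree = (a j).natDegree := by
  rw [shiftIf]; split_ifs <;> simp [natDegree_taylor]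

theorem leadingCoeff_shiftIf (a : ι → G[X]) (h : G) (j : ι) (b : Bool) :
    (shiftIf a h j b).leadingCoeff = (a j).leadingCoeff := by
  rw [shiftIf]; split_ifs <;> simp [leadingCoeff_taylor]

theorem norm_polyOp_sq_le [Fintype ι] [Fintype G] (a : ι → G[X])
    [Fintype {j // (a j).natDegree ≠ 0}] (g : ι → G → ℂ)
    (hg : ∀ j x, ‖g j x‖ ≤ 1) (j₀ : ι) :
    ‖polyOp p a g‖ ^ 2 ≤ 𝔼 h : ZMod p, ‖polyOp p (petFamily a j₀ (algebraMap (ZMod p) G h))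
      fun q => conjIf g (q.1, q.2)‖ := by
  classical
  have e1 : polyOp p a g = 𝔼 x, (∏ j : {j // ¬ (a j).natDegree ≠ 0}, g j (x + (a j).coeff 0)) *
      𝔼 y : ZMod p, ∏ j : {j // (a j).natDegree ≠ 0},
        g j (x + (a j).eval (algebraMap (ZMod p) G y)) := by
    refine Finset.expect_congr rfl fun x _ => ?_
    rw [Finset.mul_expect]
    refine Finset.expect_congr rfl fun y _ => ?_
    rw [← Fintype.prod_subtype_mul_prod_subtype (fun j => (a j).natDegree ≠ 0), mul_comm]
    congr 1
    · refine Finset.prod_congr rfl fun j _ => ?_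
      have : (a j).natDegree = 0 := not_not.1 j.2
      rw [eq_C_of_natDegree_eq_zero this]
      simp
    · exact Finset.prod_congr (by ext; simp) fun j _ => rfl
  rw [e1]
  refine (van_der_corput (fun x => norm_prod_le_one _ fun j => hg _ _) _).trans_eq ?_
  refine Finset.expect_congr rfl fun h _ => ?_
  congr 1
  rw [expect_expect_sub (fun y : ZMod p => (a j₀).eval (algebraMap (ZMod p) G y))]
  refine Finset.expect_congr rfl fun x _ => Finset.expect_congr rfl fun y _ => ?_
  rw [map_prod, ← Finset.prod_mul_distrib, Fintype.prod_prod_type]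
  refine Finset.prod_congr rfl fun j _ => ?_
  simp only [Fintype.prod_bool, petFamily, shiftIf, conjIf, if_true, eval_sub, taylor_eval,
    Bool.false_eq_true, if_false, map_add]
  rw [mul_comm]
  congr 2
  · congr 1; ring_nf
  · ring_nf

/-- The leading coefficients of the members of degree `e`. -/
def leadSet (a : ι → G[X]) (e : ℕ) : Set G :=
  {l | ∃ j, (a j).natDegree = e ∧ (a j).leadingCoeff = l}

theorem ncard_leadSet_le [Fintype ι] (a : ι → G[X]) (e : ℕ) :
    (leadSet a e).ncard ≤ Fintype.card ι := by
  have : leadSet a e = (fun j => (a j).leadingCoeff) '' {j | (a j).natDegree = e} := by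
    ext l; simp [leadSet]
  rw [this]
  refine (Set.ncard_image_le (Set.toFinite _)).trans ?_
  rw [← Nat.card_eq_fintype_card, ← Set.ncard_univ]
  exact Set.ncard_le_ncard (Set.subset_univ _)

theorem leadSet_petFamily_of_lt {a : ι → G[X]} {j₀ : ι} {e : ℕ}
    (he : (a j₀).natDegree < e) (h : G) : leadSet (petFamily a j₀ h) e = leadSet a e := by
  ext l
  constructor
  · rintro ⟨⟨j, b⟩, h1, h2⟩
    have hlt : (a j₀).natDegree < (shiftIf a h j b).natDegree := by
      by_contra! hle
      have := natDegree_sub_le (shiftIf a h j b) (a j₀)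
      rw [max_eq_right hle] at this
      simp only [petFamily] at h1
      omega
    refine ⟨j, ?_, ?_⟩
    · rw [← natDegree_shiftIf a h j b, ← natDegree_sub_eq_left_of_natDegree_lt hlt]
      exact h1
    · rw [← leadingCoeff_shiftIf a h j b, ← leadingCoeff_sub_of_degree_lt (degree_lt_degree hlt)]
      exact h2
  · rintro ⟨j, rfl, h2⟩
    refine ⟨(⟨j, by omega⟩, false), ?_, ?_⟩
    · simp only [petFamily, shiftIf, Bool.false_eq_true, if_false]
      exact natDegree_sub_eq_left_of_natDegree_lt he
    · simp only [petFamily, shiftIf, Bool.false_eq_true, if_false]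
      rw [leadingCoeff_sub_of_degree_lt (degree_lt_degree he), h2]

theorem ncard_leadSet_petFamily_lt [Finite ι] {a : ι → G[X]} {j₀ : ι} (h0 : (a j₀).natDegree ≠ 0)
    (hmin : ∀ j, (a j).natDegree ≠ 0 → (a j₀).natDegree ≤ (a j).natDegree) (h : G) :
    (leadSet (petFamily a j₀ h) (a j₀).natDegree).ncard <
      (leadSet a (a j₀).natDegree).ncard := by
  set e := (a j₀).natDegree with he
  have hfin : (leadSet a e).Finite :=
    (Set.toFinite (Set.range fun j => (a j).leadingCoeff)).subset fun l ⟨j, _, hj⟩ => ⟨j, hj⟩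
  have hsub : leadSet (petFamily a j₀ h) e ⊆
      (fun l => l - (a j₀).leadingCoeff) '' (leadSet a e \ {(a j₀).leadingCoeff}) := by
    rintro l ⟨⟨j, b⟩, h1, h2⟩
    simp only [petFamily] at h1 h2
    have hge : e ≤ (shiftIf a h j b).natDegree := natDegree_shiftIf a h j b ▸ hmin j j.2
    have heq : (shiftIf a h j b).natDegree = e := by
      refine le_antisymm ?_ hge
      by_contra! hlt
      rw [natDegree_sub_eq_left_of_natDegree_lt (he ▸ hlt)] at h1
      omega
    have hl : l = (a j).leadingCoeff - (a j₀).leadingCoeff := by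
      rw [← h2, leadingCoeff, h1, coeff_sub]
      congr 1
      rw [← leadingCoeff_shiftIf a h j b, leadingCoeff, heq]
    refine ⟨(a j).leadingCoeff, ⟨⟨j, by rw [← natDegree_shiftIf a h j b, heq], rfl⟩, ?_⟩, hl.symm⟩
    intro h3
    rw [Set.mem_singleton_iff] at h3
    rw [h3, sub_self] at hl
    rw [hl, leadingCoeff_eq_zero] at h2
    rw [h2, natDegree_zero] at h1
    exact h0 h1.symm
  calc _ ≤ _ := Set.ncard_le_ncard hsub ((hfin.sdiff).image _)
    _ ≤ _ := Set.ncard_image_le hfin.sdiff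
    _ < _ := Set.ncard_sdiff_singleton_lt_of_mem ⟨j₀, he.symm, rfl⟩ hfin

/-- The numbers of leading coefficients of the members, by decreasing degree. -/
noncomputable def petType (d : ℕ) (a : ι → G[X]) : Lex (Fin d → ℕ) :=
  toLex fun i => (leadSet a (d - i)).ncard

theorem petType_petFamily_lt [Finite ι] {d : ℕ} {a : ι → G[X]} {j₀ : ι}
    (h0 : (a j₀).natDegree ≠ 0) (hd : (a j₀).natDegree ≤ d)
    (hmin : ∀ j, (a j).natDegree ≠ 0 → (a j₀).natDegree ≤ (a j).natDegree) (h : G) :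
    petType d (petFamily a j₀ h) < petType d a := by
  refine ⟨⟨d - (a j₀).natDegree, by omega⟩, fun i hi => ?_, ?_⟩
  · simp only [petType]
    have : (i : ℕ) < d - (a j₀).natDegree := hi
    exact congrArg Set.ncard (leadSet_petFamily_of_lt (e := d - i) (by omega) h)
  · simp only [petType]
    have := ncard_leadSet_petFamily_lt h0 hmin h
    have e : d - (d - (a j₀).natDegree) = (a j₀).natDegree := by omega
    simpa [e] using this

theorem Nondeg.exists_pivot [Finite ι] {v : G} (hv : v ≠ 0) {a : ι → G[X]} {i₀ : ι}
    (ha : Nondeg p v a i₀) (hp : (a i₀).natDegree < p) :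
    ∃ j₀, (a j₀).natDegree ≠ 0 ∧
      (∀ j, (a j).natDegree ≠ 0 → (a j₀).natDegree ≤ (a j).natDegree) ∧
      ∀ h : ZMod p, h ≠ 0 → ∀ j b, (a j).natDegree ≠ 0 →
        (shiftIf a (algebraMap (ZMod p) G h) j b - a j₀).natDegree ≤
          (shiftIf a (algebraMap (ZMod p) G h) i₀ true - a j₀).natDegree := by
  have hi₀ : (a i₀).natDegree ≠ 0 := by have := ha.lead.1; omega
  obtain ⟨j₁, hj₁, hmin⟩ := Set.exists_min_image {j | (a j).natDegree ≠ 0}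
    (fun j => (a j).natDegree) (Set.toFinite _) ⟨i₀, hi₀⟩
  have upper : ∀ j₀ (h : G) j b, (shiftIf a h j b - a j₀).natDegree ≤ (a i₀).natDegree := by
    intro j₀ h j b
    refine (natDegree_sub_le _ _).trans (max_le ?_ (ha.natDegree_le _))
    rw [natDegree_shiftIf]
    exact ha.natDegree_le _
  rcases (ha.natDegree_le j₁).lt_or_eq with hlt | heq
  · refine ⟨j₁, hj₁, fun j hj => hmin j hj, fun h _ j b _ => (upper j₁ _ j b).trans_eq ?_⟩
    rw [natDegree_sub_eq_left_of_natDegree_lt, natDegree_shiftIf]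
    rwa [natDegree_shiftIf]
  · have hall : ∀ j, (a j).natDegree ≠ 0 → (a j).natDegree = (a i₀).natDegree := fun j hj =>
      le_antisymm (ha.natDegree_le j) (heq ▸ hmin j hj)
    by_cases hex : ∃ j, (a j).natDegree ≠ 0 ∧ (a j).leadingCoeff ≠ (a i₀).leadingCoeff
    · obtain ⟨j₀, hj₀, hl⟩ := hex
      refine ⟨j₀, hj₀, fun j hj => by rw [hall j hj, hall j₀ hj₀],
        fun h _ j b _ => (upper j₀ _ j b).trans (le_natDegree_of_ne_zero ?_)⟩
      rw [coeff_sub, sub_ne_zero, ← natDegree_shiftIf a (algebraMap (ZMod p) G h) i₀ true,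
        coeff_natDegree, leadingCoeff_shiftIf, natDegree_shiftIf, ← hall j₀ hj₀, coeff_natDegree]
      exact hl.symm
    · push Not at hex
      refine ⟨i₀, hi₀, fun j hj => (hall j hj).ge, fun h hh j b hj => ?_⟩
      obtain ⟨k, hk⟩ : ∃ k, (a i₀).natDegree = k + 1 := ⟨(a i₀).natDegree - 1, by omega⟩
      obtain ⟨-, c, hc, hqc⟩ := ha.lead
      have e2 := (natDegree_leadingCoeff_taylor_sub hv hk (hk ▸ hp) hc hqc hh).1
      have e1 : shiftIf a (algebraMap (ZMod p) G h) i₀ true =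
        taylor (algebraMap (ZMod p) G h) (a i₀) := rfl
      rw [e1, e2, natDegree_le_iff_coeff_eq_zero]
      intro N hN
      rw [coeff_sub]
      have hle : (shiftIf a (algebraMap (ZMod p) G h) j b).natDegree ≤ k + 1 := by
        rw [natDegree_shiftIf, ← hk]; exact ha.natDegree_le j
      by_cases hN' : k + 1 < N
      · rw [coeff_eq_zero_of_natDegree_lt (by omega), coeff_eq_zero_of_natDegree_lt (by omega),
          sub_zero]
      · obtain rfl : N = k + 1 := by omega
        rw [sub_eq_zero, ← hk, coeff_natDegree, ← hex j hj, ← leadingCoeff_shiftIf a _ j b,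
          leadingCoeff, natDegree_shiftIf, hall j hj]

end PET

section PET

open Polynomial

variable {p : ℕ} [Fact p.Prime] {G : Type*} [CommRing G] [Algebra (ZMod p) G]
  {ι : Type*}

/-- Off a small set of shifts `h`, the differences of the translated special member with the other
members are still along `v`. -/
theorem Nondeg.exists_bad_shifts [Fintype ι] {v : G} (hv : v ≠ 0) {a : ι → G[X]} {i₀ : ι}
    (ha : Nondeg p v a i₀) (h2 : 2 ≤ (a i₀).natDegree) (hp : (a i₀).natDegree < p) :
    ∃ B : Finset (ZMod p), #B ≤ Fintype.card ι + 1 ∧ ∀ h, h ∉ B → h ≠ 0 ∧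
      ∀ j b, (j, b) ≠ (i₀, true) →
        AlongLead p v (shiftIf a (algebraMap (ZMod p) G h) i₀ true -
          shiftIf a (algebraMap (ZMod p) G h) j b) := by
  classical
  have : ∀ j, ∃ h₀ : ZMod p, ∀ h, h ≠ 0 → h ≠ h₀ →
      AlongLead p v (taylor (algebraMap (ZMod p) G h) (a i₀) - a j) := fun j =>
    exists_forall_alongLead_taylor_sub hv ha.lead h2 hp (by
      by_cases hj : j = i₀
      · exact Or.inl (by rw [hj])
      · exact Or.inr (ha.sub j hj))
  choose H hH using this
  refine ⟨insert 0 (univ.image H), (card_insert_le _ _).trans ?_, fun h hh => ?_⟩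
  · gcongr
    exact card_image_le
  · simp only [mem_insert, mem_image, mem_univ, true_and, not_or, not_exists] at hh
    refine ⟨hh.1, fun j b hjb => ?_⟩
    cases b with
    | false => exact hH j h hh.1 fun h' => hh.2 j h'.symm
    | true =>
      have hj : j ≠ i₀ := by rintro rfl; exact hjb rfl
      have : shiftIf a (algebraMap (ZMod p) G h) i₀ true - shiftIf a (algebraMap (ZMod p) G h) j true
          = taylor (algebraMap (ZMod p) G h) (a i₀ - a j) := by
        simp [shiftIf]
      rw [this, alongLead_taylor_iff]
      exact ha.sub j hj

theorem Nondeg.petFamily {v : G} {a : ι → G[X]} {i₀ j₀ : ι} (h0 : (a i₀).natDegree ≠ 0)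
    {h : G}
    (hle : ∀ j b, (a j).natDegree ≠ 0 →
      (shiftIf a h j b - a j₀).natDegree ≤ (shiftIf a h i₀ true - a j₀).natDegree)
    (hsub : ∀ j b, (j, b) ≠ (i₀, true) → AlongLead p v (shiftIf a h i₀ true - shiftIf a h j b)) :
    Nondeg p v (petFamily a j₀ h) (⟨i₀, h0⟩, true) where
  lead := hsub j₀ false (by simp)
  sub := by
    rintro ⟨⟨j, hj⟩, b⟩ hne
    have := hsub j b (by rintro h; simp at h; exact hne (by simp [h]))
    simpa [PolySzemeredi.petFamily] using this
  natDegree_le := fun q => hle q.1 q.2 q.1.2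

theorem norm_polyOp_pow_le_of_natDegree_eq_one [Fintype ι] [Fintype G] {v : G} {a : ι → G[X]}
    {i₀ : ι} (ha : Nondeg p v a i₀) (h1 : (a i₀).natDegree = 1) {g : ι → G → ℂ}
    (hg : ∀ j x, ‖g j x‖ ≤ 1) {s : ℕ} (hs : Fintype.card ι ≤ s) :
    ‖polyOp p a g‖ ^ 2 ^ (s + 1) ≤ gowers p v s (g i₀) := by
  classical
  obtain ⟨-, c, hc, hqc⟩ := ha.lead
  have hle : ∀ j, (a j).natDegree ≤ 1 := fun j => (ha.natDegree_le j).trans h1.le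
  have hlin : ∀ j, ∃ l : ZMod p, (j ≠ i₀ → l ≠ c) ∧ (j = i₀ → l = c) ∧ (a j).coeff 1 = l • v := by
    intro j
    by_cases hj : j = i₀
    · refine ⟨c, by simp [hj], by simp, ?_⟩
      rw [hj, ← hqc, leadingCoeff, h1]
    · obtain ⟨h2, c', hc', hl⟩ := ha.sub j hj
      refine ⟨c - c', fun _ => by simpa using hc', fun h => absurd h hj, ?_⟩
      have h3 : (a i₀ - a j).natDegree = 1 :=
        le_antisymm ((natDegree_sub_le _ _).trans (max_le h1.le (hle j))) h2
      rw [leadingCoeff, h3, coeff_sub] at hl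
      rw [leadingCoeff, h1] at hqc
      rw [sub_smul, ← hl, ← hqc]
      abel
  choose l hl1 hl2 hl3 using hlin
  have heval : ∀ j (y : ZMod p), (a j).eval (algebraMap (ZMod p) G y) =
      (a j).coeff 0 + (l j * y) • v := by
    intro j y
    rw [eval_eq_sum_range' (n := 2) (Nat.lt_succ_of_le (hle j))]
    simp only [Finset.sum_range_succ, Finset.sum_range_zero, zero_add, pow_zero, mul_one, pow_one,
      hl3, Algebra.smul_def, map_mul]
    ring
  have := norm_linear_pow_le v (univ.erase i₀) l c (fun j hj => hl1 j (by simpa using hj))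
    (fun x => g i₀ (x + (a i₀).coeff 0)) (fun j x => g j (x + (a j).coeff 0)) (fun j x => hg _ _)
    (s := s) ((card_le_univ _).trans hs)
  rw [gowers_translate] at this
  refine le_trans (le_of_eq ?_) this
  congr 2
  refine Finset.expect_congr rfl fun x _ => Finset.expect_congr rfl fun y _ => ?_
  rw [← Finset.mul_prod_erase univ _ (mem_univ i₀), ← hl2 i₀ rfl]
  simp_rw [heval]
  congr 1
  · congr 1; abel
  · refine Finset.prod_congr rfl fun j _ => ?_
    congr 1; abel

end PET

theorem norm_polyOp_le_one {p : ℕ} [Fact p.Prime] {G : Type*} [CommRing G] [Algebra (ZMod p) G]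
    {ι : Type*} [Fintype ι] [Fintype G] (a : ι → Polynomial G) {g : ι → G → ℂ}
    (hg : ∀ j x, ‖g j x‖ ≤ 1) : ‖polyOp p a g‖ ≤ 1 :=
  norm_expect_le_one fun _ => norm_expect_le_one fun _ => norm_prod_le_one _ fun _ => hg _ _

/-- If a quantity in `[0, 1]` is controlled off a small exceptional set, so is its average. -/
theorem expect_le_of_forall_notMem {p : ℕ} [Fact p.Prime] {Y : ZMod p → ℝ} (B : Finset (ZMod p))
    {n : ℕ} (hB : #B ≤ n) {r : ℝ} (hr : 0 ≤ r) (h1 : ∀ h, Y h ≤ 1) (hY : ∀ h, h ∉ B → Y h ≤ r) :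
    𝔼 h, Y h ≤ n * (1 / p) + r := by
  classical
  have hp : (0 : ℝ) < p := by exact_mod_cast (Fact.out : p.Prime).pos
  calc 𝔼 h, Y h ≤ 𝔼 h, ((if h ∈ B then 1 else 0) + r) := expect_mono fun h => by
        split_ifs with hh
        · linarith [h1 h]
        · linarith [hY h hh]
    _ = #B * (1 / p) + r := by
        rw [Finset.expect_add_distrib, Fintype.expect_const]
        congr 1
        rw [Fintype.expect_eq_sum_div_card]
        simp [ZMod.card, div_eq_mul_inv]
    _ ≤ _ := by gcongr

/-- The estimate provided by PET induction for families of type `τ`. -/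
def PETBound (d n s m : ℕ) (A : ℝ) (τ : Lex (Fin d → ℕ)) : Prop :=
  ∀ (p : ℕ) [Fact p.Prime] (G : Type) [CommRing G] [Algebra (ZMod p) G] [Fintype G]
    (ι : Type) [Fintype ι] (v : G) (a : ι → Polynomial G) (i₀ : ι) (g : ι → G → ℂ),
    v ≠ 0 → d < p → Fintype.card ι ≤ n → (a i₀).natDegree ≤ d → Nondeg p v a i₀ →
    (∀ j x, ‖g j x‖ ≤ 1) → petType d a = τ →
    ‖polyOp p a g‖ ^ 2 ^ m ≤ A * (gowers p v s (g i₀) + 1 / p)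

open Filter in
theorem eventually_petBound (d : ℕ) (τ : Lex (Fin d → ℕ)) (n : ℕ) :
    ∀ᶠ s in atTop, ∀ᶠ m in atTop, ∀ᶠ A in atTop, PETBound d n s m A τ := by
  classical
  induction τ using WellFoundedLT.induction generalizing n with
  | ind τ ih =>
    set S : Set (Lex (Fin d → ℕ)) := {σ | σ < τ ∧ ∀ i, σ i ≤ 2 * n} with hS
    have hfin : S.Finite := by
      refine (Set.Finite.subset (Set.Finite.pi' (fun _ : Fin d => Set.finite_Iic (2 * n)))
        (fun σ hσ => ?_ : (S : Set (Fin d → ℕ)) ⊆ _))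
      exact fun i => hσ.2 i
    have h1 : ∀ᶠ s in atTop, ∀ σ ∈ S, ∀ᶠ m in atTop, ∀ᶠ A in atTop,
        PETBound d (2 * n) s m A σ :=
      (eventually_all_finite hfin).2 fun σ hσ => ih σ hσ.1 (2 * n)
    filter_upwards [h1, eventually_ge_atTop n] with s hs hsn
    have h2 : ∀ᶠ m in atTop, ∀ σ ∈ S, ∀ᶠ A in atTop, PETBound d (2 * n) s m A σ :=
      (eventually_all_finite hfin).2 hs
    filter_upwards [(tendsto_sub_atTop_nat 1).eventually h2, eventually_ge_atTop (s + 1)]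
      with m hm hms
    have h3 : ∀ᶠ A in atTop, ∀ σ ∈ S, PETBound d (2 * n) s (m - 1) A σ :=
      (eventually_all_finite hfin).2 hm
    filter_upwards [(tendsto_atTop_add_const_right atTop (-(n + 1 : ℝ)) tendsto_id).eventually h3,
      eventually_ge_atTop (1 : ℝ), eventually_ge_atTop (n + 1 : ℝ)] with A hA hA1 hAn
    intro p _ G _ _ _ ι _ v a i₀ g hv hdp hcard hdeg ha hg hτ
    have hp : (0 : ℝ) < p := by exact_mod_cast (Fact.out : p.Prime).pos
    have hN := gowers_nonneg (p := p) v s (g i₀)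
    have hX := norm_polyOp_le_one (p := p) a hg
    by_cases hone : (a i₀).natDegree = 1
    · calc ‖polyOp p a g‖ ^ 2 ^ m ≤ ‖polyOp p a g‖ ^ 2 ^ (s + 1) :=
            pow_le_pow_of_le_one (norm_nonneg _) hX (Nat.pow_le_pow_right (by norm_num) hms)
        _ ≤ gowers p v s (g i₀) :=
            norm_polyOp_pow_le_of_natDegree_eq_one ha hone hg (hcard.trans hsn)
        _ ≤ gowers p v s (g i₀) + 1 / p := by have : (0 : ℝ) ≤ 1 / p := by positivity
                                              linarith
        _ ≤ _ := le_mul_of_one_le_left (by positivity) hA1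
    · have h2 : 2 ≤ (a i₀).natDegree := by have := ha.lead.1; omega
      have h0 : (a i₀).natDegree ≠ 0 := by omega
      obtain ⟨j₀, hj₀, hmin, hle⟩ := ha.exists_pivot hv (by omega)
      obtain ⟨B, hBcard, hB⟩ := ha.exists_bad_shifts hv h2 (by omega)
      obtain ⟨m, rfl⟩ : ∃ m', m = m' + 1 := ⟨m - 1, by omega⟩
      rw [pow_two_pow_succ]
      refine (pow_le_pow_left₀ (by positivity) (norm_polyOp_sq_le a g hg j₀) _).trans ?_
      refine (expect_pow_two_pow_le (fun _ => norm_nonneg _) _).trans ?_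
      have hg' : ∀ (q : {j // (a j).natDegree ≠ 0} × Bool) x, ‖conjIf g (q.1, q.2) x‖ ≤ 1 :=
        fun q x => (norm_conjIf g _ x).trans_le (hg _ _)
      have hcard' : Fintype.card ({j // (a j).natDegree ≠ 0} × Bool) ≤ 2 * n := by
        rw [Fintype.card_prod, Fintype.card_bool, mul_comm]
        exact Nat.mul_le_mul_left 2 ((Fintype.card_subtype_le _).trans hcard)
      refine (expect_le_of_forall_notMem B (hBcard.trans (Nat.add_le_add_right hcard 1))
        (r := (A + -(n + 1)) * (gowers p v s (g i₀) + 1 / p))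
        (mul_nonneg (by linarith) (by positivity))
        (fun h => pow_le_one₀ (norm_nonneg _) (norm_polyOp_le_one _ hg')) fun h hh => ?_).trans ?_
      · obtain ⟨hh0, hh1⟩ := hB h hh
        have hnd := Nondeg.petFamily h0 (hle h hh0) hh1
        have key := hA (petType d (petFamily a j₀ (algebraMap (ZMod p) G h))) ⟨?_, fun i => ?_⟩
          p G ({j // (a j).natDegree ≠ 0} × Bool) v _ (⟨i₀, h0⟩, true)
          (fun q => conjIf g (q.1, q.2)) hv hdp hcard' ?_ hnd hg' rfl
        · have e : gowers p v s (conjIf g (i₀, true)) = gowers p v s (g i₀) := gowers_conj v s _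
          rw [e] at key
          simpa using key
        · rw [← hτ]
          exact petType_petFamily_lt hj₀ ((ha.natDegree_le _).trans hdeg) hmin _
        · exact (ncard_leadSet_le _ _).trans hcard'
        · refine (Polynomial.natDegree_sub_le_of_le (le_of_eq (natDegree_shiftIf _ _ _ _))
            (ha.natDegree_le j₀)).trans ?_
          simpa using hdeg
      · push_cast
        have : (0 : ℝ) ≤ (n + 1) * gowers p v s (g i₀) := by positivity
        nlinarith

section PET

open Polynomial

open Filter in
theorem exists_norm_polyOp_pow_le (d n : ℕ) : ∃ (s m : ℕ) (A : ℝ), 0 ≤ A ∧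
    ∀ (p : ℕ) [Fact p.Prime] (G : Type) [CommRing G] [Algebra (ZMod p) G] [Fintype G]
      (ι : Type) [Fintype ι] (v : G) (a : ι → G[X]) (i₀ : ι) (g : ι → G → ℂ),
      v ≠ 0 → d < p → Fintype.card ι ≤ n → (a i₀).natDegree ≤ d → Nondeg p v a i₀ →
      (∀ j x, ‖g j x‖ ≤ 1) →
      ‖polyOp p a g‖ ^ 2 ^ m ≤ A * (gowers p v s (g i₀) + 1 / p) := by
  set S : Set (Lex (Fin d → ℕ)) := {σ | ∀ i, σ i ≤ n} with hS
  have hfin : S.Finite := by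
    refine (Set.Finite.subset (Set.Finite.pi' (fun _ : Fin d => Set.finite_Iic n))
      (fun σ hσ => ?_ : (S : Set (Fin d → ℕ)) ⊆ _))
    exact fun i => hσ i
  obtain ⟨s, hs⟩ := ((eventually_all_finite hfin).2
    fun σ _ => eventually_petBound d σ n).exists
  obtain ⟨m, hm⟩ := ((eventually_all_finite hfin).2 hs).exists
  obtain ⟨A, hA, hA0⟩ := (((eventually_all_finite hfin).2 hm).and (eventually_ge_atTop 0)).exists
  refine ⟨s, m, A, hA0, fun p _ G _ _ _ ι _ v a i₀ g hv hdp hcard hdeg ha hg => ?_⟩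
  exact hA (petType d a) (fun i => (ncard_leadSet_le _ _).trans hcard) p G ι v a i₀ g hv hdp hcard
    hdeg ha hg rfl

/-- PET induction with an additional polynomial phase whose coefficients depend on the base
point. -/
theorem exists_norm_polyOp_phase_pow_le (d k n : ℕ) : ∃ (s m : ℕ) (A : ℝ), 0 ≤ A ∧
    ∀ (p : ℕ) [Fact p.Prime] (G : Type) [CommRing G] [Algebra (ZMod p) G] [Fintype G]
      (ι : Type) [Fintype ι] (v : G) (a : ι → G[X]) (i₀ : ι) (g : ι → G → ℂ) (b : G → ℂ)
      (R : G → (ZMod p)[X]),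
      v ≠ 0 → d < p → Fintype.card ι ≤ n → 2 ≤ (a i₀).natDegree → (a i₀).natDegree ≤ d →
      Nondeg p v a i₀ → (∀ j x, ‖g j x‖ ≤ 1) → (∀ x, ‖b x‖ ≤ 1) → (∀ x, (R x).natDegree ≤ k) →
      ‖𝔼 x, b x * 𝔼 y : ZMod p, (∏ j, g j (x + (a j).eval (algebraMap (ZMod p) G y))) *
        echar p ((R x).eval y)‖ ^ 2 ^ m ≤ A * (gowers p v s (g i₀) + 1 / p) := by
  induction k generalizing n with
  | zero =>
    obtain ⟨s, m, A, hA, H⟩ := exists_norm_polyOp_pow_le d (n + 1)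
    refine ⟨s, m, A, hA, fun p _ G _ _ _ ι _ v a i₀ g b R hv hdp hcard h2 hdeg ha hg hb hR => ?_⟩
    have hc : ∀ x y, (R x).eval y = (R x).eval 0 := by
      intro x y
      rw [eq_C_of_natDegree_le_zero (hR x)]; simp
    have := H p G (Option ι) v (fun o => o.elim 0 a) (some i₀)
      (fun o => o.elim (fun x => b x * echar p ((R x).eval 0)) g) hv hdp
      (by rw [Fintype.card_option]; omega) hdeg
      { lead := ha.lead
        sub := by
          rintro (_ | j) hj
          · simpa using ha.lead
          · exact ha.sub j (by rintro rfl; exact hj rfl)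
        natDegree_le := by
          rintro (_ | j)
          · simp
          · exact ha.natDegree_le j }
      (by
        rintro (_ | j) x
        · simpa [norm_echar] using hb x
        · exact hg j x)
    refine le_trans (le_of_eq ?_) this
    congr 2
    refine Finset.expect_congr rfl fun x _ => ?_
    rw [Finset.mul_expect]
    refine Finset.expect_congr rfl fun y _ => ?_
    rw [Fintype.prod_option, hc x y]
    simp
    ring
  | succ k ih =>
    obtain ⟨s, m, A, hA, H⟩ := ih (2 * n)
    refine ⟨s, m + 1, A + (n + 1 : ℕ), by positivity,
      fun p _ G _ _ _ ι _ v a i₀ g b R hv hdp hcard h2 hdeg ha hg hb hR => ?_⟩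
    have hp : (0 : ℝ) < p := by exact_mod_cast (Fact.out : p.Prime).pos
    have hN := gowers_nonneg (p := p) v s (g i₀)
    obtain ⟨B, hBcard, hB⟩ := ha.exists_bad_shifts hv h2 (by omega)
    rw [pow_two_pow_succ]
    refine (pow_le_pow_left₀ (by positivity) (van_der_corput hb _) _).trans ?_
    refine (expect_pow_two_pow_le (fun _ => norm_nonneg _) _).trans ?_
    refine (expect_le_of_forall_notMem B (hBcard.trans (Nat.add_le_add_right hcard 1))
      (r := A * (gowers p v s (g i₀) + 1 / p)) (by positivity) (fun h => ?_) fun h hh => ?_).trans ?_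
    · refine pow_le_one₀ (norm_nonneg _) (norm_expect_le_one fun x => norm_expect_le_one fun y => ?_)
      simp only [norm_mul, RCLike.norm_conj, norm_echar, mul_one]
      exact mul_le_one₀ (norm_prod_le_one _ fun _ => hg _ _) (norm_nonneg _)
        (norm_prod_le_one _ fun _ => hg _ _)
    · obtain ⟨-, hh1⟩ := hB h hh
      have key := H p G (ι × Bool) v
        (fun q => shiftIf a (algebraMap (ZMod p) G h) q.1 q.2) (i₀, true) (conjIf g) (fun _ => 1)
        (fun x => R x - taylor h (R x)) hv hdp
        (by rw [Fintype.card_prod, Fintype.card_bool]; omega)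
        (by rwa [natDegree_shiftIf]) (by rwa [natDegree_shiftIf])
        { lead := (alongLead_taylor_iff _).2 ha.lead
          sub := fun q hq => hh1 q.1 q.2 hq
          natDegree_le := fun q => by
            simpa only [natDegree_shiftIf] using ha.natDegree_le q.1 }
        (fun q x => (norm_conjIf g q x).trans_le (hg _ _)) (by simp)
        (fun x => natDegree_sub_taylor_le _ _ (hR x))
      have e : gowers p v s (conjIf g (i₀, true)) = gowers p v s (g i₀) := gowers_conj v s _
      rw [e] at key
      refine le_trans (le_of_eq ?_) key
      congr 2
      refine Finset.expect_congr rfl fun x _ => ?_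
      rw [one_mul]
      refine Finset.expect_congr rfl fun y _ => ?_
      rw [Fintype.prod_prod_type, eval_sub, taylor_eval, sub_eq_add_neg, AddChar.map_add_eq_mul,
        map_mul, conj_echar, map_prod]
      simp only [Fintype.prod_bool, shiftIf, conjIf, if_true, taylor_eval,
        Bool.false_eq_true, if_false, map_add, Finset.prod_mul_distrib]
      ring
    · have : (0 : ℝ) ≤ (n + 1 : ℕ) * gowers p v s (g i₀) := by positivity
      nlinarith

/-- The polynomial map `y ↦ P(y) v`. -/
noncomputable def vecPoly {p : ℕ} [Fact p.Prime] {G : Type*} [CommRing G] [Algebra (ZMod p) G]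
    (P : (ZMod p)[X]) (v : G) : G[X] := C v * P.map (algebraMap (ZMod p) G)

section

variable {p : ℕ} [Fact p.Prime] {G : Type*} [CommRing G] [Algebra (ZMod p) G]

theorem eval_vecPoly (P : (ZMod p)[X]) (v : G) (y : ZMod p) :
    (vecPoly P v).eval (algebraMap (ZMod p) G y) = P.eval y • v := by
  rw [vecPoly, eval_mul, eval_C, eval_map, eval₂_at_apply, Algebra.smul_def, mul_comm]

theorem coeff_vecPoly (P : (ZMod p)[X]) (v : G) (n : ℕ) :
    (vecPoly P v).coeff n = P.coeff n • v := by
  rw [vecPoly, coeff_C_mul, coeff_map, Algebra.smul_def, mul_comm]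

theorem natDegree_vecPoly (P : (ZMod p)[X]) {v : G} (hv : v ≠ 0) :
    (vecPoly P v).natDegree = P.natDegree := by
  refine le_antisymm (natDegree_le_iff_coeff_eq_zero.2 fun N hN => ?_) ?_
  · rw [coeff_vecPoly, coeff_eq_zero_of_natDegree_lt hN, zero_smul]
  · by_cases hP : P = 0
    · simp [hP]
    · refine le_natDegree_of_ne_zero ?_
      rw [coeff_vecPoly]
      exact smul_ne_zero (leadingCoeff_ne_zero.2 hP) hv

theorem alongLead_vecPoly {P : (ZMod p)[X]} (hP : 1 ≤ P.natDegree) {v : G} (hv : v ≠ 0) :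
    AlongLead p v (vecPoly P v) := by
  refine ⟨by rwa [natDegree_vecPoly P hv], P.leadingCoeff, ?_, ?_⟩
  · rw [leadingCoeff_ne_zero]
    rintro rfl
    simp at hP
  · rw [leadingCoeff, natDegree_vecPoly P hv, coeff_vecPoly, leadingCoeff]

end

/-- Control of the averages of the counting operator with phases by a Gowers norm of the
function attached to the polynomial of highest degree. -/
theorem exists_norm_counting_pow_le (d e l : ℕ) : ∃ (s m : ℕ) (A : ℝ), 0 ≤ A ∧
    ∀ (p : ℕ) [Fact p.Prime] (G : Type) [CommRing G] [Algebra (ZMod p) G] [Fintype G]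
      (P : ℕ → (ZMod p)[X]) (v : ℕ → G) (f : ℕ → G → ℂ) (b : G → ℂ) (R : G → (ZMod p)[X]),
      d < p → (∀ i, i ≤ l → v i ≠ 0) → (∀ i, i ≤ l → 1 ≤ (P i).natDegree) →
      (∀ i, i < l → (P i).natDegree < (P l).natDegree) → (P l).natDegree = e → e ≤ d →
      (∀ j x, ‖f j x‖ ≤ 1) → (∀ x, ‖b x‖ ≤ 1) → (∀ x, (R x).natDegree ≤ d) →
      ‖𝔼 x, 𝔼 y : ZMod p, b x * (∏ j ∈ range (l + 1), f j (x + (P j).eval y • v j)) *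
        echar p ((R x).eval y)‖ ^ 2 ^ m ≤ A * (gowers p (v l) s (f l) + 1 / p) := by
  by_cases he : 2 ≤ e
  · obtain ⟨s, m, A, hA, H⟩ := exists_norm_polyOp_phase_pow_le d d (l + 1)
    refine ⟨s, m, A, hA, fun p _ G _ _ _ P v f b R hdp hv hP hlt hPe hed hf hb hR => ?_⟩
    have hdeg : ∀ j, j ≤ l → (vecPoly (P j) (v j)).natDegree = (P j).natDegree := fun j hj =>
      natDegree_vecPoly _ (hv j hj)
    have hlead := alongLead_vecPoly (hP l le_rfl) (hv l le_rfl)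
    have key := H p G (Fin (l + 1)) (v l) (fun j => vecPoly (P j) (v j)) (Fin.last l)
      (fun j => f j) b R (hv l le_rfl) hdp (by simp)
      (by rw [Fin.val_last, hdeg l le_rfl, hPe]; exact he)
      (by rw [Fin.val_last, hdeg l le_rfl, hPe]; exact hed)
      { lead := hlead
        sub := fun j hj => by
          have hj' : (j : ℕ) < l := Fin.val_lt_last hj
          have hlt' : (vecPoly (P j) (v j)).natDegree < (vecPoly (P l) (v l)).natDegree := by
            rw [hdeg j hj'.le, hdeg l le_rfl]
            exact hlt j hj'
          obtain ⟨h1, c, hc, hl⟩ := hlead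
          refine ⟨?_, c, hc, ?_⟩
          · rw [Fin.val_last, natDegree_sub_eq_left_of_natDegree_lt hlt']; exact h1
          · rw [Fin.val_last, leadingCoeff_sub_of_degree_lt (degree_lt_degree hlt')]; exact hl
        natDegree_le := fun j => by
          rw [Fin.val_last, hdeg j (Nat.lt_succ_iff.1 j.2), hdeg l le_rfl]
          rcases (Nat.lt_succ_iff.1 j.2).lt_or_eq with h | h
          · exact (hlt j h).le
          · rw [h] }
      (fun j x => hf j x) hb hR
    refine le_trans (le_of_eq ?_) key
    congr 2
    refine Finset.expect_congr rfl fun x _ => ?_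
    rw [Finset.mul_expect]
    refine Finset.expect_congr rfl fun y _ => ?_
    simp_rw [eval_vecPoly]
    rw [Finset.prod_range (fun j => f j (x + (P j).eval y • v j))]
    ring
  · refine ⟨d + 1, d + 2, 1, zero_le_one,
      fun p _ G _ _ _ P v f b R hdp hv hP hlt hPe hed hf hb hR => ?_⟩
    have hPl := hP l le_rfl
    obtain rfl : l = 0 := by
      by_contra h0
      have := hlt 0 (by omega)
      have := hP 0 (by omega)
      omega
    have hlin : ∀ y, (P 0).eval y = (P 0).coeff 0 + (P 0).coeff 1 * y := fun y => by
      rw [eval_eq_sum_range' (n := 2) (by omega)]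
      simp [Finset.sum_range_succ]
    have hc : (P 0).coeff 1 ≠ 0 := by
      have h1 : (P 0).natDegree = 1 := by omega
      rw [← h1, coeff_natDegree, leadingCoeff_ne_zero]
      rintro h; simp [h] at h1
    have key := norm_linear_phase_pow_le (v 0) hc d (s := d + 1) le_rfl
      (fun x => f 0 (x + (P 0).coeff 0 • v 0)) b hb R hR
    rw [gowers_translate] at key
    have h1p : (0 : ℝ) ≤ 1 / p := by positivity
    rw [one_mul]
    refine le_trans (le_of_eq ?_) (key.trans (le_add_of_nonneg_right h1p))
    congr 2
    refine Finset.expect_congr rfl fun x _ => ?_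
    rw [Finset.mul_expect]
    refine Finset.expect_congr rfl fun y _ => ?_
    rw [zero_add, Finset.prod_range_one, hlin, add_smul, add_comm ((P 0).coeff 0 • v 0), ← add_assoc]
    ring

end PET

/-! ### Cubes and the box Cauchy–Schwarz inequality -/

section Cube

variable {α : Type*}

/-- The product of `F`, with conjugations, over the vertices of the cube spanned by `h`
and `k`. -/
noncomputable def cube : (m : ℕ) → ((Fin m → α) → ℂ) → (Fin m → α) → (Fin m → α) → ℂ
  | 0, F, h, _ => F h
  | m + 1, F, h, k =>
    cube m (fun t => F (Fin.cons (h 0) t) * conj (F (Fin.cons (k 0) t))) (Fin.tail h) (Fin.tail k)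

/-- The alternating sum of `φ` over the vertices of the cube spanned by `h` and `k`. -/
def altsum {M : Type*} [AddCommGroup M] :
    (m : ℕ) → ((Fin m → α) → M) → (Fin m → α) → (Fin m → α) → M
  | 0, φ, h, _ => φ h
  | m + 1, φ, h, k =>
    altsum m (fun t => φ (Fin.cons (h 0) t) - φ (Fin.cons (k 0) t)) (Fin.tail h) (Fin.tail k)

theorem cube_mul {m : ℕ} (F F' : (Fin m → α) → ℂ) (h h' : Fin m → α) :
    cube m (fun t => F t * F' t) h h' = cube m F h h' * cube m F' h h' := by
  induction m with
  | zero => rfl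
  | succ m ih =>
    rw [cube, cube, cube, ← ih]
    congr 1
    funext t
    rw [map_mul]
    ring

theorem norm_cube_le {m : ℕ} {F : (Fin m → α) → ℂ} (hF : ∀ t, ‖F t‖ ≤ 1) (h h' : Fin m → α) :
    ‖cube m F h h'‖ ≤ 1 := by
  induction m with
  | zero => exact hF _
  | succ m ih =>
    refine ih (fun t => ?_) _ _
    rw [norm_mul, RCLike.norm_conj]
    exact mul_le_one₀ (hF _) (norm_nonneg _) (hF _)

theorem cube_echar {p : ℕ} [Fact p.Prime] {m : ℕ} (φ : (Fin m → α) → ZMod p) (h h' : Fin m → α) :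
    cube m (fun t => echar p (φ t)) h h' = echar p (altsum m φ h h') := by
  induction m with
  | zero => rfl
  | succ m ih =>
    rw [cube, altsum, ← ih]
    congr 1
    funext t
    rw [conj_echar, sub_eq_add_neg, AddChar.map_add_eq_mul]

theorem altsum_mul_right {R : Type*} [Ring R] {m : ℕ} (φ : (Fin m → α) → R) (c : R)
    (h h' : Fin m → α) : altsum m (fun t => φ t * c) h h' = altsum m φ h h' * c := by
  induction m with
  | zero => rfl
  | succ m ih =>
    rw [altsum, altsum, ← ih]
    simp_rw [sub_mul]

theorem altsum_sum {ι M : Type*} [AddCommGroup M] {m : ℕ} (s : Finset ι)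
    (φ : ι → (Fin m → α) → M) (h h' : Fin m → α) :
    altsum m (fun t => ∑ i ∈ s, φ i t) h h' = ∑ i ∈ s, altsum m (φ i) h h' := by
  induction m with
  | zero => rfl
  | succ m ih =>
    rw [altsum]
    simp_rw [altsum, ← ih, Finset.sum_sub_distrib]

theorem ne_zero_of_cube_ne_zero {m : ℕ} {F : (Fin m → α) → ℂ} {h h' : Fin m → α}
    (hF : cube m F h h' ≠ 0) : F h ≠ 0 := by
  induction m with
  | zero => exact hF
  | succ m ih =>
    have := left_ne_zero_of_mul (ih hF)
    rwa [Fin.cons_self_tail] at this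

/-- The function `B` does not depend on the coordinate `i`. -/
def IndepOf {m : ℕ} {β : Type*} (i : Fin m) (B : (Fin m → α) → β) : Prop :=
  ∀ h a, B (Function.update h i a) = B h

theorem exists_altsum_decomposition {M : Type*} [AddCommGroup M] {m : ℕ} (φ : (Fin m → α) → M)
    (h' : Fin m → α) : ∃ θ : Fin m → (Fin m → α) → M, (∀ i, IndepOf i (θ i)) ∧
      ∀ h, φ h = altsum m φ h h' + ∑ i, θ i h := by
  induction m with
  | zero => exact ⟨fun _ => φ, fun i => i.elim0, fun h => by simp [altsum]⟩
  | succ m ih =>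
    choose Θ hΘ1 hΘ2 using fun a : α =>
      ih (fun t => φ (Fin.cons a t) - φ (Fin.cons (h' 0) t)) (Fin.tail h')
    refine ⟨Fin.cons (fun h => φ (Fin.cons (h' 0) (Fin.tail h)))
      (fun i h => Θ (h 0) i (Fin.tail h)), fun i => ?_, fun h => ?_⟩
    · refine Fin.cases ?_ (fun i => ?_) i
      · intro h a
        simp
      · intro h a
        simp only [Fin.cons_succ, Fin.tail_update_succ]
        rw [Function.update_of_ne (Fin.succ_ne_zero i).symm]
        exact hΘ1 _ i _ _
    · rw [Fin.sum_univ_succ, altsum]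
      simp only [Fin.cons_zero, Fin.cons_succ]
      have := hΘ2 (h 0) (Fin.tail h)
      rw [Fin.cons_self_tail] at this
      rw [add_left_comm, ← this]
      abel

theorem expect_cons {M : Type*} [AddCommMonoid M] [Module ℚ≥0 M] [Fintype α] {m : ℕ}
    (F : (Fin (m + 1) → α) → M) :
    𝔼 h, F h = 𝔼 a, 𝔼 t : Fin m → α, F (Fin.cons a t) := by
  rw [← expect_prod_type (fun z : α × (Fin m → α) => F (Fin.cons z.1 z.2))]
  exact (Fintype.expect_equiv (Fin.consEquiv fun _ => α) _ _ fun _ => rfl).symm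

/-- Cauchy–Schwarz eliminating functions each independent of one coordinate. -/
theorem box_cauchy_schwarz.{u} {α Z : Type u} [Fintype α] {m : ℕ} [Fintype Z]
    (F : Z → (Fin m → α) → ℂ) (B : Fin m → Z → (Fin m → α) → ℂ) (hB : ∀ i z h, ‖B i z h‖ ≤ 1)
    (hind : ∀ i z, IndepOf i (B i z)) :
    ‖𝔼 z, 𝔼 h, F z h * ∏ i, B i z h‖ ^ 2 ^ m ≤ ‖𝔼 z, 𝔼 h, 𝔼 h', cube m (F z) h h'‖ := by
  induction m generalizing Z with
  | zero =>
    rcases isEmpty_or_nonempty α with hα | hα <;> simp [cube]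
  | succ m ih =>
    rcases isEmpty_or_nonempty α with hα | ⟨⟨a₀⟩⟩
    · simp
    have hB0 : ∀ z a t, B 0 z (Fin.cons a t) = B 0 z (Fin.cons a₀ t) := fun z a t => by
      rw [← hind 0 z (Fin.cons a t) a₀, Fin.update_cons_zero]
    set u : Z × (Fin m → α) → α → ℂ := fun q a =>
      F q.1 (Fin.cons a q.2) * ∏ i : Fin m, B i.succ q.1 (Fin.cons a q.2) with hu
    have e1 : 𝔼 z, 𝔼 h, F z h * ∏ i, B i z h =
        𝔼 q : Z × (Fin m → α), B 0 q.1 (Fin.cons a₀ q.2) * 𝔼 a, u q a := by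
      rw [expect_prod_type]
      refine Finset.expect_congr rfl fun z _ => ?_
      rw [expect_cons, Finset.expect_comm]
      refine Finset.expect_congr rfl fun t _ => ?_
      rw [Finset.mul_expect]
      refine Finset.expect_congr rfl fun a _ => ?_
      rw [Fin.prod_univ_succ, hB0, hu]
      ring
    have e2 : ∀ q, ((‖𝔼 a, u q a‖ ^ 2 : ℝ) : ℂ) = 𝔼 a, 𝔼 a', u q a * conj (u q a') := by
      intro q
      simp_rw [← Finset.mul_expect, ← conj_expect]
      rw [← Finset.expect_mul, Complex.mul_conj, Complex.normSq_eq_norm_sq]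
    have e3 : ((𝔼 q, ‖𝔼 a, u q a‖ ^ 2 : ℝ) : ℂ) = 𝔼 w : Z × α × α, 𝔼 t : Fin m → α,
        (F w.1 (Fin.cons w.2.1 t) * conj (F w.1 (Fin.cons w.2.2 t))) *
          ∏ i : Fin m, (B i.succ w.1 (Fin.cons w.2.1 t) *
            conj (B i.succ w.1 (Fin.cons w.2.2 t))) := by
      rw [Complex.ofReal_expect]
      simp_rw [e2]
      rw [expect_prod_type, expect_prod_type]
      refine Finset.expect_congr rfl fun z _ => ?_
      rw [Finset.expect_comm, expect_prod_type]
      refine Finset.expect_congr rfl fun a _ => ?_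
      rw [Finset.expect_comm]
      refine Finset.expect_congr rfl fun a' _ => Finset.expect_congr rfl fun t _ => ?_
      simp only [hu, map_mul, map_prod, Finset.prod_mul_distrib]
      ring
    have hle : ‖𝔼 z, 𝔼 h, F z h * ∏ i, B i z h‖ ^ 2 ≤
        ‖((𝔼 q, ‖𝔼 a, u q a‖ ^ 2 : ℝ) : ℂ)‖ := by
      rw [e1, Complex.norm_real, Real.norm_of_nonneg (expect_nonneg' fun x => by positivity)]
      exact norm_sq_expect_le fun q => hB _ _ _
    rw [pow_two_pow_succ]
    refine (pow_le_pow_left₀ (by positivity) hle _).trans ?_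
    rw [e3]
    refine (ih (Z := Z × α × α)
      (fun w t => F w.1 (Fin.cons w.2.1 t) * conj (F w.1 (Fin.cons w.2.2 t)))
      (fun i w t => B i.succ w.1 (Fin.cons w.2.1 t) * conj (B i.succ w.1 (Fin.cons w.2.2 t)))
      (fun i w t => ?_) fun i w t a => ?_).trans_eq ?_
    · rw [norm_mul, RCLike.norm_conj]
      exact mul_le_one₀ (hB _ _ _) (norm_nonneg _) (hB _ _ _)
    · simp only [Fin.cons_update, hind i.succ w.1 _ _]
    · congr 1
      rw [expect_prod_type]
      refine Finset.expect_congr rfl fun z _ => ?_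
      rw [expect_prod_type, expect_cons]
      refine Finset.expect_congr rfl fun a _ => ?_
      simp_rw [expect_cons (fun h' => cube (m + 1) (F z) _ h')]
      rw [Finset.expect_comm (s := (univ : Finset (Fin m → α)))]
      rfl

end Cube

/-! ### Iterated multiplicative derivatives -/

section IterDiff

variable {p : ℕ} [Fact p.Prime] {G : Type*} [AddCommGroup G] [Module (ZMod p) G]

variable (p) in
/-- The iterated multiplicative derivative of `F` along the multiples `h i • v`. -/
noncomputable def iterDiff (v : G) : (m : ℕ) → (G → ℂ) → (Fin m → ZMod p) → G → ℂ
  | 0, F, _ => F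
  | m + 1, F, h => iterDiff v m (mulDiff p v (h 0) F) (Fin.tail h)

theorem norm_iterDiff_le (v : G) {m : ℕ} {F : G → ℂ} (hF : ∀ x, ‖F x‖ ≤ 1) (h : Fin m → ZMod p)
    (x : G) : ‖iterDiff p v m F h x‖ ≤ 1 := by
  induction m generalizing F with
  | zero => exact hF x
  | succ m ih => exact ih (norm_mulDiff_le hF v _) _

theorem iterDiff_mul (v : G) {m : ℕ} (F F' : G → ℂ) (h : Fin m → ZMod p) (x : G) :
    iterDiff p v m (fun x => F x * F' x) h x = iterDiff p v m F h x * iterDiff p v m F' h x := by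
  induction m generalizing F F' with
  | zero => rfl
  | succ m ih =>
    rw [iterDiff, iterDiff, iterDiff, ← ih]
    congr 1
    funext x
    simp only [mulDiff, map_mul]
    ring

theorem iterDiff_conj_add (v : G) {m : ℕ} (F : G → ℂ) (h : Fin m → ZMod p) (c x : G) :
    iterDiff p v m (fun x => conj (F (x + c))) h x = conj (iterDiff p v m F h (x + c)) := by
  induction m generalizing F with
  | zero => rfl
  | succ m ih =>
    rw [iterDiff, iterDiff, ← ih]
    congr 1
    funext x
    simp only [mulDiff, map_mul, add_right_comm]

theorem iterDiff_mulDiff (v : G) {m : ℕ} (F : G → ℂ) (h : Fin m → ZMod p) (a : ZMod p) (x : G) :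
    iterDiff p v m (mulDiff p v a F) h x =
      iterDiff p v m F h x * conj (iterDiff p v m F h (x + a • v)) := by
  rw [← iterDiff_conj_add, ← iterDiff_mul]
  rfl

/-- Off its base vertex, the iterated derivative splits into functions each of which is
independent of one of the parameters. -/
theorem exists_iterDiff_eq_mul_prod (v : G) (m : ℕ) {F : G → ℂ} (hF : ∀ x, ‖F x‖ ≤ 1) :
    ∃ B : Fin m → G → (Fin m → ZMod p) → ℂ, (∀ i x h, ‖B i x h‖ ≤ 1) ∧
      (∀ i x, IndepOf i (B i x)) ∧
      ∀ x h, iterDiff p v m F h (x - (∑ i, h i) • v) =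
        F (x - (∑ i, h i) • v) * ∏ i, B i x h := by
  induction m with
  | zero => exact ⟨fun _ _ _ => 0, by simp, fun i => i.elim0, fun x h => by simp [iterDiff]⟩
  | succ m ih =>
    obtain ⟨B, hB1, hB2, hB3⟩ := ih
    refine ⟨Fin.cons (fun x h => conj (iterDiff p v m F (Fin.tail h)
        (x - (∑ i, Fin.tail h i) • v))) fun i x h => B i (x - h 0 • v) (Fin.tail h),
      fun i x h => ?_, fun i => ?_, fun x h => ?_⟩
    · refine Fin.cases ?_ (fun i => ?_) i
      · rw [Fin.cons_zero, RCLike.norm_conj]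
        exact norm_iterDiff_le v hF _ _
      · exact hB1 _ _ _
    · refine Fin.cases ?_ (fun i => ?_) i
      · intro x h a
        simp
      · intro x h a
        simp only [Fin.cons_succ, Fin.tail_update_succ]
        rw [Function.update_of_ne (Fin.succ_ne_zero i).symm]
        exact hB2 i _ _ _
    · have e1 : x - (∑ i, h i) • v = (x - h 0 • v) - (∑ i, Fin.tail h i) • v := by
        rw [Fin.sum_univ_succ, add_smul]
        simp only [Fin.tail]
        abel
      rw [iterDiff, iterDiff_mulDiff, e1, hB3, Fin.prod_univ_succ]
      simp only [Fin.cons_zero, Fin.cons_succ]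
      have e2 : x - h 0 • v - (∑ i, Fin.tail h i) • v + h 0 • v =
        x - (∑ i, Fin.tail h i) • v := by abel
      rw [e2]
      ring

variable [Fintype G]

theorem gowers_le_one (v : G) (s : ℕ) {F : G → ℂ} (hF : ∀ x, ‖F x‖ ≤ 1) :
    gowers p v s F ≤ 1 := by
  induction s generalizing F with
  | zero =>
    exact Finset.expect_le univ_nonempty fun x _ =>
      pow_le_one₀ (norm_nonneg _) (norm_lineAvg_le hF v x)
  | succ s ih =>
    exact Finset.expect_le univ_nonempty fun a _ => ih (norm_mulDiff_le hF v a)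

theorem gowers_add_eq_expect (v : G) (m k : ℕ) (F : G → ℂ) :
    gowers p v (m + k) F = 𝔼 h : Fin m → ZMod p, gowers p v k (iterDiff p v m F h) := by
  induction m generalizing F with
  | zero => simp [iterDiff]
  | succ m ih =>
    rw [Nat.add_right_comm, gowers, expect_cons]
    refine Finset.expect_congr rfl fun a _ => ?_
    rw [ih]
    rfl

theorem expect_cube_succ (v : G) (m : ℕ) (F : G → ℂ) :
    𝔼 x, 𝔼 h, 𝔼 h', cube (m + 1) (fun t : Fin (m + 1) → ZMod p => F (x - (∑ i, t i) • v)) h h' =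
      𝔼 a, 𝔼 x, 𝔼 h, 𝔼 h',
        cube m (fun t : Fin m → ZMod p => mulDiff p v a F (x - (∑ i, t i) • v)) h h' := by
  have e1 : ∀ b a : ZMod p, 𝔼 x, 𝔼 h, 𝔼 h', cube m (fun t : Fin m → ZMod p =>
        F (x - (b + ∑ i, t i) • v) * conj (F (x - (a + ∑ i, t i) • v))) h h' =
      𝔼 x, 𝔼 h, 𝔼 h', cube m (fun t : Fin m → ZMod p =>
        mulDiff p v (b - a) F (x - (∑ i, t i) • v)) h h' := by
    intro b a
    rw [← expect_add_right _ (b • v)]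
    refine Finset.expect_congr rfl fun x _ => ?_
    congr! 7 with h _ h' _ t
    have e3 : x + b • v - (b + ∑ i, t i) • v = x - (∑ i, t i) • v := by rw [add_smul]; abel
    have e4 : x + b • v - (a + ∑ i, t i) • v = x - (∑ i, t i) • v + (b - a) • v := by
      rw [add_smul, sub_smul]; abel
    rw [e3, e4, mulDiff]
  have e2 : ∀ b : ZMod p, 𝔼 a : ZMod p, 𝔼 x, 𝔼 h, 𝔼 h', cube m (fun t : Fin m → ZMod p =>
        F (x - (b + ∑ i, t i) • v) * conj (F (x - (a + ∑ i, t i) • v))) h h' =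
      𝔼 a : ZMod p, 𝔼 x, 𝔼 h, 𝔼 h',
        cube m (fun t : Fin m → ZMod p => mulDiff p v a F (x - (∑ i, t i) • v)) h h' := fun b => by
    simp_rw [e1]
    exact Fintype.expect_equiv (Equiv.subLeft b) _ _ fun _ => rfl
  rw [← Fintype.expect_const (ι := ZMod p) (𝔼 a : ZMod p, 𝔼 x, 𝔼 h, 𝔼 h',
        cube m (fun t : Fin m → ZMod p => mulDiff p v a F (x - (∑ i, t i) • v)) h h'),
    ← Finset.expect_congr rfl fun b _ => e2 b]
  simp_rw [expect_cons, cube, Fin.sum_cons, Fin.cons_zero, Fin.tail_cons]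
  rw [Finset.expect_comm]
  refine Finset.expect_congr rfl fun b _ => ?_
  rw [Finset.expect_comm (s := (univ : Finset (ZMod p)))]
  refine Finset.expect_congr rfl fun x _ => ?_
  rw [Finset.expect_comm]

theorem gowers_eq_expect_cube (v : G) (m : ℕ) (F : G → ℂ) :
    (gowers p v m F : ℂ) = 𝔼 k : ZMod p, 𝔼 x, 𝔼 h, 𝔼 h',
      cube m (fun t : Fin m → ZMod p => mulDiff p v k F (x - (∑ i, t i) • v)) h h' := by
  induction m generalizing F with
  | zero =>
    simp only [gowers, cube, Finset.univ_eq_empty, Finset.sum_empty, zero_smul, sub_zero,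
      Fintype.expect_const]
    rw [Complex.ofReal_expect]
    simp_rw [lineAvg, norm_expect_sq_eq]
    rw [Finset.expect_comm]
    refine Finset.expect_congr rfl fun k _ => ?_
    rw [← expect_lineAvg (p := p) v (fun x => mulDiff p v k F x)]
    simp only [lineAvg, mulDiff, add_smul, add_assoc]
  | succ m ih =>
    rw [gowers, Complex.ofReal_expect]
    simp_rw [ih, expect_cube_succ]

end IterDiff

/-! ### Fourier analysis on lines -/

section Fourier

variable {p : ℕ} [Fact p.Prime]

theorem sum_norm_sq_fourier (f : ZMod p → ℂ) :
    ∑ k, ‖𝔼 n, f n * echar p (k * n)‖ ^ 2 = 𝔼 n, ‖f n‖ ^ 2 := by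
  have hp : (p : ℂ) ≠ 0 := by exact_mod_cast (Fact.out : p.Prime).ne_zero
  apply Complex.ofReal_injective
  rw [Complex.ofReal_sum]
  simp_rw [norm_expect_sq_eq]
  have e1 : ∀ k h : ZMod p, 𝔼 y, f y * echar p (k * y) * conj (f (y + h) * echar p (k * (y + h))) =
      (𝔼 y, f y * conj (f (y + h))) * echar p (k * -h) := by
    intro k h
    rw [Finset.expect_mul]
    refine Finset.expect_congr rfl fun y _ => ?_
    have : k * -h = k * y + -(k * (y + h)) := by ring
    rw [map_mul (starRingEnd ℂ), conj_echar, this, AddChar.map_add_eq_mul]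
    ring
  simp_rw [e1]
  rw [← Finset.expect_sum_comm]
  simp_rw [← Finset.mul_sum, AddChar.sum_mulShift _ (ZMod.isPrimitive_stdAddChar p)]
  rw [Fintype.expect_eq_sum_div_card, Finset.sum_eq_single 0 (by
    intro b _ hb
    simp [hb]) (by simp)]
  simp only [add_zero, neg_zero, if_true, ZMod.card, Complex.mul_conj, Complex.normSq_eq_norm_sq]
  rw [mul_div_assoc, div_self hp, mul_one, Complex.ofReal_expect]

theorem expect_norm_sq_autocorrelation_le {f : ZMod p → ℂ} (hf : ∀ n, ‖f n‖ ≤ 1) {r : ℝ}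
    (hr : ∀ k, ‖𝔼 n, f n * echar p (k * n)‖ ^ 2 ≤ r) :
    𝔼 a, ‖𝔼 n, f n * conj (f (n + a))‖ ^ 2 ≤ r := by
  have e1 : ∀ k : ZMod p, 𝔼 a, (𝔼 n, f n * conj (f (n + a))) * echar p (k * a) =
      ((‖𝔼 n, f n * echar p (-k * n)‖ ^ 2 : ℝ) : ℂ) := by
    intro k
    rw [norm_expect_sq_eq]
    refine Finset.expect_congr rfl fun a _ => ?_
    rw [Finset.expect_mul]
    refine Finset.expect_congr rfl fun n _ => ?_
    have : k * a = -k * n + -(-k * (n + a)) := by ring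
    rw [map_mul (starRingEnd ℂ), conj_echar, this, AddChar.map_add_eq_mul]
    ring
  have hr0 : 0 ≤ r := (sq_nonneg _).trans (hr 0)
  rw [← sum_norm_sq_fourier]
  simp_rw [e1]
  calc ∑ k, ‖((‖𝔼 n, f n * echar p (-k * n)‖ ^ 2 : ℝ) : ℂ)‖ ^ 2
      ≤ ∑ k, r * ‖𝔼 n, f n * echar p (-k * n)‖ ^ 2 := by
        refine Finset.sum_le_sum fun k _ => ?_
        rw [Complex.norm_real, Real.norm_of_nonneg (by positivity), sq]
        exact mul_le_mul_of_nonneg_right (hr _) (by positivity)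
    _ = r * ∑ k, ‖𝔼 n, f n * echar p (k * n)‖ ^ 2 := by
        rw [← Finset.mul_sum]
        congr 1
        exact Fintype.sum_equiv (Equiv.neg _) _ _ fun _ => rfl
    _ ≤ r * 1 := by
        rw [sum_norm_sq_fourier]
        refine mul_le_mul_of_nonneg_left ?_ hr0
        exact Finset.expect_le univ_nonempty fun x _ => pow_le_one₀ (norm_nonneg _) (hf x)
    _ = r := mul_one r

variable {G : Type*} [AddCommGroup G] [Module (ZMod p) G]

variable (p) in
/-- The Fourier coefficient of `F` at the frequency `k` along the line through `x`. -/
noncomputable def lineFourier (v : G) (F : G → ℂ) (k : ZMod p) (x : G) : ℂ :=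
  𝔼 n : ZMod p, F (x + n • v) * echar p (k * n)

theorem norm_lineFourier_le {v : G} {F : G → ℂ} (hF : ∀ x, ‖F x‖ ≤ 1) (k : ZMod p) (x : G) :
    ‖lineFourier p v F k x‖ ≤ 1 :=
  norm_expect_le_one fun n => by rw [norm_mul, norm_echar, mul_one]; exact hF _

theorem lineFourier_add_smul (v : G) (F : G → ℂ) (k : ZMod p) (x : G) (a : ZMod p) :
    lineFourier p v F k (x + a • v) = echar p (-(k * a)) * lineFourier p v F k x := by
  rw [lineFourier, lineFourier,
    ← expect_add_right (fun n : ZMod p => F (x + n • v) * echar p (k * n)) a, Finset.mul_expect]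
  refine Finset.expect_congr rfl fun n _ => ?_
  have e1 : x + a • v + n • v = x + (n + a) • v := by rw [add_smul]; abel
  have e2 : k * n = -(k * a) + k * (n + a) := by ring
  rw [e1, e2, AddChar.map_add_eq_mul]
  ring

theorem norm_lineFourier_add_smul (v : G) (F : G → ℂ) (k : ZMod p) (x : G) (a : ZMod p) :
    ‖lineFourier p v F k (x + a • v)‖ = ‖lineFourier p v F k x‖ := by
  rw [lineFourier_add_smul, norm_mul, norm_echar, one_mul]

/-- The inverse theorem for the second Gowers norm along `v`, with frequencies constant on
lines. -/
theorem exists_gowers_one_le [Fintype G] (v : G) {F : G → ℂ} (hF : ∀ x, ‖F x‖ ≤ 1) :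
    ∃ φ : G → ZMod p, (∀ x (n : ZMod p), φ (x + n • v) = φ x) ∧
      gowers p v 1 F ≤ 𝔼 x, ‖lineFourier p v F (φ x) x‖ ^ 2 := by
  have hex : ∀ w : ZMod p → ℝ, ∃ k, ∀ k', w k' ≤ w k := fun w => Finite.exists_max w
  choose M hM using hex
  refine ⟨fun x => M fun k => ‖lineFourier p v F k x‖, fun x n => ?_, ?_⟩
  · simp_rw [norm_lineFourier_add_smul]
  · simp only [gowers]
    rw [Finset.expect_comm]
    refine expect_mono fun x => ?_
    have := expect_norm_sq_autocorrelation_le (f := fun n : ZMod p => F (x + n • v))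
      (fun n => hF _) (r := ‖lineFourier p v F (M fun k => ‖lineFourier p v F k x‖) x‖ ^ 2)
      fun k => pow_le_pow_left₀ (norm_nonneg _) (hM (fun k => ‖lineFourier p v F k x‖) k) 2
    simpa only [lineAvg, mulDiff, add_smul, add_assoc] using this

end Fourier

/-! ### Degree lowering -/

section DegreeLowering

variable {p : ℕ} [Fact p.Prime] {G : Type} [AddCommGroup G] [Module (ZMod p) G] [Fintype G]

open Classical in
variable (p) in
/-- The family `g` correlates with functions oscillating along `v` only through their
non-oscillating part, up to an error `ε`; the same holds for cubes of members of `g`. -/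
def Tame {Z : Type} [Fintype Z] (v : G) (ε : ℝ) (g : Z → G → ℂ) : Prop :=
  ∀ (m : ℕ) (h h' : Fin m → ZMod p) (X : G → ℂ) (ψ : G → ZMod p), (∀ x, ‖X x‖ ≤ 1) →
    (∀ x (n : ZMod p), ψ (x + n • v) = ψ x) →
    (∀ x (n : ZMod p), X (x + n • v) = echar p (ψ x * n) * X x) →
    ‖𝔼 z, 𝔼 x, cube m (fun t => g z (x - (∑ i, t i) • v)) h h' * X x‖ ≤
      (𝔼 x, if X x ≠ 0 ∧ ψ x = 0 then 1 else 0) + ε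

open Classical in
theorem Tame.norm_expect_pow_le {Z : Type} [Fintype Z] {v : G} {ε : ℝ} {g : Z → G → ℂ}
    (hg : Tame p v ε g) {m : ℕ} {X : (Fin m → ZMod p) → G → ℂ}
    {φ : (Fin m → ZMod p) → G → ZMod p} (hX1 : ∀ h x, ‖X h x‖ ≤ 1)
    (hφ : ∀ h x (n : ZMod p), φ h (x + n • v) = φ h x)
    (hX : ∀ h x (n : ZMod p), X h (x + n • v) = echar p (φ h x * n) * X h x)
    (B : Fin m → G → (Fin m → ZMod p) → ℂ) (hB : ∀ i x h, ‖B i x h‖ ≤ 1)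
    (hind : ∀ i x, IndepOf i (B i x)) :
    ‖𝔼 h, 𝔼 x, (𝔼 z, g z (x - (∑ i, h i) • v)) * (∏ i, B i x h) *
        X h (x - (∑ i, h i) • v)‖ ^ 2 ^ m ≤
      (𝔼 h, 𝔼 h', 𝔼 x, if X h x ≠ 0 ∧ altsum m (fun t => φ t x) h h' = 0 then 1 else 0) + ε := by
  have e1 : 𝔼 h, 𝔼 x, (𝔼 z, g z (x - (∑ i, h i) • v)) * (∏ i, B i x h) *
        X h (x - (∑ i, h i) • v) = 𝔼 w : Z × G, 𝔼 h : Fin m → ZMod p,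
        (g w.1 (w.2 - (∑ i, h i) • v) * X h (w.2 - (∑ i, h i) • v)) * ∏ i, B i w.2 h := by
    rw [expect_prod_type, Finset.expect_comm (s := (univ : Finset Z)), Finset.expect_comm]
    refine Finset.expect_congr rfl fun x _ => ?_
    rw [Finset.expect_comm (s := (univ : Finset Z))]
    refine Finset.expect_congr rfl fun h _ => ?_
    rw [mul_assoc, Finset.expect_mul]
    exact Finset.expect_congr rfl fun z _ => by ring
  rw [e1]
  refine (box_cauchy_schwarz (fun (w : Z × G) h =>
    g w.1 (w.2 - (∑ i, h i) • v) * X h (w.2 - (∑ i, h i) • v)) (fun i w h => B i w.2 h)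
    (fun i w h => hB _ _ _) fun i w => hind i w.2).trans ?_
  have e2 : 𝔼 w : Z × G, 𝔼 h, 𝔼 h', cube m (fun h : Fin m → ZMod p =>
      g w.1 (w.2 - (∑ i, h i) • v) * X h (w.2 - (∑ i, h i) • v)) h h' =
      𝔼 h, 𝔼 h', 𝔼 z, 𝔼 x, cube m (fun h : Fin m → ZMod p => g z (x - (∑ i, h i) • v)) h h' *
        cube m (fun h : Fin m → ZMod p => X h (x - (∑ i, h i) • v)) h h' := by
    simp_rw [cube_mul]
    rw [Finset.expect_comm]
    refine Finset.expect_congr rfl fun h _ => ?_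
    rw [Finset.expect_comm]
    exact Finset.expect_congr rfl fun h' _ => expect_prod_type _
  have hε : ε = 𝔼 _h : Fin m → ZMod p, 𝔼 _h' : Fin m → ZMod p, ε := by
    simp
  rw [e2, hε, ← Finset.expect_add_distrib]
  refine (RCLike.norm_expect_le (K := ℂ)).trans (expect_mono fun h => ?_)
  rw [← Finset.expect_add_distrib]
  refine (RCLike.norm_expect_le (K := ℂ)).trans (expect_mono fun h' => ?_)
  have hinv : ∀ t x, φ t (x - (∑ i, t i) • v) = φ t x := fun t x => by
    rw [sub_eq_add_neg, ← neg_smul, hφ]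
  refine (hg m h h' (fun x => cube m (fun t => X t (x - (∑ i, t i) • v)) h h')
    (fun x => altsum m (fun t => φ t x) h h') (fun x => norm_cube_le (fun t => hX1 _ _) _ _)
    (fun x n => by simp_rw [hφ]) fun x n => ?_).trans ?_
  · rw [← altsum_mul_right, ← cube_echar, ← cube_mul]
    congr 1
    funext t
    rw [← hinv t x, ← hX]
    congr 1
    abel
  · refine add_le_add (expect_mono fun x => ?_) le_rfl
    split_ifs with h1 h2
    · exact le_rfl
    · refine absurd ⟨?_, h1.2⟩ h2
      have := ne_zero_of_cube_ne_zero h1.1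
      rw [sub_eq_add_neg, ← neg_smul, hX] at this
      exact right_ne_zero_of_mul this
    · exact zero_le_one
    · exact le_rfl

theorem echar_sum {ι : Type*} (s : Finset ι) (f : ι → ZMod p) :
    echar p (∑ i ∈ s, f i) = ∏ i ∈ s, echar p (f i) := by
  classical
  induction s using Finset.induction_on with
  | empty => simp
  | insert i s hi ih => rw [Finset.sum_insert hi, Finset.prod_insert hi, AddChar.map_add_eq_mul, ih]

theorem expect_norm_lineFourier_pow_le (v : G) {F : G → ℂ} (hF : ∀ x, ‖F x‖ ≤ 1) {m : ℕ}
    (θ : Fin m → G → (Fin m → ZMod p) → ZMod p) (hind : ∀ i x, IndepOf i (θ i x))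
    (hθ : ∀ i x (n : ZMod p), θ i (x + n • v) = θ i x) :
    (𝔼 h, 𝔼 x, ‖lineFourier p v (iterDiff p v m F h) (∑ i, θ i x h) x‖ ^ 2) ^ 2 ^ m ≤
      gowers p v m F := by
  have hT : ((𝔼 h, 𝔼 x, ‖lineFourier p v (iterDiff p v m F h) (∑ i, θ i x h) x‖ ^ 2 : ℝ) : ℂ) =
      𝔼 w : ZMod p × G, 𝔼 h, iterDiff p v m (mulDiff p v w.1 F) h (w.2 - (∑ i, h i) • v) *
        ∏ i, echar p (-(θ i w.2 h * w.1)) := by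
    have e1 : ∀ h x, ((‖lineFourier p v (iterDiff p v m F h) (∑ i, θ i x h) x‖ ^ 2 : ℝ) : ℂ) =
        𝔼 k : ZMod p, lineAvg p v (fun x => iterDiff p v m (mulDiff p v k F) h x *
          ∏ i, echar p (-(θ i x h * k))) x := by
      intro h x
      rw [lineFourier, norm_expect_sq_eq]
      refine Finset.expect_congr rfl fun k _ => Finset.expect_congr rfl fun n _ => ?_
      have e2 : ∏ i, echar p (-(θ i (x + n • v) h * k)) =
          echar p ((∑ i, θ i x h) * n) * echar p (-((∑ i, θ i x h) * (n + k))) := by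
        rw [← AddChar.map_add_eq_mul]
        have : (∑ i, θ i x h) * n + -((∑ i, θ i x h) * (n + k)) = ∑ i, -(θ i x h * k) := by
          rw [Finset.sum_neg_distrib, ← Finset.sum_mul]; ring
        simp_rw [hθ]
        rw [this, echar_sum]
      beta_reduce
      rw [e2, iterDiff_mulDiff, map_mul (starRingEnd ℂ), conj_echar, add_smul n k, ← add_assoc]
      ring
    simp_rw [Complex.ofReal_expect, e1]
    rw [expect_prod_type]
    have e3 : ∀ h, 𝔼 x, 𝔼 k : ZMod p, lineAvg p v (fun x => iterDiff p v m (mulDiff p v k F) h x *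
          ∏ i, echar p (-(θ i x h * k))) x = 𝔼 k : ZMod p, 𝔼 x,
          iterDiff p v m (mulDiff p v k F) h (x - (∑ i, h i) • v) *
            ∏ i, echar p (-(θ i x h * k)) := by
      intro h
      rw [Finset.expect_comm]
      refine Finset.expect_congr rfl fun k _ => ?_
      rw [expect_lineAvg, ← expect_add_right _ (-((∑ i, h i) • v))]
      refine Finset.expect_congr rfl fun x _ => ?_
      rw [← sub_eq_add_neg]
      have : ∀ i, θ i (x - (∑ i, h i) • v) = θ i x := fun i => by
        rw [sub_eq_add_neg, ← neg_smul, hθ]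
      simp_rw [this]
    simp_rw [e3]
    rw [Finset.expect_comm]
    exact Finset.expect_congr rfl fun k _ => Finset.expect_comm _ _ _
  have hT0 : (0 : ℝ) ≤ 𝔼 h, 𝔼 x,
      ‖lineFourier p v (iterDiff p v m F h) (∑ i, θ i x h) x‖ ^ 2 :=
    expect_nonneg' fun h => expect_nonneg' fun x => by positivity
  choose B hB1 hB2 hB3 using fun k : ZMod p =>
    exists_iterDiff_eq_mul_prod (p := p) v m (norm_mulDiff_le hF v k)
  have hbox := box_cauchy_schwarz (fun (w : ZMod p × G) (h : Fin m → ZMod p) =>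
      mulDiff p v w.1 F (w.2 - (∑ i, h i) • v))
    (fun i w h => B w.1 i w.2 h * echar p (-(θ i w.2 h * w.1)))
    (fun i w h => by rw [norm_mul, norm_echar, mul_one]; exact hB1 _ _ _ _)
    (fun i w h a => by simp only [hB2 w.1 i w.2 h a, hind i w.2 h a])
  rw [← Real.norm_of_nonneg hT0, ← Complex.norm_real, hT]
  simp_rw [hB3]
  refine le_trans (le_of_eq ?_) (hbox.trans_eq ?_)
  · congr 2
    refine Finset.expect_congr rfl fun w _ => Finset.expect_congr rfl fun h _ => ?_
    rw [Finset.prod_mul_distrib]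
    ring
  · rw [expect_prod_type, ← gowers_eq_expect_cube, Complex.norm_real,
      Real.norm_of_nonneg (gowers_nonneg _ _ _)]

end DegreeLowering

section DegreeLowering

variable {p : ℕ} [Fact p.Prime] {G : Type} [AddCommGroup G] [Module (ZMod p) G] [Fintype G]

theorem exists_phase_of_gowers_succ (v : G) (m : ℕ) {F : G → ℂ} (hF : ∀ x, ‖F x‖ ≤ 1) :
    ∃ (φ : (Fin m → ZMod p) → G → ZMod p) (X : (Fin m → ZMod p) → G → ℂ),
      (∀ h x (n : ZMod p), φ h (x + n • v) = φ h x) ∧ (∀ h x, ‖X h x‖ ≤ 1) ∧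
      (∀ h x (n : ZMod p), X h (x + n • v) = echar p (φ h x * n) * X h x) ∧
      (∀ h x, X h x ≠ 0 →
        gowers p v (m + 1) F / 2 ≤ ‖lineFourier p v (iterDiff p v m F h) (φ h x) x‖ ^ 2) ∧
      gowers p v (m + 1) F / 2 ≤ ‖𝔼 h, 𝔼 x, iterDiff p v m F h x * X h x‖ := by
  classical
  choose φ hφ1 hφ2 using fun h : Fin m → ZMod p =>
    exists_gowers_one_le (p := p) v (fun x => norm_iterDiff_le v hF h x)
  set δ := gowers p v (m + 1) F with hδ
  set L : (Fin m → ZMod p) → G → ℂ := fun h x =>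
    lineFourier p v (iterDiff p v m F h) (φ h x) x with hL
  set X : (Fin m → ZMod p) → G → ℂ := fun h x =>
    if δ / 2 ≤ ‖L h x‖ ^ 2 then conj (L h x) else 0 with hX
  have hLadd : ∀ h x (n : ZMod p), L h (x + n • v) = echar p (-(φ h x * n)) * L h x := by
    intro h x n
    simp only [hL, hφ1, lineFourier_add_smul]
  have hXadd : ∀ h x (n : ZMod p), X h (x + n • v) = echar p (φ h x * n) * X h x := by
    intro h x n
    have h1 : ‖L h (x + n • v)‖ = ‖L h x‖ := by rw [hLadd, norm_mul, norm_echar, one_mul]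
    simp only [hX, h1]
    split_ifs
    · rw [hLadd, map_mul (starRingEnd ℂ), conj_echar, neg_neg]
    · rw [mul_zero]
  refine ⟨φ, X, hφ1, fun h x => ?_, hXadd, fun h x hx => ?_, ?_⟩
  · simp only [hX]
    split_ifs
    · rw [RCLike.norm_conj]
      exact norm_lineFourier_le (fun x => norm_iterDiff_le v hF h x) _ _
    · simp
  · by_contra hlt
    exact hx (if_neg hlt)
  · have e1 : ∀ h, 𝔼 x, iterDiff p v m F h x * X h x = 𝔼 x, L h x * X h x := by
      intro h
      rw [← expect_lineAvg (p := p) v]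
      refine Finset.expect_congr rfl fun x _ => ?_
      rw [lineAvg]
      simp_rw [hXadd, ← mul_assoc]
      rw [← Finset.expect_mul]
      rfl
    have e2 : ∀ h x, L h x * X h x = ((if δ / 2 ≤ ‖L h x‖ ^ 2 then ‖L h x‖ ^ 2 else 0 : ℝ) : ℂ) := by
      intro h x
      simp only [hX]
      split_ifs
      · rw [Complex.mul_conj, Complex.normSq_eq_norm_sq]
      · simp
    have e3 : δ ≤ 𝔼 h, 𝔼 x, ‖L h x‖ ^ 2 := by
      rw [hδ, gowers_add_eq_expect]
      exact expect_mono fun h => hφ2 h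
    have e4 : 𝔼 h, 𝔼 x, ‖L h x‖ ^ 2 ≤
        𝔼 h, 𝔼 x, (if δ / 2 ≤ ‖L h x‖ ^ 2 then ‖L h x‖ ^ 2 else 0) + δ / 2 := by
      have : δ / 2 = 𝔼 _h : Fin m → ZMod p, 𝔼 _x : G, δ / 2 := by simp
      conv_rhs => rw [this]
      simp_rw [← Finset.expect_add_distrib]
      refine expect_mono fun h => expect_mono fun x => ?_
      have := gowers_nonneg (p := p) v (m + 1) F
      split_ifs with h1
      · simp only [← hδ] at this
        linarith
      · linarith
    have e5 : 𝔼 h, 𝔼 x, iterDiff p v m F h x * X h x =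
        ((𝔼 h, 𝔼 x, (if δ / 2 ≤ ‖L h x‖ ^ 2 then ‖L h x‖ ^ 2 else 0) : ℝ) : ℂ) := by
      simp_rw [e1, e2, Complex.ofReal_expect]
    rw [e5, Complex.norm_real]
    refine le_trans ?_ (Real.le_norm_self _)
    linarith

theorem expect_indicator_pow_le {v : G} {m : ℕ} {F : G → ℂ} (hF : ∀ x, ‖F x‖ ≤ 1) {a : ℝ}
    (ha : 0 ≤ a) {φ : (Fin m → ZMod p) → G → ZMod p} {S : (Fin m → ZMod p) → G → Prop}
    [∀ h x, Decidable (S h x)] (hφ : ∀ h x (n : ZMod p), φ h (x + n • v) = φ h x)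
    (hS : ∀ h x, S h x → a ≤ ‖lineFourier p v (iterDiff p v m F h) (φ h x) x‖ ^ 2) :
    (a * 𝔼 h, 𝔼 h', 𝔼 x, if S h x ∧ altsum m (fun t => φ t x) h h' = 0 then 1 else 0) ^ 2 ^ m ≤
      gowers p v m F := by
  choose Θ hΘ1 hΘ2 using exists_altsum_decomposition (α := ZMod p) (M := ZMod p) (m := m)
  have key : ∀ h' : Fin m → ZMod p, ((𝔼 h, 𝔼 x,
      if S h x ∧ altsum m (fun t => φ t x) h h' = 0 then a else 0)) ^ 2 ^ m ≤ gowers p v m F := by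
    intro h'
    refine le_trans ?_ (expect_norm_lineFourier_pow_le v hF
      (fun i x h => Θ (fun t => φ t x) h' i h) (fun i x => hΘ1 _ _ i) (fun i x n => ?_))
    · refine pow_le_pow_left₀ (expect_nonneg' fun h => expect_nonneg' fun x => ?_)
        (expect_mono fun h => expect_mono fun x => ?_) _
      · split_ifs <;> simp [ha]
      · split_ifs with h1
        · have := hΘ2 (fun t => φ t x) h' h
          rw [h1.2, zero_add] at this
          rw [← this]
          exact hS h x h1.1
        · positivity
    · simp_rw [hφ]
  calc _ = (𝔼 h', 𝔼 h, 𝔼 x,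
        if S h x ∧ altsum m (fun t => φ t x) h h' = 0 then a else 0) ^ 2 ^ m := by
        rw [Finset.expect_comm]
        simp_rw [Finset.mul_expect, mul_ite, mul_one, mul_zero]
    _ ≤ _ := expect_pow_two_pow_le (fun h' => expect_nonneg' fun h => expect_nonneg' fun x => by
        split_ifs <;> simp [ha]) _
    _ ≤ _ := Finset.expect_le univ_nonempty fun h' _ => key h'

theorem gowers_succ_pow_le {Z₁ Z₂ : Type} [Fintype Z₁] [Fintype Z₂] {v : G} {ε : ℝ} (hε : 0 ≤ ε)
    (hε1 : ε ≤ 1) {g₁ : Z₁ → G → ℂ} {g₂ : Z₂ → G → ℂ} (hg₁ : Tame p v ε g₁) (hg₂ : Tame p v ε g₂)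
    {F : G → ℂ} (hF : ∀ x, ‖F x‖ ≤ 1) (hFg : ∀ x, F x = ((𝔼 z, g₁ z x) - 𝔼 z, g₂ z x) / 2)
    (m : ℕ) : gowers p v (m + 1) F ^ ((2 ^ m + 1) * 2 ^ m) ≤
      2 ^ ((2 ^ m + 1) * 2 ^ m) * 2 ^ 2 ^ m * (gowers p v m F + ε) := by
  classical
  obtain ⟨φ, X, hφ, hX1, hX, hXL, hle⟩ := exists_phase_of_gowers_succ (p := p) v m hF
  obtain ⟨B, hB1, hB2, hB3⟩ := exists_iterDiff_eq_mul_prod (p := p) v m hF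
  set a := gowers p v (m + 1) F / 2 with ha
  have ha0 : 0 ≤ a := by have := gowers_nonneg (p := p) v (m + 1) F; positivity
  have ha1 : a ≤ 1 := by have := gowers_le_one (p := p) v (m + 1) hF; linarith
  set S : ℝ := 𝔼 h, 𝔼 h', 𝔼 x,
    if X h x ≠ 0 ∧ altsum m (fun t => φ t x) h h' = 0 then 1 else 0 with hSdef
  have hS0 : 0 ≤ S := expect_nonneg' fun h => expect_nonneg' fun h' => expect_nonneg' fun x => by
    split_ifs <;> simp
  have h1 := hg₁.norm_expect_pow_le hX1 hφ hX B hB1 hB2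
  have h2 := hg₂.norm_expect_pow_le hX1 hφ hX B hB1 hB2
  set T₁ := 𝔼 h, 𝔼 x, (𝔼 z, g₁ z (x - (∑ i, h i) • v)) * (∏ i, B i x h) *
        X h (x - (∑ i, h i) • v)
  set T₂ := 𝔼 h, 𝔼 x, (𝔼 z, g₂ z (x - (∑ i, h i) • v)) * (∏ i, B i x h) *
        X h (x - (∑ i, h i) • v)
  have hT : 𝔼 h, 𝔼 x, iterDiff p v m F h x * X h x = (T₁ - T₂) / 2 := by
    rw [← Finset.expect_sub_distrib, Finset.expect_div]
    refine Finset.expect_congr rfl fun h _ => ?_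
    rw [← Finset.expect_sub_distrib, Finset.expect_div,
      ← expect_add_right (fun x => iterDiff p v m F h x * X h x) (-((∑ i, h i) • v))]
    refine Finset.expect_congr rfl fun x _ => ?_
    simp only [← sub_eq_add_neg]
    rw [hB3, hFg]
    ring
  have hmain : a ^ 2 ^ m ≤ S + ε := by
    have hmax : a ≤ max ‖T₁‖ ‖T₂‖ := by
      refine hle.trans ?_
      rw [hT, norm_div, Complex.norm_ofNat]
      have := norm_sub_le T₁ T₂
      have := le_max_left ‖T₁‖ ‖T₂‖
      have := le_max_right ‖T₁‖ ‖T₂‖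
      linarith
    refine (pow_le_pow_left₀ ha0 hmax _).trans ?_
    rcases max_choice ‖T₁‖ ‖T₂‖ with h | h <;> rw [h] <;> assumption
  have hlow : (a * S) ^ 2 ^ m ≤ gowers p v m F := expect_indicator_pow_le hF ha0 hφ hXL
  have hlow2 : a ^ (2 ^ m + 1) ≤ a * S + ε := by
    rw [pow_succ']
    nlinarith
  have h3 : a ^ ((2 ^ m + 1) * 2 ^ m) ≤ 2 ^ 2 ^ m * (gowers p v m F + ε) := by
    rw [pow_mul]
    refine (pow_le_pow_left₀ (by positivity) hlow2 _).trans ?_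
    refine (add_pow_le (by positivity) hε _).trans ?_
    gcongr
    · norm_num
    · exact Nat.sub_le _ _
    · exact pow_le_of_le_one hε hε1 (by positivity)
  have h4 : gowers p v (m + 1) F = 2 * a := by rw [ha]; ring
  rw [h4, mul_pow, mul_assoc]
  gcongr

/-- Degree lowering: the Gowers norm, of any degree, of the balanced difference of averages of two
tame families is controlled by the error in their tameness. -/
theorem exists_gowers_pow_le_of_tame (s : ℕ) : ∃ (N : ℕ) (C : ℝ), 0 < N ∧ 0 ≤ C ∧
    ∀ (p : ℕ) [Fact p.Prime] (G : Type) [AddCommGroup G] [Module (ZMod p) G] [Fintype G]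
      (Z₁ Z₂ : Type) [Fintype Z₁] [Fintype Z₂] (v : G) (ε : ℝ) (g₁ : Z₁ → G → ℂ) (g₂ : Z₂ → G → ℂ)
      (F : G → ℂ), 0 ≤ ε → ε ≤ 1 → Tame p v ε g₁ → Tame p v ε g₂ → (∀ x, ‖F x‖ ≤ 1) →
      (∀ x, F x = ((𝔼 z, g₁ z x) - 𝔼 z, g₂ z x) / 2) → (∀ x, lineAvg p v F x = 0) →
      gowers p v s F ^ N ≤ C * ε := by
  induction s with
  | zero =>
    refine ⟨1, 0, one_pos, le_rfl, ?_⟩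
    intro p _ G _ _ _ Z₁ Z₂ _ _ v ε g₁ g₂ F _ _ _ _ _ _ hF0
    simp [gowers, hF0]
  | succ m ih =>
    obtain ⟨N, C, hN, hC, ih⟩ := ih
    set M := (2 ^ m + 1) * 2 ^ m with hM
    refine ⟨M * N, (2 ^ M * 2 ^ 2 ^ m) ^ N * (2 ^ (N - 1) * (C + 1)), by positivity, by positivity, ?_⟩
    intro p _ G _ _ _ Z₁ Z₂ _ _ v ε g₁ g₂ F hε hε1 hg₁ hg₂ hF hFg hF0
    have h1 := ih p G Z₁ Z₂ v ε g₁ g₂ F hε hε1 hg₁ hg₂ hF hFg hF0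
    have h2 := gowers_succ_pow_le hε hε1 hg₁ hg₂ hF hFg m
    have h0 := gowers_nonneg (p := p) v (m + 1) F
    have h0' := gowers_nonneg (p := p) v m F
    rw [pow_mul]
    refine (pow_le_pow_left₀ (by positivity) h2 N).trans ?_
    rw [mul_pow, mul_assoc]
    refine mul_le_mul_of_nonneg_left ?_ (by positivity)
    refine (add_pow_le h0' hε _).trans ?_
    rw [mul_assoc]
    gcongr
    have : ε ^ N ≤ ε := pow_le_of_le_one hε hε1 hN.ne'
    linarith

end DegreeLowering

/-! ### Exponential sums -/

section Weyl

variable {p : ℕ} [Fact p.Prime]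

theorem expect_echar_mul (k : ZMod p) : 𝔼 n : ZMod p, echar p (k * n) = if k = 0 then 1 else 0 := by
  have h := AddChar.sum_mulShift k (ZMod.isPrimitive_stdAddChar p)
  have hp : (p : ℂ) ≠ 0 := by exact_mod_cast (Fact.out : p.Prime).ne_zero
  rw [Fintype.expect_eq_sum_div_card, ZMod.card]
  simp_rw [mul_comm k]
  rw [h]
  split_ifs <;> simp [hp]

open Polynomial in
theorem norm_expect_echar_eval_pow_le (k : ℕ) {q : (ZMod p)[X]} (hq : q.natDegree = k + 1)
    (hp : k + 1 < p) : ‖𝔼 y, echar p (q.eval y)‖ ^ 2 ^ k ≤ k / p := by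
  induction k generalizing q with
  | zero =>
    have hlead : q.coeff 1 ≠ 0 := by
      have h : q.natDegree = 1 := hq
      rw [← h, coeff_natDegree, leadingCoeff_ne_zero]
      rintro rfl
      simp at h
    have e1 : ∀ y, echar p (q.eval y) = echar p (q.coeff 1 * y) * echar p (q.coeff 0) := by
      intro y
      rw [← AddChar.map_add_eq_mul]
      conv_lhs => rw [eq_X_add_C_of_natDegree_le_one hq.le]
      simp
    simp_rw [e1]
    rw [← Finset.expect_mul, expect_echar_mul, if_neg hlead]
    simp
  | succ k ih =>
    have hp0 : (0 : ℝ) < p := by exact_mod_cast (Fact.out : p.Prime).pos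
    rw [pow_two_pow_succ]
    refine (pow_le_pow_left₀ (by positivity) (van_der_corput_one _) _).trans ?_
    refine (expect_pow_two_pow_le (fun _ => norm_nonneg _) _).trans ?_
    have hb : ∀ h : ZMod p, ‖𝔼 y, echar p (q.eval y) * conj (echar p (q.eval (y + h)))‖ ^ 2 ^ k ≤
        (if h = 0 then 1 else 0) + k / p := by
      intro h
      split_ifs with h0
      · refine le_trans (pow_le_one₀ (norm_nonneg _) (norm_expect_le_one fun y => ?_)) ?_
        · rw [norm_mul, RCLike.norm_conj, norm_echar, norm_echar, one_mul]
        · have : (0 : ℝ) ≤ k / p := by positivity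
          linarith
      · rw [zero_add]
        have hc : q.leadingCoeff ≠ 0 := by
          rw [leadingCoeff_ne_zero]
          rintro rfl
          simp at hq
        have hd : (q - taylor h q).natDegree = k + 1 := by
          rw [← natDegree_neg, neg_sub]
          exact (natDegree_leadingCoeff_taylor_sub (G := ZMod p) (one_ne_zero) hq hp hc
            (by simp) h0).1
        refine le_trans (le_of_eq ?_) (ih hd (by omega))
        congr 2
        refine Finset.expect_congr rfl fun y _ => ?_
        rw [eval_sub, taylor_eval, sub_eq_add_neg, AddChar.map_add_eq_mul, conj_echar]
    refine (expect_mono hb).trans (le_of_eq ?_)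
    rw [Finset.expect_add_distrib, Fintype.expect_const, Fintype.expect_eq_sum_div_card, ZMod.card]
    simp
    ring

end Weyl

/-! ### Counting configurations -/

section Counting

open Polynomial

variable {p : ℕ} [Fact p.Prime] {G : Type} [CommRing G] [Algebra (ZMod p) G] [Fintype G]

variable (p) in
/-- The average counting configurations, with the functions of index at least `l` replaced by
polynomial phases. -/
noncomputable def countOp (P : ℕ → (ZMod p)[X]) (v : ℕ → G) (t l : ℕ) (g : G → ℂ) (f : ℕ → G → ℂ)
    (ψ : ℕ → G → ZMod p) : ℂ :=
  𝔼 x, 𝔼 y : ZMod p, g x * (∏ i ∈ range l, f i (x + (P i).eval y • v i)) *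
    echar p (∑ i ∈ Ico l t, ψ i x * (P i).eval y)

open Classical in
variable (p) in
/-- The expected main term of `countOp`. -/
noncomputable def countMain (v : ℕ → G) (t l : ℕ) (g : G → ℂ) (f : ℕ → G → ℂ)
    (ψ : ℕ → G → ZMod p) : ℂ :=
  𝔼 x, g x * (∏ i ∈ range l, lineAvg p (v i) (f i) x) * if ∀ i ∈ Ico l t, ψ i x = 0 then 1 else 0

/-- `countOp` is close to its main term with a power-saving error. -/
def CountBound (deg : ℕ → ℕ) (d t l : ℕ) : Prop :=
  ∃ (N : ℕ) (C : ℝ), 0 < N ∧ 0 ≤ C ∧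
    ∀ (p : ℕ) [Fact p.Prime] (G : Type) [CommRing G] [Algebra (ZMod p) G] [Fintype G]
      (P : ℕ → (ZMod p)[X]) (v : ℕ → G) (g : G → ℂ) (f : ℕ → G → ℂ) (ψ : ℕ → G → ZMod p),
      d < p → (∀ i < t, v i ≠ 0) → (∀ i < t, (P i).natDegree = deg i) →
      (∀ x, ‖g x‖ ≤ 1) → (∀ i x, ‖f i x‖ ≤ 1) →
      ‖countOp p P v t l g f ψ - countMain p v t l g f ψ‖ ^ N ≤ C / p

theorem norm_countOp_le_one {P : ℕ → (ZMod p)[X]} {v : ℕ → G} {t l : ℕ} {g : G → ℂ}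
    {f : ℕ → G → ℂ} {ψ : ℕ → G → ZMod p} (hg : ∀ x, ‖g x‖ ≤ 1) (hf : ∀ i x, ‖f i x‖ ≤ 1) :
    ‖countOp p P v t l g f ψ‖ ≤ 1 :=
  norm_expect_le_one fun x => norm_expect_le_one fun y => by
    rw [norm_mul, norm_mul, norm_echar, mul_one]
    exact mul_le_one₀ (hg x) (norm_nonneg _) (norm_prod_le_one _ fun i => hf _ _)

/-- A nontrivial combination of polynomials of distinct positive degrees has positive degree. -/
theorem exists_natDegree_sum_eq {deg : ℕ → ℕ} {t : ℕ}
    (hmono : ∀ i j, i < j → j < t → deg i < deg j) {P : ℕ → (ZMod p)[X]}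
    (hP : ∀ i < t, (P i).natDegree = deg i) (hpos : ∀ i < t, 1 ≤ deg i)
    {c : ℕ → ZMod p} (hc : ∃ i < t, c i ≠ 0) :
    ∃ i < t, (∑ i ∈ range t, Polynomial.C (c i) * P i).natDegree = deg i := by
  induction t with
  | zero => simp at hc
  | succ t ih =>
    by_cases ht : c t = 0
    · obtain ⟨i, hi, hci⟩ := hc
      have hit : i < t := by
        refine lt_of_le_of_ne (by omega) ?_
        rintro rfl
        exact hci ht
      obtain ⟨j, hj, hdj⟩ := ih (fun i j hij hj => hmono i j hij (by omega))
        (fun i hi => hP i (by omega)) (fun i hi => hpos i (by omega)) ⟨i, hit, hci⟩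
      refine ⟨j, by omega, ?_⟩
      rw [Finset.sum_range_succ, ht, Polynomial.C_0, zero_mul, add_zero, hdj]
    · refine ⟨t, by omega, ?_⟩
      have h1 : (Polynomial.C (c t) * P t).natDegree = deg t := by
        rw [natDegree_C_mul ht, hP t (by omega)]
      have h2 : (∑ i ∈ range t, Polynomial.C (c i) * P i).natDegree ≤ deg t - 1 := by
        refine natDegree_sum_le_of_forall_le _ _ fun i hi => ?_
        refine (natDegree_C_mul_le _ _).trans ?_
        rw [Finset.mem_range] at hi
        have := hmono i t hi (by omega)
        rw [hP i (by omega)]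
        omega
      rw [Finset.sum_range_succ, natDegree_add_eq_right_of_natDegree_lt, h1]
      have := hpos t (by omega)
      omega

theorem countBound_zero {deg : ℕ → ℕ} {d t : ℕ} (hpos : ∀ i < t, 1 ≤ deg i)
    (hmono : ∀ i j, i < j → j < t → deg i < deg j) (hd : ∀ i < t, deg i ≤ d) :
    CountBound deg d t 0 := by
  refine ⟨2 ^ d, d, by positivity, by positivity, ?_⟩
  intro p _ G _ _ _ P v g f ψ hdp hv hP hg hf
  have hp0 : (0 : ℝ) < p := by exact_mod_cast (Fact.out : p.Prime).pos
  set E : G → ℂ := fun x => (𝔼 y : ZMod p, echar p (∑ i ∈ range t, ψ i x * (P i).eval y)) -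
    if ∀ i ∈ range t, ψ i x = 0 then 1 else 0 with hE
  have e1 : countOp p P v t 0 g f ψ - countMain p v t 0 g f ψ = 𝔼 x, g x * E x := by
    rw [countOp, countMain, ← Finset.expect_sub_distrib]
    refine Finset.expect_congr rfl fun x _ => ?_
    simp only [hE, Finset.range_zero, Finset.prod_empty, mul_one, mul_sub, Finset.mul_expect,
      Nat.Ico_zero_eq_range]
  have e2 : ∀ x, ‖E x‖ ^ 2 ^ d ≤ d / p := by
    intro x
    by_cases h0 : ∀ i ∈ range t, ψ i x = 0
    · have : E x = 0 := by
        simp only [hE, if_pos h0]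
        rw [Finset.expect_congr rfl fun y _ => by
          rw [Finset.sum_eq_zero fun i hi => by rw [h0 i hi, zero_mul]]]
        simp
      rw [this, norm_zero, zero_pow (by positivity)]
      positivity
    · have hex : ∃ i < t, ψ i x ≠ 0 := by
        push Not at h0
        obtain ⟨i, hi, h⟩ := h0
        exact ⟨i, Finset.mem_range.1 hi, h⟩
      obtain ⟨i, hi, hdeg⟩ := exists_natDegree_sum_eq hmono hP hpos hex
      obtain ⟨k, hk⟩ : ∃ k, deg i = k + 1 := ⟨deg i - 1, by have := hpos i hi; omega⟩
      have hkd := hd i hi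
      have hw := norm_expect_echar_eval_pow_le k (hdeg.trans hk) (by omega)
      have hEx : E x = 𝔼 y, echar p ((∑ i ∈ range t, Polynomial.C (ψ i x) * P i).eval y) := by
        simp only [hE, if_neg h0, sub_zero, eval_finsetSum, eval_mul, eval_C]
      rw [hEx]
      refine (pow_le_pow_of_le_one (norm_nonneg _) (norm_expect_le_one fun y => (norm_echar _).le)
        (Nat.pow_le_pow_right (by norm_num) (by omega : k ≤ d))).trans (hw.trans ?_)
      gcongr
      omega
  rw [e1]
  calc ‖𝔼 x, g x * E x‖ ^ 2 ^ d ≤ (𝔼 x, ‖E x‖) ^ 2 ^ d := by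
        gcongr
        refine (RCLike.norm_expect_le (K := ℂ)).trans (expect_mono fun x => ?_)
        rw [norm_mul]
        exact mul_le_of_le_one_left (norm_nonneg _) (hg x)
    _ ≤ 𝔼 x, ‖E x‖ ^ 2 ^ d := expect_pow_two_pow_le (fun _ => norm_nonneg _) _
    _ ≤ d / p := Finset.expect_le univ_nonempty fun x _ => e2 x

end Counting

section Counting

open Polynomial

variable {p : ℕ} [Fact p.Prime]

section Tame

variable {G : Type} [AddCommGroup G] [Module (ZMod p) G] [Fintype G]

theorem expect_mul_of_invariant {v : G} {K : G → ℂ} (hK : ∀ x (n : ZMod p), K (x + n • v) = K x)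
    (F : G → ℂ) : 𝔼 x, F x * K x = 𝔼 x, lineAvg p v F x * K x := by
  rw [← expect_lineAvg (p := p) v]
  refine Finset.expect_congr rfl fun x _ => ?_
  simp_rw [lineAvg, hK, Finset.expect_mul]

theorem cube_prod {α ι : Type*} {m : ℕ} (s : Finset ι) (F : ι → (Fin m → α) → ℂ)
    (h h' : Fin m → α) : cube m (fun t => ∏ i ∈ s, F i t) h h' = ∏ i ∈ s, cube m (F i) h h' := by
  induction m with
  | zero => rfl
  | succ m ih =>
    simp only [cube]
    rw [← ih]
    congr 1
    funext t
    rw [map_prod, Finset.prod_mul_distrib]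

theorem tame_of_invariant {v : G} {ε : ℝ} (hε : 0 ≤ ε) {K : G → ℂ} (hK1 : ∀ x, ‖K x‖ ≤ 1)
    (hK : ∀ x (n : ZMod p), K (x + n • v) = K x) : Tame p v ε fun _ : Unit => K := by
  classical
  intro m h h' X ψ hX1 _ hX
  have hline : ∀ x, lineAvg p v X x = if ψ x = 0 then X x else 0 := fun x => by
    simp_rw [lineAvg, hX]
    rw [← Finset.expect_mul, expect_echar_mul]
    split_ifs <;> simp
  have hsub : ∀ x (n : ZMod p), K (x - n • v) = K x := fun x n => by
    rw [sub_eq_add_neg, ← neg_smul, hK]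
  simp_rw [hsub, mul_comm _ (X _), Fintype.expect_const]
  rw [expect_mul_of_invariant (p := p) (v := v) fun x n => by simp_rw [hK]]
  refine ((RCLike.norm_expect_le (K := ℂ)).trans (expect_mono fun x => ?_)).trans
    (le_add_of_nonneg_right hε)
  rw [norm_mul, hline]
  have h1 : ‖cube m (fun _ : Fin m → ZMod p => K x) h h'‖ ≤ 1 := norm_cube_le (fun _ => hK1 x) _ _
  split_ifs with h2 h3 h3
  · exact mul_le_one₀ (hX1 x) (norm_nonneg _) h1
  · have : X x = 0 := by
      by_contra h4
      exact h3 ⟨h4, h2⟩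
    simp [this]
  · exact absurd h3.2 h2
  · simp

end Tame

variable {G : Type} [CommRing G] [Algebra (ZMod p) G]

variable (p) in
/-- The function dual to the last one in `countOp`, before averaging over `y`. -/
noncomputable def dualFn (P : ℕ → (ZMod p)[X]) (v : ℕ → G) (t l : ℕ) (g : G → ℂ) (f : ℕ → G → ℂ)
    (ψ : ℕ → G → ZMod p) (y : ZMod p) (x : G) : ℂ :=
  g (x - (P l).eval y • v l) *
    (∏ i ∈ range l, f i (x - (P l).eval y • v l + (P i).eval y • v i)) *
    echar p (∑ i ∈ Ico (l + 1) t, ψ i (x - (P l).eval y • v l) * (P i).eval y)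

variable {P : ℕ → (ZMod p)[X]} {v : ℕ → G} {t l : ℕ} {g : G → ℂ} {f : ℕ → G → ℂ}
  {ψ : ℕ → G → ZMod p}

theorem norm_dualFn_le (hg : ∀ x, ‖g x‖ ≤ 1) (hf : ∀ i x, ‖f i x‖ ≤ 1) (y : ZMod p) (x : G) :
    ‖dualFn p P v t l g f ψ y x‖ ≤ 1 := by
  rw [dualFn, norm_mul, norm_mul, norm_echar, mul_one]
  exact mul_le_one₀ (hg _) (norm_nonneg _) (norm_prod_le_one _ fun i => hf _ _)

variable [Fintype G]

theorem countOp_update_eq (k : G → ℂ) :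
    countOp p P v t (l + 1) g (Function.update f l k) ψ =
      𝔼 x, k x * 𝔼 y, dualFn p P v t l g f ψ y x := by
  rw [countOp, Finset.expect_comm]
  simp_rw [Finset.mul_expect]
  conv_rhs => rw [Finset.expect_comm]
  refine Finset.expect_congr rfl fun y _ => ?_
  rw [← expect_add_right (fun x => k x * dualFn p P v t l g f ψ y x) ((P l).eval y • v l)]
  refine Finset.expect_congr rfl fun x _ => ?_
  have h1 : ∏ i ∈ range l, Function.update f l k i (x + (P i).eval y • v i) =
      ∏ i ∈ range l, f i (x + (P i).eval y • v i) :=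
    Finset.prod_congr rfl fun i hi => by
      rw [Function.update_of_ne (Finset.mem_range.1 hi).ne]
  rw [Finset.prod_range_succ, h1, Function.update_self, dualFn]
  simp only [add_sub_cancel_right]
  ring

theorem countOp_update_lineAvg (hl : l < t) :
    countOp p P v t (l + 1) g (Function.update f l (lineAvg p (v l) (f l))) ψ =
      countOp p P v t l (fun x => g x * lineAvg p (v l) (f l) x) f (Function.update ψ l 0) := by
  rw [countOp, countOp]
  refine Finset.expect_congr rfl fun x _ => Finset.expect_congr rfl fun y _ => ?_
  have h1 : ∏ i ∈ range l, Function.update f l (lineAvg p (v l) (f l)) i (x + (P i).eval y • v i) =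
      ∏ i ∈ range l, f i (x + (P i).eval y • v i) :=
    Finset.prod_congr rfl fun i hi => by
      rw [Function.update_of_ne (Finset.mem_range.1 hi).ne]
  have h2 : ∑ i ∈ Ico (l + 1) t, Function.update ψ l 0 i x * (P i).eval y =
      ∑ i ∈ Ico (l + 1) t, ψ i x * (P i).eval y :=
    Finset.sum_congr rfl fun i hi => by
      rw [Function.update_of_ne (by have := (Finset.mem_Ico.1 hi).1; omega)]
  rw [Finset.prod_range_succ, h1, Function.update_self, lineAvg_add_smul,
    Finset.sum_eq_sum_Ico_succ_bot hl, h2, Function.update_self]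
  simp only [Pi.zero_apply, zero_mul, zero_add]
  ring

theorem countMain_update (hl : l < t) :
    countMain p v t (l + 1) g f ψ =
      countMain p v t l (fun x => g x * lineAvg p (v l) (f l) x) f (Function.update ψ l 0) := by
  rw [countMain, countMain]
  refine Finset.expect_congr rfl fun x _ => ?_
  have h1 : (∀ i ∈ Ico (l + 1) t, ψ i x = 0) ↔ ∀ i ∈ Ico l t, Function.update ψ l 0 i x = 0 := by
    refine ⟨fun h i hi => ?_, fun h i hi => ?_⟩
    · rw [Finset.mem_Ico] at hi
      rcases eq_or_ne i l with rfl | hil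
      · simp
      · rw [Function.update_of_ne hil]
        exact h i (Finset.mem_Ico.2 ⟨by omega, hi.2⟩)
    · rw [Finset.mem_Ico] at hi
      have := h i (Finset.mem_Ico.2 ⟨by omega, hi.2⟩)
      rwa [Function.update_of_ne (by omega)] at this
  simp only [h1]
  rw [Finset.prod_range_succ]
  ring

theorem tame_dualFn {ε : ℝ} (hl : l < t) (hg : ∀ x, ‖g x‖ ≤ 1) (hf : ∀ i x, ‖f i x‖ ≤ 1)
    (H : ∀ (g : G → ℂ) (f : ℕ → G → ℂ) (ψ : ℕ → G → ZMod p), (∀ x, ‖g x‖ ≤ 1) →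
      (∀ i x, ‖f i x‖ ≤ 1) → ‖countOp p P v t l g f ψ‖ ≤ ‖countMain p v t l g f ψ‖ + ε) :
    Tame p (v l) ε (dualFn p P v t l g f ψ) := by
  classical
  intro m h h' X φ hX1 hφ hX
  set K : G → ℂ := fun x =>
    cube m (fun t : Fin m → ZMod p => g (x - (∑ i, t i) • v l)) h h' * X x with hK
  set Φ : ℕ → G → ℂ := fun i x =>
    cube m (fun t : Fin m → ZMod p => f i (x - (∑ i, t i) • v l)) h h' with hΦ
  set Ψ : ℕ → G → ZMod p := Function.update (fun i x =>
    altsum m (fun t : Fin m → ZMod p => ψ i (x - (∑ i, t i) • v l)) h h') l φ with hΨ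
  have hK1 : ∀ x, ‖K x‖ ≤ ‖X x‖ := fun x => by
    rw [hK, norm_mul]
    exact mul_le_of_le_one_left (norm_nonneg _) (norm_cube_le (fun _ => hg _) _ _)
  have hΦ1 : ∀ i x, ‖Φ i x‖ ≤ 1 := fun i x => norm_cube_le (fun _ => hf _ _) _ _
  have e1 : 𝔼 y, 𝔼 x, cube m (fun s : Fin m → ZMod p =>
      dualFn p P v t l g f ψ y (x - (∑ i, s i) • v l)) h h' * X x =
      countOp p P v t l K Φ Ψ := by
    rw [countOp, Finset.expect_comm (s := (univ : Finset G))]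
    refine Finset.expect_congr rfl fun y _ => ?_
    rw [← expect_add_right (fun x => cube m (fun s : Fin m → ZMod p =>
      dualFn p P v t l g f ψ y (x - (∑ i, s i) • v l)) h h' * X x) ((P l).eval y • v l)]
    refine Finset.expect_congr rfl fun x _ => ?_
    have hs : ∀ s : Fin m → ZMod p, dualFn p P v t l g f ψ y
        (x + (P l).eval y • v l - (∑ i, s i) • v l) =
        g (x - (∑ i, s i) • v l) *
          (∏ i ∈ range l, f i (x + (P i).eval y • v i - (∑ i, s i) • v l)) *
          echar p (∑ i ∈ Ico (l + 1) t, ψ i (x - (∑ i, s i) • v l) * (P i).eval y) := by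
      intro s
      rw [dualFn, show x + (P l).eval y • v l - (∑ i, s i) • v l - (P l).eval y • v l =
        x - (∑ i, s i) • v l by abel]
      congr 2
      exact Finset.prod_congr rfl fun i _ => by congr 1; abel
    have hsum : ∑ i ∈ Ico (l + 1) t, Ψ i x * (P i).eval y = altsum m (fun s : Fin m → ZMod p =>
        ∑ i ∈ Ico (l + 1) t, ψ i (x - (∑ i, s i) • v l) * (P i).eval y) h h' := by
      rw [altsum_sum]
      refine Finset.sum_congr rfl fun i hi => ?_
      rw [altsum_mul_right, hΨ, Function.update_of_ne
        (by have := (Finset.mem_Ico.1 hi).1; omega)]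
    simp only [hs]
    rw [cube_mul, cube_mul, cube_prod, cube_echar, hX, Finset.sum_eq_sum_Ico_succ_bot hl, hsum,
      AddChar.map_add_eq_mul, hΨ, Function.update_self]
    simp only [hK, hΦ]
    ring
  rw [e1]
  refine (H K Φ Ψ (fun x => (hK1 x).trans (hX1 x)) hΦ1).trans (add_le_add ?_ le_rfl)
  refine (RCLike.norm_expect_le (K := ℂ)).trans (expect_mono fun x => ?_)
  have h1 : ‖K x * ∏ i ∈ range l, lineAvg p (v i) (Φ i) x‖ ≤ ‖X x‖ := by
    rw [norm_mul]
    exact (mul_le_of_le_one_right (norm_nonneg _) (norm_prod_le_one _ fun i =>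
      norm_lineAvg_le (hΦ1 i) _ _)).trans (hK1 x)
  rw [norm_mul]
  by_cases h0 : ∀ i ∈ Ico l t, Ψ i x = 0
  · have hφ0 : φ x = 0 := by
      have := h0 l (Finset.mem_Ico.2 ⟨le_rfl, hl⟩)
      rwa [hΨ, Function.update_self] at this
    rw [if_pos h0, norm_one, mul_one]
    by_cases hX0 : X x = 0
    · rw [hX0, norm_zero] at h1
      simpa [hX0] using h1
    · rw [if_pos ⟨hX0, hφ0⟩]
      exact h1.trans (hX1 x)
  · rw [if_neg h0, norm_zero, mul_zero]
    split_ifs <;> simp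

/-- Replacing the last function by its average along lines costs at most a dual average. -/
theorem norm_sq_countOp_sub_le (hf : ∀ i x, ‖f i x‖ ≤ 1) {K : G → ℂ}
    (hK : ∀ x, K x = ((𝔼 y, dualFn p P v t l g f ψ y x) -
      lineAvg p (v l) (fun x => 𝔼 y, dualFn p P v t l g f ψ y x) x) / 2) :
    ‖countOp p P v t (l + 1) g f ψ -
        countOp p P v t (l + 1) g (Function.update f l (lineAvg p (v l) (f l))) ψ‖ ^ 2 ≤
      2 * ‖countOp p P v t (l + 1) g (Function.update f l fun x => conj (K x)) ψ‖ := by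
  set F : G → ℂ := fun x => 𝔼 y, dualFn p P v t l g f ψ y x with hF
  have hFinv : ∀ x (n : ZMod p), lineAvg p (v l) F (x + n • v l) = lineAvg p (v l) F x :=
    fun x n => lineAvg_add_smul _ _ _ _
  have hK0 : ∀ x, lineAvg p (v l) (fun x => conj (K x)) x = 0 := by
    intro x
    rw [lineAvg, ← conj_expect]
    simp_rw [hK, hFinv]
    rw [← Finset.expect_div, Finset.expect_sub_distrib, Fintype.expect_const, lineAvg, sub_self]
    simp
  have e1 : countOp p P v t (l + 1) g f ψ -
      countOp p P v t (l + 1) g (Function.update f l (lineAvg p (v l) (f l))) ψ =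
      2 * 𝔼 x, f l x * K x := by
    have h0 := countOp_update_eq (P := P) (v := v) (t := t) (l := l) (g := g) (f := f) (ψ := ψ) (f l)
    rw [Function.update_eq_self] at h0
    have h1 : 𝔼 x, lineAvg p (v l) (f l) x * F x = 𝔼 x, f l x * lineAvg p (v l) F x := by
      rw [expect_mul_of_invariant hFinv]
      simp_rw [mul_comm (lineAvg p (v l) (f l) _)]
      exact expect_mul_of_invariant (fun x n => lineAvg_add_smul _ _ _ _) _
    rw [h0, countOp_update_eq, h1, ← Finset.expect_sub_distrib, Finset.mul_expect]
    refine Finset.expect_congr rfl fun x _ => ?_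
    rw [hK]
    ring
  have e2 : countOp p P v t (l + 1) g (Function.update f l fun x => conj (K x)) ψ =
      ((2 * 𝔼 x, ‖K x‖ ^ 2 : ℝ) : ℂ) := by
    have h1 : 𝔼 x, conj (K x) * lineAvg p (v l) F x = 0 := by
      rw [expect_mul_of_invariant hFinv]
      simp [hK0]
    rw [countOp_update_eq, ← sub_zero (𝔼 x, conj (K x) * _), ← h1, ← Finset.expect_sub_distrib,
      Complex.ofReal_mul, Complex.ofReal_expect, Finset.mul_expect]
    refine Finset.expect_congr rfl fun x _ => ?_
    have : (𝔼 y, dualFn p P v t l g f ψ y x) = 2 * K x + lineAvg p (v l) F x := by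
      rw [hK]
      ring
    rw [this, ← Complex.normSq_eq_norm_sq, ← Complex.mul_conj]
    push_cast
    ring
  have h2 : 0 ≤ 𝔼 x, ‖K x‖ ^ 2 := expect_nonneg' fun x => by positivity
  have h3 := norm_sq_expect_le (u := K) (hf l)
  rw [e1, e2, Complex.norm_real, Real.norm_of_nonneg (by positivity), norm_mul, mul_pow]
  norm_num
  linarith

theorem exists_root_bound {C : ℝ} (hC : 1 ≤ C) {N : ℕ} (hN : 0 < N) {q : ℝ} (hq : 1 ≤ q) :
    ∃ ε : ℝ, 0 ≤ ε ∧ ε ≤ 1 ∧ 1 / q ≤ ε ∧ ε ^ N ≤ C / q ∧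
      ∀ a : ℝ, 0 ≤ a → a ^ N ≤ C / q → a ≤ 1 → a ≤ ε := by
  have hq0 : 0 < q := by linarith
  have hCq : 0 ≤ C / q := by positivity
  set r := (C / q) ^ (N⁻¹ : ℝ) with hr
  have hr0 : 0 ≤ r := by positivity
  have hrN : r ^ N = C / q := Real.rpow_inv_natCast_pow hCq hN.ne'
  have hle : ∀ a : ℝ, 0 ≤ a → a ^ N ≤ C / q → a ≤ r := fun a ha h => by
    rw [← hrN] at h
    exact (pow_le_pow_iff_left₀ ha hr0 hN.ne').1 h
  have h1 : 1 / q ≤ 1 := by rw [div_le_one hq0]; exact hq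
  refine ⟨min 1 r, by positivity, min_le_left _ _, le_min h1 ?_, ?_, fun a ha h h' =>
    le_min h' (hle a ha h)⟩
  · refine hle _ (by positivity) ((pow_le_of_le_one (by positivity) h1 hN.ne').trans ?_)
    gcongr
  · rw [← hrN]
    exact pow_le_pow_left₀ (by positivity) (min_le_right _ _) _

end Counting

section Counting

open Polynomial

theorem CountBound.succ {deg : ℕ → ℕ} {d t l : ℕ} (hpos : ∀ i < t, 1 ≤ deg i)
    (hmono : ∀ i j, i < j → j < t → deg i < deg j) (hd : ∀ i < t, deg i ≤ d) (hl : l < t)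
    (h : CountBound deg d t l) : CountBound deg d t (l + 1) := by
  obtain ⟨N, C', hN, hC', H'⟩ := h
  obtain ⟨C, hC, hC1⟩ : ∃ C : ℝ, C' ≤ C ∧ 1 ≤ C := ⟨max C' 1, le_max_left _ _,
    le_max_right _ _⟩
  obtain ⟨s, m, A, hA, hpet⟩ := exists_norm_counting_pow_le d (deg l) l
  obtain ⟨M, B, hM, hB, hlow⟩ := exists_gowers_pow_le_of_tame s
  set W : ℕ := 2 * 2 ^ m * M with hW
  set D : ℝ := 2 ^ (2 ^ m * M) * A ^ M * (2 ^ (M - 1) * (B + 1)) with hD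
  have hD0 : 0 ≤ D := by positivity
  have hC0 : 0 ≤ C := by linarith
  have hW0 : W ≠ 0 := by positivity
  refine ⟨N * W, 2 ^ (N * W - 1) * (C ^ W + D ^ N * C), by positivity, by positivity, ?_⟩
  intro p _ G _ _ _ P v g f ψ hdp hv hP hg hf
  have hp1 : (1 : ℝ) ≤ p := by exact_mod_cast (Fact.out : p.Prime).one_lt.le
  have hp0 : (0 : ℝ) < p := by linarith
  have hop : ∀ (g : G → ℂ) (f : ℕ → G → ℂ) (ψ : ℕ → G → ZMod p), (∀ x, ‖g x‖ ≤ 1) →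
      (∀ i x, ‖f i x‖ ≤ 1) →
      ‖countOp p P v t l g f ψ - countMain p v t l g f ψ‖ ^ N ≤ C / p := fun g f ψ hg hf =>
    (H' p G P v g f ψ hdp hv hP hg hf).trans (by gcongr)
  obtain ⟨ε, hε0, hε1, hεp, hεN, hεle⟩ := exists_root_bound hC1 hN hp1
  have hop' : ∀ (g : G → ℂ) (f : ℕ → G → ℂ) (ψ : ℕ → G → ZMod p), (∀ x, ‖g x‖ ≤ 1) →
      (∀ i x, ‖f i x‖ ≤ 1) → ‖countOp p P v t l g f ψ‖ ≤ ‖countMain p v t l g f ψ‖ + ε := by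
    intro g f ψ hg hf
    have h1 := hop g f ψ hg hf
    have h2 := norm_sub_norm_le (countOp p P v t l g f ψ) (countMain p v t l g f ψ)
    have h3 := norm_countOp_le_one (p := p) (P := P) (v := v) (t := t) (l := l) (ψ := ψ) hg hf
    rcases le_total (‖countOp p P v t l g f ψ‖ - ‖countMain p v t l g f ψ‖) 0 with h4 | h4
    · linarith
    · have := hεle _ h4 ((pow_le_pow_left₀ h4 h2 N).trans h1)
        (by linarith [norm_nonneg (countMain p v t l g f ψ)])
      linarith
  set F : G → ℂ := fun x => 𝔼 y, dualFn p P v t l g f ψ y x with hF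
  have hF1 : ∀ x, ‖F x‖ ≤ 1 := fun x => norm_expect_le_one fun y => norm_dualFn_le hg hf y x
  set K : G → ℂ := fun x => (F x - lineAvg p (v l) F x) / 2 with hK
  have hK1 : ∀ x, ‖K x‖ ≤ 1 := fun x => by
    simp only [hK]
    rw [norm_div, Complex.norm_ofNat]
    have h1 := norm_sub_le (F x) (lineAvg p (v l) F x)
    have h2 := norm_lineAvg_le (p := p) hF1 (v l) x
    have h3 := hF1 x
    linarith
  have hK0 : ∀ x, lineAvg p (v l) K x = 0 := by
    intro x
    rw [lineAvg]
    simp only [hK, lineAvg_add_smul]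
    rw [← Finset.expect_div, Finset.expect_sub_distrib, Fintype.expect_const, lineAvg, sub_self,
      zero_div]
  have hgow : gowers p (v l) s K ^ M ≤ B * ε :=
    hlow p G (ZMod p) Unit (v l) ε (dualFn p P v t l g f ψ) (fun _ => lineAvg p (v l) F) K hε0 hε1
      (tame_dualFn hl hg hf hop')
      (tame_of_invariant hε0 (norm_lineAvg_le hF1 _) fun x n => lineAvg_add_smul _ _ _ _) hK1
      (fun x => by simp [hK, hF]) hK0
  set Λ := countOp p P v t (l + 1) g f ψ -
        countOp p P v t (l + 1) g (Function.update f l (lineAvg p (v l) (f l))) ψ with hΛ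
  set ω := countOp p P v t (l + 1) g (Function.update f l fun x => conj (K x)) ψ with hω
  have hΛω : ‖Λ‖ ^ 2 ≤ 2 * ‖ω‖ := norm_sq_countOp_sub_le hf fun x => rfl
  have hω1 : ‖ω‖ ^ 2 ^ m ≤ A * (gowers p (v l) s K + 1 / p) := by
    have := hpet p G P v (Function.update f l fun x => conj (K x)) g
      (fun x => ∑ i ∈ Ico (l + 1) t, Polynomial.C (ψ i x) * P i) hdp (fun i hi => hv i (by omega))
      (fun i hi => by rw [hP i (by omega)]; exact hpos i (by omega))
      (fun i hi => by
        rw [hP i (by omega), hP l hl]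
        exact hmono i l hi hl)
      (hP l hl) (hd l hl) (fun j x => by
        rcases eq_or_ne j l with rfl | hj
        · rw [Function.update_self, RCLike.norm_conj]
          exact hK1 x
        · rw [Function.update_of_ne hj]
          exact hf j x) hg (fun x => by
        refine natDegree_sum_le_of_forall_le _ _ fun i hi => ?_
        refine (natDegree_C_mul_le _ _).trans ?_
        rw [Finset.mem_Ico] at hi
        rw [hP i hi.2]
        exact hd i hi.2)
    rw [Function.update_self, gowers_conj] at this
    refine le_trans (le_of_eq ?_) this
    rw [hω, countOp]
    simp only [eval_finsetSum, eval_mul, eval_C]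
  have hγ : (gowers p (v l) s K + 1 / p) ^ M ≤ 2 ^ (M - 1) * (B + 1) * ε := by
    refine (add_pow_le (gowers_nonneg _ _ _) (by positivity) M).trans ?_
    rw [mul_assoc]
    gcongr
    have h1 : (1 / (p : ℝ)) ^ M ≤ 1 / p :=
      pow_le_of_le_one (by positivity) ((div_le_one hp0).2 hp1) hM.ne'
    linarith
  have hΛ1 : ‖Λ‖ ^ W ≤ D * ε := by
    calc ‖Λ‖ ^ W = (‖Λ‖ ^ 2) ^ (2 ^ m * M) := by rw [hW, ← pow_mul, mul_assoc]
      _ ≤ (2 * ‖ω‖) ^ (2 ^ m * M) := by gcongr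
      _ = 2 ^ (2 ^ m * M) * (‖ω‖ ^ 2 ^ m) ^ M := by rw [mul_pow, ← pow_mul]
      _ ≤ 2 ^ (2 ^ m * M) * (A * (gowers p (v l) s K + 1 / p)) ^ M := by gcongr
      _ = 2 ^ (2 ^ m * M) * A ^ M * (gowers p (v l) s K + 1 / p) ^ M := by rw [mul_pow, mul_assoc]
      _ ≤ 2 ^ (2 ^ m * M) * A ^ M * (2 ^ (M - 1) * (B + 1) * ε) := by gcongr
      _ = D * ε := by rw [hD]; ring
  have hΛ2 : ‖Λ‖ ^ (N * W) ≤ D ^ N * C / p := by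
    calc ‖Λ‖ ^ (N * W) = (‖Λ‖ ^ W) ^ N := by rw [← pow_mul, mul_comm]
      _ ≤ (D * ε) ^ N := by gcongr
      _ = D ^ N * ε ^ N := mul_pow _ _ _
      _ ≤ D ^ N * (C / p) := by gcongr
      _ = _ := by ring
  set E := countOp p P v t (l + 1) g (Function.update f l (lineAvg p (v l) (f l))) ψ -
    countMain p v t (l + 1) g f ψ with hE
  have hE1 : ‖E‖ ^ (N * W) ≤ C ^ W / p := by
    have h1 : ‖E‖ ^ N ≤ C / p := by
      rw [hE, countOp_update_lineAvg hl, countMain_update hl]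
      refine hop _ _ _ (fun x => ?_) hf
      rw [norm_mul]
      exact mul_le_one₀ (hg x) (norm_nonneg _) (norm_lineAvg_le (hf l) _ _)
    rw [pow_mul]
    refine (pow_le_pow_left₀ (by positivity) h1 W).trans ?_
    rw [div_pow]
    gcongr
    exact le_self_pow₀ hp1 hW0
  have hsum : countOp p P v t (l + 1) g f ψ - countMain p v t (l + 1) g f ψ = E + Λ := by
    rw [hE, hΛ]
    ring
  rw [hsum]
  calc ‖E + Λ‖ ^ (N * W) ≤ (‖E‖ + ‖Λ‖) ^ (N * W) := by
        gcongr
        exact norm_add_le _ _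
    _ ≤ 2 ^ (N * W - 1) * (‖E‖ ^ (N * W) + ‖Λ‖ ^ (N * W)) :=
        add_pow_le (norm_nonneg _) (norm_nonneg _) _
    _ ≤ 2 ^ (N * W - 1) * (C ^ W / p + D ^ N * C / p) := by gcongr
    _ = _ := by ring

theorem countBound_of_le {deg : ℕ → ℕ} {d t : ℕ} (hpos : ∀ i < t, 1 ≤ deg i)
    (hmono : ∀ i j, i < j → j < t → deg i < deg j) (hd : ∀ i < t, deg i ≤ d) {l : ℕ} (hl : l ≤ t) :
    CountBound deg d t l := by
  induction l with
  | zero => exact countBound_zero hpos hmono hd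
  | succ l ih => exact (ih (by omega)).succ hpos hmono hd hl

end Counting

/-! ### Sets without configurations are sparse -/

section Density

open Polynomial

variable {p : ℕ} [Fact p.Prime]

open Classical in
theorem le_expect_mul_prod_lineAvg {G : Type} [AddCommGroup G] [Module (ZMod p) G] [Fintype G]
    {t : ℕ} (ht : 1 ≤ t) (v : ℕ → G) {a : G → ℝ} (ha0 : ∀ x, 0 ≤ a x) :
    ((𝔼 x, a x) / (2 * t)) ^ (t + 1) ≤
      𝔼 x, a x * ∏ i ∈ range t, 𝔼 n : ZMod p, a (x + n • v i) := by
  set α := 𝔼 x, a x with hα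
  set L : ℕ → G → ℝ := fun i x => 𝔼 n : ZMod p, a (x + n • v i) with hL
  have hα0 : 0 ≤ α := expect_nonneg' ha0
  have ht0 : (1 : ℝ) ≤ t := by exact_mod_cast ht
  set β := α / (2 * t) with hβ
  have hβ0 : 0 ≤ β := by positivity
  have hLinv : ∀ i x (n : ZMod p), L i (x + n • v i) = L i x := fun i x n => by
    simp only [hL]
    rw [← expect_add_right (fun m : ZMod p => a (x + m • v i)) n]
    exact Finset.expect_congr rfl fun m _ => by rw [add_smul]; congr 1; abel
  have hL0 : ∀ i x, 0 ≤ L i x := fun i x => expect_nonneg' fun n => ha0 _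
  have hbad : ∀ i, 𝔼 x, a x * (if L i x < β then 1 else 0) ≤ β := by
    intro i
    have e1 : 𝔼 x, a x * (if L i x < β then 1 else 0) =
        𝔼 x, L i x * (if L i x < β then 1 else 0) := by
      simp_rw [hL, Finset.expect_mul]
      rw [Finset.expect_comm]
      have h1 : ∀ n : ZMod p, 𝔼 x, a (x + n • v i) * (if L i x < β then (1 : ℝ) else 0) =
          𝔼 x, a x * (if L i x < β then 1 else 0) := fun n => by
        rw [← expect_add_right (fun x => a x * (if L i x < β then (1 : ℝ) else 0)) (n • v i)]
        simp_rw [hLinv]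
      exact ((Finset.expect_congr rfl fun n _ => h1 n).trans (Fintype.expect_const _)).symm
    rw [e1]
    refine Finset.expect_le univ_nonempty fun x _ => ?_
    split_ifs with h
    · rw [mul_one]
      exact h.le
    · rw [mul_zero]
      exact hβ0
  have hpt : ∀ x, β ^ t * (a x - ∑ i ∈ range t, a x * (if L i x < β then 1 else 0)) ≤
      a x * ∏ i ∈ range t, L i x := by
    intro x
    by_cases h : ∃ i ∈ range t, L i x < β
    · obtain ⟨i, hi, hix⟩ := h
      refine le_trans (mul_nonpos_of_nonneg_of_nonpos (by positivity) ?_)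
        (mul_nonneg (ha0 x) (Finset.prod_nonneg fun i _ => hL0 i x))
      have : a x * (if L i x < β then 1 else 0) ≤
          ∑ i ∈ range t, a x * (if L i x < β then 1 else 0) :=
        Finset.single_le_sum (f := fun i => a x * (if L i x < β then (1 : ℝ) else 0))
          (fun j _ => mul_nonneg (ha0 x) (by split_ifs <;> simp)) hi
      rw [if_pos hix, mul_one] at this
      linarith
    · push Not at h
      rw [Finset.sum_eq_zero fun i hi => by rw [if_neg (h i hi).not_gt, mul_zero], sub_zero, mul_comm]
      refine mul_le_mul_of_nonneg_left ?_ (ha0 x)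
      calc β ^ t = ∏ _i ∈ range t, β := by simp
        _ ≤ _ := Finset.prod_le_prod (fun _ _ => hβ0) h
  calc β ^ (t + 1) ≤ β ^ t * (α - t * β) := by
        rw [pow_succ]
        refine mul_le_mul_of_nonneg_left ?_ (by positivity)
        have : α = 2 * t * β := by rw [hβ]; field_simp
        nlinarith
    _ ≤ β ^ t * (α - ∑ i ∈ range t, 𝔼 x, a x * (if L i x < β then 1 else 0)) := by
        gcongr
        refine (Finset.sum_le_sum fun i _ => hbad i).trans ?_
        simp
    _ = 𝔼 x, β ^ t * (a x - ∑ i ∈ range t, a x * (if L i x < β then 1 else 0)) := by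
        rw [← Finset.mul_expect, Finset.expect_sub_distrib, Finset.expect_sum_comm]
    _ ≤ _ := expect_mono hpt

theorem exists_density_pow_le {deg : ℕ → ℕ} {d t : ℕ} (ht : 1 ≤ t) (hpos : ∀ i < t, 1 ≤ deg i)
    (hmono : ∀ i j, i < j → j < t → deg i < deg j) (hd : ∀ i < t, deg i ≤ d) :
    ∃ (N : ℕ) (C : ℝ), 0 < N ∧ 0 ≤ C ∧
      ∀ (p : ℕ) [Fact p.Prime] (G : Type) [CommRing G] [Algebra (ZMod p) G] [Fintype G]
        (P : ℕ → (ZMod p)[X]) (v : ℕ → G) (A : Finset G),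
        d < p → (∀ i < t, v i ≠ 0) → (∀ i < t, (P i).natDegree = deg i) →
        (∀ x ∈ A, ∀ y : ZMod p, y ≠ 0 → ∃ i < t, x + (P i).eval y • v i ∉ A) →
        ((#A : ℝ) / Fintype.card G) ^ N ≤ C / p := by
  classical
  obtain ⟨N, C, hN, hC, H⟩ := countBound_of_le hpos hmono hd le_rfl
  refine ⟨(t + 1) * N, (2 * t) ^ ((t + 1) * N) * (2 ^ (N - 1) * (1 + C)), by positivity,
    by positivity, ?_⟩
  intro p _ G _ _ _ P v A hdp hv hP hA
  have hp1 : (1 : ℝ) ≤ p := by exact_mod_cast (Fact.out : p.Prime).one_lt.le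
  have hp0 : (0 : ℝ) < p := by linarith
  have ht0 : (0 : ℝ) < t := by exact_mod_cast ht
  set a : G → ℝ := fun x => if x ∈ A then 1 else 0 with ha
  have ha0 : ∀ x, 0 ≤ a x := fun x => by simp only [ha]; split_ifs <;> simp
  have ha1 : ∀ x, a x ≤ 1 := fun x => by simp only [ha]; split_ifs <;> simp
  have hac : ∀ x, ‖(a x : ℂ)‖ ≤ 1 := fun x => by
    rw [Complex.norm_real, Real.norm_of_nonneg (ha0 x)]
    exact ha1 x
  have hdens : 𝔼 x, a x = (#A : ℝ) / Fintype.card G := by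
    rw [Fintype.expect_eq_sum_div_card]
    simp [ha]
  have hcount := H p G P v (fun x => (a x : ℂ)) (fun _ x => (a x : ℂ)) (fun _ _ => 0) hdp hv hP hac
    (fun _ => hac)
  have hmain := le_expect_mul_prod_lineAvg (p := p) ht v ha0
  have e1 : countMain p v t t (fun x => (a x : ℂ)) (fun _ x => (a x : ℂ)) (fun _ _ => 0) =
      ((𝔼 x, a x * ∏ i ∈ range t, 𝔼 n : ZMod p, a (x + n • v i) : ℝ) : ℂ) := by
    simp [countMain, lineAvg, Complex.ofReal_expect]
  have hop : ‖countOp p P v t t (fun x => (a x : ℂ)) (fun _ x => (a x : ℂ)) (fun _ _ => 0)‖ ≤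
      1 / p := by
    rw [countOp]
    refine (RCLike.norm_expect_le (K := ℂ)).trans (Finset.expect_le univ_nonempty fun x _ => ?_)
    calc _ ≤ 𝔼 y : ZMod p, if y = 0 then (1 : ℝ) else 0 := by
          refine (RCLike.norm_expect_le (K := ℂ)).trans (expect_mono fun y => ?_)
          rw [norm_mul, norm_mul, norm_echar, mul_one]
          split_ifs with hy
          · exact mul_le_one₀ (hac x) (norm_nonneg _) (norm_prod_le_one _ fun i => hac _)
          · by_cases hx : x ∈ A
            · obtain ⟨i, hi, hiA⟩ := hA x hx y hy
              rw [Finset.prod_eq_zero (Finset.mem_range.2 hi) (by simp [ha, hiA])]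
              simp
            · simp [ha, hx]
      _ = 1 / p := by
          rw [Fintype.expect_eq_sum_div_card, ZMod.card]
          simp
  rw [e1] at hcount
  rw [hdens] at hmain
  set μ := 𝔼 x, a x * ∏ i ∈ range t, 𝔼 n : ZMod p, a (x + n • v i) with hμ
  set ω := countOp p P v t t (fun x => (a x : ℂ)) (fun _ x => (a x : ℂ)) (fun _ _ => 0) with hω
  have hμ0 : 0 ≤ μ := le_trans (by positivity) hmain
  have h1 : μ ≤ 1 / p + ‖ω - μ‖ := by
    have h2 := norm_sub_norm_le (μ : ℂ) ω
    rw [norm_sub_rev, Complex.norm_real, Real.norm_of_nonneg hμ0] at h2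
    linarith
  have h3 : μ ^ N ≤ 2 ^ (N - 1) * (1 + C) / p := by
    calc μ ^ N ≤ (1 / p + ‖ω - μ‖) ^ N := by gcongr
      _ ≤ 2 ^ (N - 1) * ((1 / p) ^ N + ‖ω - μ‖ ^ N) := add_pow_le (by positivity) (norm_nonneg _) _
      _ ≤ 2 ^ (N - 1) * (1 / p + C / p) := by
          gcongr
          exact pow_le_of_le_one (by positivity) ((div_le_one hp0).2 hp1) hN.ne'
      _ = _ := by ring
  have ht0 : (2 * t : ℝ) ≠ 0 := by positivity
  rw [← mul_div_cancel₀ ((#A : ℝ) / Fintype.card G) ht0, mul_pow, mul_div_assoc]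
  refine mul_le_mul_of_nonneg_left ?_ (by positivity)
  rw [pow_mul]
  exact (pow_le_pow_left₀ (by positivity) hmain N).trans h3

theorem intCast_zmod_ne_zero {p : ℕ} {z : ℤ} (hz : z ≠ 0) (h : z.natAbs < p) : (z : ZMod p) ≠ 0 := by
  rw [Ne, ZMod.intCast_zmod_eq_zero_iff_dvd]
  intro hdvd
  exact hz (Int.eq_zero_of_dvd_of_natAbs_lt_natAbs hdvd (by simpa using h))

end Density

end PolySzemeredi

open PolySzemeredi

theorem stmt17 (D t : ℕ) (hD : 1 ≤ D) (ht : 1 ≤ t)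
    (P : Fin t → Polynomial ℤ)
    (hdeg0 : 0 < (P ⟨0, by omega⟩).natDegree)
    (hmono : ∀ i j : Fin t, i < j → (P i).natDegree < (P j).natDegree)
    (v : Fin t → (Fin D → ℤ)) (hv : ∀ i, v i ≠ 0) :
    ∃ (c C : ℝ) (p₀ : ℕ), 0 < c ∧ 0 < C ∧
      ∀ (p : ℕ) [Fact p.Prime] [NeZero p], p₀ < p →
      ∀ A : Finset (Fin D → ZMod p),
        C * (p : ℝ) ^ ((D : ℝ) - c) ≤ (A.card : ℝ) →
        ∃ (x : Fin D → ZMod p) (y : ZMod p), y ≠ 0 ∧ x ∈ A ∧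
          ∀ i : Fin t,
            x + ((P i).map (Int.castRingHom (ZMod p))).eval y •
              ((fun j => ((v i j : ℤ) : ZMod p)) : Fin D → ZMod p) ∈ A := by
  have hpos : ∀ i, 1 ≤ (P i).natDegree := fun i => by
    rcases Nat.eq_zero_or_pos i.val with h | h
    · have : i = ⟨0, by omega⟩ := Fin.ext h
      rw [this]
      exact hdeg0
    · exact Nat.succ_le_of_lt ((Nat.zero_le _).trans_lt (hmono ⟨0, by omega⟩ i h))
  set d : ℕ := ∑ i, (P i).natDegree with hd
  have hdle : ∀ i, (P i).natDegree ≤ d := fun i =>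
    Finset.single_le_sum (f := fun i => (P i).natDegree) (fun _ _ => Nat.zero_le _)
      (Finset.mem_univ i)
  set deg : ℕ → ℕ := fun i => if h : i < t then (P ⟨i, h⟩).natDegree else 0 with hdeg
  obtain ⟨N, C, hN, hC, H⟩ := exists_density_pow_le (deg := deg) (d := d) ht
    (fun i hi => by simp only [hdeg, dif_pos hi]; exact hpos _)
    (fun i j hij hj => by
      simp only [hdeg, dif_pos hj, dif_pos (hij.trans hj)]
      exact hmono _ _ hij)
    (fun i hi => by simp only [hdeg, dif_pos hi]; exact hdle _)
  refine ⟨1 / N, C + 1, d + ∑ i, (P i).leadingCoeff.natAbs + ∑ i, ∑ j, (v i j).natAbs,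
    by positivity, by positivity, ?_⟩
  intro p _ _ hp A hA
  by_contra hcon
  push Not at hcon
  have hp1 : (1 : ℝ) < p := by exact_mod_cast (Fact.out : p.Prime).one_lt
  have hp0 : (0 : ℝ) < p := by linarith
  have hlead : ∀ i, (Int.castRingHom (ZMod p)) (P i).leadingCoeff ≠ 0 := fun i => by
    refine intCast_zmod_ne_zero (Polynomial.leadingCoeff_ne_zero.2 fun h => ?_) ?_
    · have := hpos i
      simp [h] at this
    · have : (P i).leadingCoeff.natAbs ≤ ∑ i, (P i).leadingCoeff.natAbs :=
        Finset.single_le_sum (f := fun i => (P i).leadingCoeff.natAbs)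
          (fun _ _ => Nat.zero_le _) (Finset.mem_univ i)
      omega
  have hvp : ∀ i, (fun j => ((v i j : ℤ) : ZMod p)) ≠ (0 : Fin D → ZMod p) := fun i h => by
    obtain ⟨j, hj⟩ := Function.ne_iff.1 (hv i)
    refine intCast_zmod_ne_zero (p := p) hj ?_ (congrFun h j)
    have h1 : (v i j).natAbs ≤ ∑ j, (v i j).natAbs :=
      Finset.single_le_sum (f := fun j => (v i j).natAbs)
        (fun _ _ => Nat.zero_le _) (Finset.mem_univ j)
    have h2 : ∑ j, (v i j).natAbs ≤ ∑ i, ∑ j, (v i j).natAbs :=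
      Finset.single_le_sum (f := fun i => ∑ j, (v i j).natAbs)
        (fun _ _ => Nat.zero_le _) (Finset.mem_univ i)
    omega
  have hdens := H p (Fin D → ZMod p)
    (fun i => if h : i < t then (P ⟨i, h⟩).map (Int.castRingHom (ZMod p)) else 0)
    (fun i => if h : i < t then fun j => ((v ⟨i, h⟩ j : ℤ) : ZMod p) else 0) A (by omega)
    (fun i hi => by simp only [dif_pos hi]; exact hvp _)
    (fun i hi => by
      simp only [dif_pos hi, hdeg]
      exact Polynomial.natDegree_map_of_leadingCoeff_ne_zero _ (hlead _))
    (fun x hx y hy => by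
      obtain ⟨i, hi⟩ := hcon x y hy hx
      refine ⟨i, i.2, ?_⟩
      simpa only [dif_pos i.2] using hi)
  have hcard : (Fintype.card (Fin D → ZMod p) : ℝ) = (p : ℝ) ^ D := by
    rw [Fintype.card_fun, ZMod.card, Fintype.card_fin]
    push_cast
    rfl
  have hlow : (C + 1) * (p : ℝ) ^ (-(1 / N : ℝ)) ≤ (#A : ℝ) / Fintype.card (Fin D → ZMod p) := by
    rw [hcard, le_div_iff₀ (by positivity)]
    refine le_trans (le_of_eq ?_) hA
    rw [mul_assoc, ← Real.rpow_natCast, ← Real.rpow_add hp0]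
    congr 2
    ring
  have hpow := (pow_le_pow_left₀ (by positivity) hlow N).trans hdens
  have hroot : ((p : ℝ) ^ (-(1 / N : ℝ))) ^ N = 1 / p := by
    rw [← Real.rpow_natCast, ← Real.rpow_mul hp0.le, neg_mul, one_div_mul_cancel (by positivity),
      Real.rpow_neg_one, one_div]
  rw [mul_pow, hroot, mul_one_div, div_le_div_iff_of_pos_right hp0] at hpow
  have : C + 1 ≤ (C + 1) ^ N := le_self_pow₀ (by linarith) hN.ne'
  linarith
end

section
/- For any prime p > 4 and any subset A ⊆ F_p^2 of density α = |A|/p^2 with α ≥ C p^{−c} (for suitable absolute constants C, c > 0), A contains a configuration (x_1, x_2), (x_1 + y, x_2), (x_1, x_2 + y^2) with y ≠ 0. -/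
open Finset Complex

lemma sq_norm_sum_mul_le {ι : Type*} (s : Finset ι) (u v : ι → ℂ) :
    ‖∑ i ∈ s, u i * v i‖ ^ 2 ≤ (∑ i ∈ s, ‖u i‖ ^ 2) * ∑ i ∈ s, ‖v i‖ ^ 2 := by
  refine le_trans ?_ (sum_mul_sq_le_sq_mul_sq s (fun i => ‖u i‖) fun i => ‖v i‖)
  gcongr
  exact (norm_sum_le _ _).trans_eq (sum_congr rfl fun i _ => norm_mul _ _)

lemma sq_norm_sum_le_card_mul {ι : Type*} [Fintype ι] (u : ι → ℂ) :
    ‖∑ x, u x‖ ^ 2 ≤ Fintype.card ι * ∑ x, ‖u x‖ ^ 2 := by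
  simpa using sq_norm_sum_mul_le univ (fun _ : ι => (1 : ℂ)) u

section FiniteField

variable {F : Type*} [Field F] [Fintype F] {ψ : AddChar F ℂ}

/-- Parseval's identity for the characters of a finite field. -/
lemma sum_norm_sq_sum_mul_char (hψ : ψ.IsPrimitive) {γ : F} (hγ : γ ≠ 0) (a : F → ℂ) :
    ∑ w, ‖∑ d, a d * ψ (γ * w * d)‖ ^ 2 = Fintype.card F * ∑ d, ‖a d‖ ^ 2 := by
  classical
  have expand : ∀ w, ((‖∑ d, a d * ψ (γ * w * d)‖ ^ 2 : ℝ) : ℂ) =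
      ∑ d, ∑ d', a d * (starRingEnd ℂ) (a d') * ψ (w * (γ * (d - d'))) := by
    intro w
    rw [ofReal_pow, ← Complex.mul_conj', map_sum, sum_mul_sum]
    refine sum_congr rfl fun d _ => sum_congr rfl fun d' _ => ?_
    rw [map_mul (starRingEnd ℂ), ← AddChar.map_neg_eq_conj,
      show w * (γ * (d - d')) = γ * w * d + -(γ * w * d') by ring, AddChar.map_add_eq_mul]
    ring
  have key : ((∑ w, ‖∑ d, a d * ψ (γ * w * d)‖ ^ 2 : ℝ) : ℂ) =
      ((Fintype.card F * ∑ d, ‖a d‖ ^ 2 : ℝ) : ℂ) := by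
    rw [ofReal_sum, sum_congr rfl fun w _ => expand w, sum_comm]
    push_cast
    rw [mul_sum]
    refine sum_congr rfl fun d _ => ?_
    rw [sum_comm]
    simp_rw [← mul_sum, AddChar.sum_mulShift _ hψ, mul_eq_zero, hγ, false_or, sub_eq_zero]
    rw [sum_eq_single d (fun b _ hb => by simp [hb.symm]) (by simp), Complex.mul_conj']
    simp [mul_comm]
  exact_mod_cast key

lemma sum_norm_sq_sum_mul_chirp (hψ : ψ.IsPrimitive) (h2 : (2 : F) ≠ 0) {γ : F} (hγ : γ ≠ 0)
    (a : F → ℂ) :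
    ∑ q, ‖∑ x, a x * ψ (γ * (q - x) ^ 2)‖ ^ 2 = Fintype.card F * ∑ x, ‖a x‖ ^ 2 := by
  have hne : -(2 * γ) ≠ 0 := neg_ne_zero.2 (mul_ne_zero h2 hγ)
  have h := sum_norm_sq_sum_mul_char hψ hne fun x => a x * ψ (γ * x ^ 2)
  simp only [norm_mul, AddChar.norm_apply, mul_one] at h
  rw [← h]
  refine sum_congr rfl fun q _ => ?_
  have : ∑ x, a x * ψ (γ * (q - x) ^ 2) =
      ψ (γ * q ^ 2) * ∑ x, a x * ψ (γ * x ^ 2) * ψ (-(2 * γ) * q * x) := by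
    rw [mul_sum]
    refine sum_congr rfl fun x _ => ?_
    rw [show γ * (q - x) ^ 2 = γ * q ^ 2 + (γ * x ^ 2 + -(2 * γ) * q * x) by ring,
      AddChar.map_add_eq_mul, AddChar.map_add_eq_mul]
    ring
  rw [this, norm_mul, AddChar.norm_apply, one_mul]

/-- The bilinear form with kernel `ψ (γ * (y - x) ^ 2)` has norm at most `√|F|`. -/
lemma norm_sum_chirp_le (hψ : ψ.IsPrimitive) (h2 : (2 : F) ≠ 0) {γ : F} (hγ : γ ≠ 0)
    (u v : F → ℂ) :
    ‖∑ y, v y * ∑ x, u x * ψ (γ * (y - x) ^ 2)‖ ≤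
      √(Fintype.card F) * (√(∑ x, ‖u x‖ ^ 2) * √(∑ x, ‖v x‖ ^ 2)) := by
  rw [← Real.sqrt_mul (by positivity), ← Real.sqrt_mul (by positivity)]
  refine Real.le_sqrt_of_sq_le ((sq_norm_sum_mul_le _ _ _).trans_eq ?_)
  rw [sum_norm_sq_sum_mul_chirp hψ h2 hγ]
  ring

lemma norm_sum_chirp_le_trivial (γ : F) (u v : F → ℂ) :
    ‖∑ y, v y * ∑ x, u x * ψ (γ * (y - x) ^ 2)‖ ≤
      Fintype.card F * (√(∑ x, ‖u x‖ ^ 2) * √(∑ x, ‖v x‖ ^ 2)) := by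
  rw [← Real.sqrt_mul (by positivity)]
  nth_rewrite 1 [← Real.sqrt_sq (Nat.cast_nonneg (Fintype.card F) : (0 : ℝ) ≤ _)]
  rw [← Real.sqrt_mul (by positivity)]
  refine Real.le_sqrt_of_sq_le ((sq_norm_sum_mul_le _ _ _).trans ?_)
  have inner : ∀ y, ‖∑ x, u x * ψ (γ * (y - x) ^ 2)‖ ^ 2 ≤
      Fintype.card F * ∑ x, ‖u x‖ ^ 2 := fun y => by
    simpa [AddChar.norm_apply] using
      sq_norm_sum_le_card_mul fun x => u x * ψ (γ * (y - x) ^ 2)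
  calc (∑ y, ‖v y‖ ^ 2) * ∑ y, ‖∑ x, u x * ψ (γ * (y - x) ^ 2)‖ ^ 2
      ≤ (∑ y, ‖v y‖ ^ 2) * ∑ _y : F, Fintype.card F * ∑ x, ‖u x‖ ^ 2 := by
        gcongr; exact inner _
    _ = _ := by
        rw [sum_const, card_univ, nsmul_eq_mul]; ring

lemma norm_sum_lines_le [DecidableEq F] (hψ : ψ.IsPrimitive) (h2 : (2 : F) ≠ 0) {d : F}
    (hd : d ≠ 0) (m m' : F) (u v : F → ℂ) :
    ‖∑ h, ∑ c, u (c - m * h) * v (c - m' * h) *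
        ψ (d * m' * (m' + d) * h ^ 2 - d * m * (m + d) * h ^ 2)‖ ≤
      (√(Fintype.card F) + (if m' = m then (Fintype.card F : ℝ) else 0) +
        (if m' = -(m + d) then (Fintype.card F : ℝ) else 0)) *
        (√(∑ x, ‖u x‖ ^ 2) * √(∑ x, ‖v x‖ ^ 2)) := by
  set N : ℝ := √(∑ x, ‖u x‖ ^ 2) * √(∑ x, ‖v x‖ ^ 2) with hN
  have hN0 : 0 ≤ N := by positivity
  have hite : ∀ P : Prop, [Decidable P] → (0 : ℝ) ≤ if P then (Fintype.card F : ℝ) else 0 := by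
    intro P _; split_ifs <;> positivity
  by_cases hm : m' = m
  · subst hm
    have eq : ∑ h, ∑ c, u (c - m' * h) * v (c - m' * h) *
        ψ (d * m' * (m' + d) * h ^ 2 - d * m' * (m' + d) * h ^ 2) =
        Fintype.card F * ∑ x, u x * v x := by
      simp only [sub_self, AddChar.map_zero_eq_one, mul_one]
      have : ∀ h : F, ∑ c, u (c - m' * h) * v (c - m' * h) = ∑ x, u x * v x := fun h =>
        Equiv.sum_comp (Equiv.subRight (m' * h)) fun x => u x * v x
      simp [this]
    have hle : ‖∑ x, u x * v x‖ ≤ N := by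
      rw [hN, ← Real.sqrt_mul (by positivity)]
      exact Real.le_sqrt_of_sq_le (sq_norm_sum_mul_le _ _ _)
    rw [eq, norm_mul, Complex.norm_natCast, if_pos rfl]
    refine mul_le_mul ?_ hle (norm_nonneg _) ?_
    · linarith [hite (m' = -(m' + d)), Real.sqrt_nonneg (Fintype.card F : ℝ)]
    · linarith [hite (m' = -(m' + d)), Real.sqrt_nonneg (Fintype.card F : ℝ),
        (Nat.cast_nonneg (Fintype.card F) : (0 : ℝ) ≤ _)]
  · have hne : m - m' ≠ 0 := sub_ne_zero.2 (Ne.symm hm)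
    set γ : F := -(d * (m + m' + d)) / (m - m') with hγ
    have eq : ∑ h, ∑ c, u (c - m * h) * v (c - m' * h) *
        ψ (d * m' * (m' + d) * h ^ 2 - d * m * (m + d) * h ^ 2) =
        ∑ y, v y * ∑ x, u x * ψ (γ * (y - x) ^ 2) := by
      simp_rw [mul_sum]
      rw [← sum_product', ← sum_product']
      refine sum_nbij' (fun z => (z.2 - m' * z.1, z.2 - m * z.1))
        (fun z => ((z.1 - z.2) / (m - m'), z.2 + m * ((z.1 - z.2) / (m - m'))))
        (by simp) (by simp) ?_ ?_ ?_
      · rintro ⟨h, c⟩ -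
        have : (c - m' * h - (c - m * h)) / (m - m') = h := by field_simp; ring
        ext
        · exact this
        · simp only [this]
          ring
      · rintro ⟨y, x⟩ -
        ext <;> simp
        field_simp
        ring
      · rintro ⟨h, c⟩ -
        have : d * m' * (m' + d) * h ^ 2 - d * m * (m + d) * h ^ 2 =
            γ * (c - m' * h - (c - m * h)) ^ 2 := by
          rw [hγ]; field_simp; ring
        simp only [this]
        ring
    rw [eq, if_neg hm, add_zero]
    by_cases hs : m' = -(m + d)
    · rw [if_pos hs]
      refine (norm_sum_chirp_le_trivial γ u v).trans ?_
      exact mul_le_mul_of_nonneg_right (by linarith [Real.sqrt_nonneg (Fintype.card F : ℝ)]) hN0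
    · rw [if_neg hs, add_zero]
      refine norm_sum_chirp_le hψ h2 ?_ u v
      refine div_ne_zero (neg_ne_zero.2 (mul_ne_zero hd fun h0 => hs ?_)) hne
      linear_combination h0

/-- `L²` estimate for averages over lines twisted by quadratic phases. -/
lemma sum_norm_sq_sum_lines_le (hψ : ψ.IsPrimitive) (h2 : (2 : F) ≠ 0) {d : F} (hd : d ≠ 0)
    (H : F → F → ℂ) :
    ∑ h, ∑ c, ‖∑ m, H (c - m * h) m * ψ (-(d * m * (m + d) * h ^ 2))‖ ^ 2 ≤
      (Fintype.card F * √(Fintype.card F) + 2 * Fintype.card F) * ∑ m, ∑ x, ‖H x m‖ ^ 2 := by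
  classical
  set n : F → ℝ := fun m => √(∑ x, ‖H x m‖ ^ 2) with hn
  have hn2 : ∀ m, n m ^ 2 = ∑ x, ‖H x m‖ ^ 2 := fun m => Real.sq_sqrt (by positivity)
  have expand : ((∑ h, ∑ c,
      ‖∑ m, H (c - m * h) m * ψ (-(d * m * (m + d) * h ^ 2))‖ ^ 2 : ℝ) : ℂ) =
      ∑ m, ∑ m', ∑ h, ∑ c, H (c - m * h) m * (starRingEnd ℂ) (H (c - m' * h) m') *
        ψ (d * m' * (m' + d) * h ^ 2 - d * m * (m + d) * h ^ 2) := by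
    push_cast
    have : ∀ h c, (‖∑ m, H (c - m * h) m * ψ (-(d * m * (m + d) * h ^ 2))‖ : ℂ) ^ 2 =
        ∑ m, ∑ m', H (c - m * h) m * (starRingEnd ℂ) (H (c - m' * h) m') *
        ψ (d * m' * (m' + d) * h ^ 2 - d * m * (m + d) * h ^ 2) := by
      intro h c
      rw [← Complex.mul_conj', map_sum, sum_mul_sum]
      refine sum_congr rfl fun m _ => sum_congr rfl fun m' _ => ?_
      rw [map_mul (starRingEnd ℂ), ← AddChar.map_neg_eq_conj, neg_neg,
        sub_eq_add_neg (d * m' * (m' + d) * h ^ 2), AddChar.map_add_eq_mul]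
      ring
    simp_rw [this]
    calc ∑ h, ∑ c, ∑ m, ∑ m', (_ : ℂ) = ∑ h, ∑ m, ∑ c, ∑ m', _ :=
          sum_congr rfl fun h _ => sum_comm
      _ = ∑ m, ∑ h, ∑ c, ∑ m', _ := sum_comm
      _ = ∑ m, ∑ h, ∑ m', ∑ c, _ :=
          sum_congr rfl fun m _ => sum_congr rfl fun h _ => sum_comm
      _ = _ := sum_congr rfl fun m _ => sum_comm
  have pair : ∀ m m', ‖∑ h, ∑ c, H (c - m * h) m * (starRingEnd ℂ) (H (c - m' * h) m') *
        ψ (d * m' * (m' + d) * h ^ 2 - d * m * (m + d) * h ^ 2)‖ ≤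
      √(Fintype.card F) * (n m * n m') +
        (if m' = m then Fintype.card F * (n m * n m') else 0) +
        (if m' = -(m + d) then Fintype.card F * (n m * n m') else 0) := by
    intro m m'
    have := norm_sum_lines_le hψ h2 hd m m' (fun x => H x m) fun x => (starRingEnd ℂ) (H x m')
    simp only [RCLike.norm_conj] at this
    refine this.trans_eq ?_
    simp only [hn]
    split_ifs <;> ring
  have hrefl : ∑ m, n m * n (-(m + d)) ≤ ∑ m, n m ^ 2 := by
    have e : ∑ m, n (-(m + d)) ^ 2 = ∑ m, n m ^ 2 :=
      Equiv.sum_comp ((Equiv.addRight d).trans (Equiv.neg F)) fun m => n m ^ 2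
    have : ∑ m, n m * n (-(m + d)) ≤ ∑ m, (n m ^ 2 + n (-(m + d)) ^ 2) / 2 :=
      sum_le_sum fun m _ => by nlinarith [sq_nonneg (n m - n (-(m + d)))]
    rw [← sum_div, sum_add_distrib, e] at this
    linarith
  have hall : (∑ m, n m) ^ 2 ≤ Fintype.card F * ∑ m, n m ^ 2 := by
    simpa using sq_sum_le_card_mul_sum_sq (s := (univ : Finset F)) (f := n)
  have hcast : ∑ h, ∑ c, ‖∑ m, H (c - m * h) m * ψ (-(d * m * (m + d) * h ^ 2))‖ ^ 2 =
      ‖((∑ h, ∑ c,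
        ‖∑ m, H (c - m * h) m * ψ (-(d * m * (m + d) * h ^ 2))‖ ^ 2 : ℝ) : ℂ)‖ := by
    rw [Complex.norm_real, Real.norm_of_nonneg (by positivity)]
  rw [hcast, expand]
  calc _ ≤ ∑ m, ∑ m', (√(Fintype.card F) * (n m * n m') +
        (if m' = m then Fintype.card F * (n m * n m') else 0) +
        (if m' = -(m + d) then Fintype.card F * (n m * n m') else 0)) :=
        (norm_sum_le _ _).trans (sum_le_sum fun m _ =>
          (norm_sum_le _ _).trans (sum_le_sum fun m' _ => pair m m'))
    _ = √(Fintype.card F) * (∑ m, n m) ^ 2 + Fintype.card F * ∑ m, n m ^ 2 +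
        Fintype.card F * ∑ m, n m * n (-(m + d)) := by
        simp only [sum_add_distrib, sum_ite_eq', mem_univ, if_true, ← mul_sum]
        rw [sq (∑ m, n m), sum_mul_sum]
        simp only [mul_sum, sq]
    _ ≤ √(Fintype.card F) * (Fintype.card F * ∑ m, n m ^ 2) + Fintype.card F * ∑ m, n m ^ 2 +
        Fintype.card F * ∑ m, n m ^ 2 := by gcongr
    _ = _ := by simp_rw [hn2]; ring

/-- The contribution of a nonzero frequency difference `d`. -/
lemma sum_norm_sq_offdiagonal_le (hψ : ψ.IsPrimitive) (h2 : (2 : F) ≠ 0) {d : F} (hd : d ≠ 0)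
    (H : F → F → ℂ) :
    ∑ h, ∑ q, ‖∑ x, ∑ m, H x m * ψ ((m + d) * (q - x) ^ 2 - m * (q + h - x) ^ 2)‖ ^ 2 ≤
      Fintype.card F * ((Fintype.card F * √(Fintype.card F) + 2 * Fintype.card F) *
        ∑ m, ∑ x, ‖H x m‖ ^ 2) := by
  have key : ∀ h, ∑ q, ‖∑ x, ∑ m, H x m *
        ψ ((m + d) * (q - x) ^ 2 - m * (q + d * h - x) ^ 2)‖ ^ 2 =
      Fintype.card F * ∑ c, ‖∑ m, H (c - m * h) m * ψ (-(d * m * (m + d) * h ^ 2))‖ ^ 2 := by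
    intro h
    rw [← sum_norm_sq_sum_mul_chirp hψ h2 hd]
    refine sum_congr rfl fun q _ => ?_
    congr 2
    simp_rw [sum_mul]
    refine sum_comm.trans (Eq.trans ?_ sum_comm)
    refine sum_congr rfl fun m _ => ?_
    rw [← Equiv.sum_comp (Equiv.subRight (m * h))]
    refine sum_congr rfl fun c _ => ?_
    rw [Equiv.subRight_apply, mul_assoc, ← AddChar.map_add_eq_mul]
    congr 2
    ring
  rw [← Equiv.sum_comp (Equiv.mulLeft₀ d hd)]
  simp only [Equiv.mulLeft₀_apply, key, ← mul_sum]
  gcongr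
  exact sum_norm_sq_sum_lines_le hψ h2 hd H

/-- The contribution of the frequency difference `0`. -/
lemma sum_norm_sq_diagonal_le (hψ : ψ.IsPrimitive) (h2 : (2 : F) ≠ 0) (H : F → F → ℂ)
    (h0 : ∀ x, H x 0 = 0) (h1 : ∀ x, ∑ m, ‖H x m‖ ≤ 1) :
    ∑ h, ∑ q, ‖∑ x, ∑ m, H x m * ψ (m * (q - x) ^ 2 - m * (q + h - x) ^ 2)‖ ^ 2 ≤
      2 * (Fintype.card F : ℝ) ^ 3 := by
  classical
  have hH : ∑ m, ∑ x, ‖H x m‖ ^ 2 ≤ Fintype.card F := by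
    rw [sum_comm]
    calc ∑ x, ∑ m, ‖H x m‖ ^ 2 ≤ ∑ _x : F, (1 : ℝ) := sum_le_sum fun x _ => by
          refine (sum_sq_le_sq_sum_of_nonneg fun m _ => norm_nonneg _).trans ?_
          exact pow_le_one₀ (by positivity) (h1 x)
      _ = _ := by simp
  have hzero : ∑ q, ‖∑ x, ∑ m, H x m * ψ (m * (q - x) ^ 2 - m * (q + 0 - x) ^ 2)‖ ^ 2 ≤
      (Fintype.card F : ℝ) ^ 3 := by
    have : ∀ q, ‖∑ x, ∑ m, H x m * ψ (m * (q - x) ^ 2 - m * (q + 0 - x) ^ 2)‖ ≤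
        Fintype.card F := fun q => by
      refine (norm_sum_le _ _).trans ?_
      refine (sum_le_sum (g := fun _ => (1 : ℝ)) fun x _ => ?_).trans_eq (by simp)
      refine (norm_sum_le _ _).trans ?_
      simpa [AddChar.norm_apply] using h1 x
    calc _ ≤ ∑ _q : F, (Fintype.card F : ℝ) ^ 2 := by gcongr; exact this _
      _ = _ := by simp; ring
  have hq : ∀ h ≠ 0, ∑ q, ‖∑ x, ∑ m, H x m * ψ (m * (q - x) ^ 2 - m * (q + h - x) ^ 2)‖ ^ 2 =
      Fintype.card F * ∑ m, ‖∑ x, H x m * ψ (2 * m * h * x)‖ ^ 2 := by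
    intro h hh
    have hne : -(2 * h) ≠ 0 := neg_ne_zero.2 (mul_ne_zero h2 hh)
    have := sum_norm_sq_sum_mul_char hψ hne
      fun m => (∑ x, H x m * ψ (2 * m * h * x)) * ψ (-(m * h ^ 2))
    simp only [norm_mul, AddChar.norm_apply, mul_one] at this
    rw [← this]
    refine sum_congr rfl fun q _ => ?_
    congr 2
    rw [sum_comm]
    refine sum_congr rfl fun m _ => ?_
    simp_rw [sum_mul]
    refine sum_congr rfl fun x _ => ?_
    rw [mul_assoc, mul_assoc, ← AddChar.map_add_eq_mul, ← AddChar.map_add_eq_mul]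
    congr 2
    ring
  have hsum : ∀ m, ∑ h, ‖∑ x, H x m * ψ (2 * m * h * x)‖ ^ 2 ≤
      Fintype.card F * ∑ x, ‖H x m‖ ^ 2 := by
    intro m
    by_cases hm : m = 0
    · subst hm; simp [h0]
    · exact (sum_norm_sq_sum_mul_char hψ (mul_ne_zero h2 hm) fun x => H x m).le
  rw [← add_sum_erase _ _ (mem_univ (0 : F)), two_mul]
  refine add_le_add hzero ?_
  calc _ = ∑ h ∈ univ.erase 0, Fintype.card F * ∑ m, ‖∑ x, H x m * ψ (2 * m * h * x)‖ ^ 2 :=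
        sum_congr rfl fun h hh => hq h (ne_of_mem_erase hh)
    _ ≤ ∑ h, Fintype.card F * ∑ m, ‖∑ x, H x m * ψ (2 * m * h * x)‖ ^ 2 :=
        sum_le_sum_of_subset_of_nonneg (erase_subset _ _) fun _ _ _ => by positivity
    _ = Fintype.card F * ∑ m, ∑ h, ‖∑ x, H x m * ψ (2 * m * h * x)‖ ^ 2 := by
        rw [← mul_sum, sum_comm]
    _ ≤ Fintype.card F * ∑ m, Fintype.card F * ∑ x, ‖H x m‖ ^ 2 := by gcongr; exact hsum _
    _ = (Fintype.card F : ℝ) ^ 2 * ∑ m, ∑ x, ‖H x m‖ ^ 2 := by rw [← mul_sum]; ring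
    _ ≤ (Fintype.card F : ℝ) ^ 2 * Fintype.card F := by gcongr
    _ = _ := by ring

/-- Fourier coefficients of `f` in the second variable. -/
noncomputable def fiberCoeff (ψ : AddChar F ℂ) (f : F → F → ℝ) (x l : F) : ℂ :=
  (∑ s, f x s * ψ (-(l * s))) / Fintype.card F

lemma sum_fiberCoeff_mul (hψ : ψ.IsPrimitive) (f : F → F → ℝ) (x s : F) :
    ∑ l, fiberCoeff ψ f x l * ψ (l * s) = f x s := by
  classical
  have hF : (Fintype.card F : ℂ) ≠ 0 := Nat.cast_ne_zero.2 Fintype.card_ne_zero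
  have : ∀ l, fiberCoeff ψ f x l * ψ (l * s) =
      ∑ t, f x t / Fintype.card F * ψ (l * (s - t)) := by
    intro l
    rw [fiberCoeff, div_mul_eq_mul_div, sum_mul, sum_div]
    refine sum_congr rfl fun t _ => ?_
    rw [show l * (s - t) = -(l * t) + l * s by ring, AddChar.map_add_eq_mul]
    ring
  simp_rw [this]
  rw [sum_comm]
  simp_rw [← mul_sum, AddChar.sum_mulShift _ hψ, sub_eq_zero]
  rw [sum_eq_single s (fun b _ hb => by simp [hb.symm]) (by simp)]
  simp [hF]

lemma sum_norm_sq_fiberCoeff_le (hψ : ψ.IsPrimitive) {f : F → F → ℝ}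
    (hf : ∀ x s, |f x s| ≤ 1) (x : F) : ∑ l, ‖fiberCoeff ψ f x l‖ ^ 2 ≤ 1 := by
  have hF : (0 : ℝ) < Fintype.card F := Nat.cast_pos.2 Fintype.card_pos
  have h := sum_norm_sq_sum_mul_char hψ (one_ne_zero : (1 : F) ≠ 0) (fiberCoeff ψ f x)
  have : ∀ w, ∑ l, fiberCoeff ψ f x l * ψ (1 * w * l) = f x w := fun w => by
    rw [← sum_fiberCoeff_mul hψ]
    exact sum_congr rfl fun l _ => by rw [one_mul, mul_comm w]
  simp_rw [this, Complex.norm_real, Real.norm_eq_abs] at h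
  have hle : ∑ w, |f x w| ^ 2 ≤ Fintype.card F := by
    refine (sum_le_sum (g := fun _ => (1 : ℝ)) fun w _ => ?_).trans_eq (by simp)
    exact pow_le_one₀ (abs_nonneg _) (hf x w)
  rw [h] at hle
  exact le_of_mul_le_mul_left (by linarith) hF

lemma sum_sq_sum_mul_eq (hψ : ψ.IsPrimitive) (f : F → F → ℝ) (a b : F → F) :
    ∑ w, (∑ x, f x (w + a x) * f x (w + b x)) ^ 2 =
      Fintype.card F * ∑ d, ‖∑ x, ∑ m, fiberCoeff ψ f x (m + d) *
        (starRingEnd ℂ) (fiberCoeff ψ f x m) * ψ ((m + d) * a x - m * b x)‖ ^ 2 := by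
  rw [← sum_norm_sq_sum_mul_char hψ (one_ne_zero : (1 : F) ≠ 0)]
  refine sum_congr rfl fun w _ => ?_
  rw [← sq_abs, ← Real.norm_eq_abs, ← Complex.norm_real]
  congr 2
  push_cast
  simp_rw [sum_mul]
  rw [sum_comm]
  refine sum_congr rfl fun x _ => ?_
  have hconj : (f x (w + b x) : ℂ) =
      (starRingEnd ℂ) (∑ m, fiberCoeff ψ f x m * ψ (m * (w + b x))) := by
    rw [sum_fiberCoeff_mul hψ, Complex.conj_ofReal]
  rw [hconj, ← sum_fiberCoeff_mul hψ f x (w + a x), map_sum, mul_sum, sum_comm]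
  refine sum_congr rfl fun m _ => ?_
  rw [sum_mul, ← Equiv.sum_comp (Equiv.addLeft m)]
  refine sum_congr rfl fun d _ => ?_
  rw [Equiv.coe_addLeft, map_mul (starRingEnd ℂ), ← AddChar.map_neg_eq_conj,
    mul_assoc _ _ (ψ (1 * w * d)), ← AddChar.map_add_eq_mul,
    show (m + d) * a x - m * b x + 1 * w * d =
      (m + d) * (w + a x) + -(m * (w + b x)) by ring, AddChar.map_add_eq_mul]
  ring

/-- A function with mean zero on every fibre has small box norm along the parabola. -/
lemma sum_box_le (hψ : ψ.IsPrimitive) (h2 : (2 : F) ≠ 0) {f : F → F → ℝ}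
    (hf : ∀ x s, |f x s| ≤ 1) (hmean : ∀ x, ∑ s, f x s = 0) :
    ∑ h, ∑ q, ∑ w, (∑ x, f x (w + (q - x) ^ 2) * f x (w + (q + h - x) ^ 2)) ^ 2 ≤
      5 * ((Fintype.card F : ℝ) ^ 4 * √(Fintype.card F)) := by
  classical
  set N : ℝ := (Fintype.card F : ℝ) with hN
  have hN1 : 1 ≤ N := Nat.one_le_cast.2 Fintype.card_pos
  set φ := fiberCoeff ψ f
  set H : F → F → F → ℂ := fun d x m => φ x (m + d) * (starRingEnd ℂ) (φ x m) with hH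
  have hφ := sum_norm_sq_fiberCoeff_le hψ hf
  have hφ0 : ∀ x, φ x 0 = 0 := fun x => by
    have : (∑ s, (f x s : ℂ)) = 0 := by exact_mod_cast hmean x
    simp [φ, fiberCoeff, this]
  have hmass : ∑ d, ∑ m, ∑ x, ‖H d x m‖ ^ 2 ≤ N := by
    have hx : ∀ x, ∑ m, ∑ d, ‖H d x m‖ ^ 2 ≤ 1 := fun x => by
      have : ∀ m, ∑ d, ‖H d x m‖ ^ 2 = (∑ l, ‖φ x l‖ ^ 2) * ‖φ x m‖ ^ 2 := fun m => by
        rw [← Equiv.sum_comp (Equiv.addLeft m) fun l => ‖φ x l‖ ^ 2, sum_mul]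
        simp [hH, mul_pow]
      simp_rw [this, ← mul_sum]
      exact mul_le_one₀ (hφ x) (by positivity) (hφ x)
    calc ∑ d, ∑ m, ∑ x, ‖H d x m‖ ^ 2 = ∑ m, ∑ d, ∑ x, ‖H d x m‖ ^ 2 := sum_comm
      _ = ∑ m, ∑ x, ∑ d, ‖H d x m‖ ^ 2 := sum_congr rfl fun m _ => sum_comm
      _ = ∑ x, ∑ m, ∑ d, ‖H d x m‖ ^ 2 := sum_comm
      _ ≤ ∑ _x : F, (1 : ℝ) := sum_le_sum fun x _ => hx x
      _ = N := by simp [hN]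
  have hdiag : ∑ h, ∑ q, ‖∑ x, ∑ m, H 0 x m *
      ψ ((m + 0) * (q - x) ^ 2 - m * (q + h - x) ^ 2)‖ ^ 2 ≤ 2 * N ^ 3 := by
    simp only [add_zero]
    refine sum_norm_sq_diagonal_le hψ h2 (H 0) (fun x => by simp [hH, hφ0]) fun x => ?_
    simpa [hH, ← sq] using hφ x
  have hoff : ∀ d ∈ univ.erase (0 : F), ∑ h, ∑ q, ‖∑ x, ∑ m, H d x m *
      ψ ((m + d) * (q - x) ^ 2 - m * (q + h - x) ^ 2)‖ ^ 2 ≤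
      N * ((N * √N + 2 * N) * ∑ m, ∑ x, ‖H d x m‖ ^ 2) := fun d hd =>
    sum_norm_sq_offdiagonal_le hψ h2 (ne_of_mem_erase hd) (H d)
  simp_rw [sum_sq_sum_mul_eq hψ f, ← mul_sum]
  have hswap : ∑ h, ∑ q, ∑ d, ‖∑ x, ∑ m, H d x m *
      ψ ((m + d) * (q - x) ^ 2 - m * (q + h - x) ^ 2)‖ ^ 2 =
      ∑ d, ∑ h, ∑ q, ‖∑ x, ∑ m, H d x m *
      ψ ((m + d) * (q - x) ^ 2 - m * (q + h - x) ^ 2)‖ ^ 2 :=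
    (sum_congr rfl fun h _ => sum_comm).trans sum_comm
  have hsqrt : 1 ≤ √N := Real.one_le_sqrt.2 hN1
  calc _ = N * ∑ d, ∑ h, ∑ q, ‖∑ x, ∑ m, H d x m *
      ψ ((m + d) * (q - x) ^ 2 - m * (q + h - x) ^ 2)‖ ^ 2 := by rw [← hswap]
    _ ≤ N * (2 * N ^ 3 + ∑ d, N * ((N * √N + 2 * N) * ∑ m, ∑ x, ‖H d x m‖ ^ 2)) := by
        gcongr
        rw [← add_sum_erase _ _ (mem_univ (0 : F))]
        refine add_le_add hdiag ((sum_le_sum hoff).trans ?_)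
        exact sum_le_sum_of_subset_of_nonneg (erase_subset _ _) fun _ _ _ => by positivity
    _ ≤ N * (2 * N ^ 3 + N * ((N * √N + 2 * N) * N)) := by
        simp_rw [← mul_sum]
        gcongr
    _ = N ^ 4 * √N + 4 * N ^ 4 * 1 := by ring
    _ ≤ N ^ 4 * √N + 4 * N ^ 4 * √N := by gcongr
    _ = _ := by ring

/-- Weighted counts of corners along a parabola are small if the vertical weight has mean zero
on every fibre. -/
lemma corner_sum_pow_four_le (hψ : ψ.IsPrimitive) (h2 : (2 : F) ≠ 0) {f₀ f₁ f : F → F → ℝ}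
    (hf₀ : ∀ x s, |f₀ x s| ≤ 1) (hf₁ : ∀ x s, |f₁ x s| ≤ 1) (hf : ∀ x s, |f x s| ≤ 1)
    (hmean : ∀ x, ∑ s, f x s = 0) :
    (∑ w, ∑ q, ∑ x, f₀ x w * f₁ q w * f x (w + (q - x) ^ 2)) ^ 4 ≤
      5 * ((Fintype.card F : ℝ) ^ 11 * √(Fintype.card F)) := by
  set N : ℝ := (Fintype.card F : ℝ) with hN
  have hle : ∀ {a b : ℝ}, |a| ≤ 1 → (a * b) ^ 2 ≤ b ^ 2 := fun {a b} ha => by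
    rw [mul_pow]
    exact mul_le_of_le_one_left (sq_nonneg b) ((sq_le_one_iff_abs_le_one a).2 ha)
  have first : (∑ w, ∑ q, ∑ x, f₀ x w * f₁ q w * f x (w + (q - x) ^ 2)) ^ 2 ≤
      N ^ 2 * ∑ w, ∑ q, (∑ x, f₀ x w * f x (w + (q - x) ^ 2)) ^ 2 := by
    rw [← sum_product' univ univ fun w q => ∑ x, f₀ x w * f₁ q w * f x (w + (q - x) ^ 2),
      ← sum_product' univ univ fun w q => (∑ x, f₀ x w * f x (w + (q - x) ^ 2)) ^ 2]
    refine (sq_sum_le_card_mul_sum_sq).trans ?_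
    rw [card_product, card_univ]
    push_cast
    rw [← sq]
    refine mul_le_mul_of_nonneg_left (sum_le_sum fun z _ => ?_) (by positivity)
    have : ∑ x, f₀ x z.1 * f₁ z.2 z.1 * f x (z.1 + (z.2 - x) ^ 2) =
        f₁ z.2 z.1 * ∑ x, f₀ x z.1 * f x (z.1 + (z.2 - x) ^ 2) := by
      rw [mul_sum]; exact sum_congr rfl fun x _ => by ring
    rw [this]
    exact hle (hf₁ _ _)
  have expand : ∑ w, ∑ q, (∑ x, f₀ x w * f x (w + (q - x) ^ 2)) ^ 2 =
      ∑ w, ∑ x, ∑ x', f₀ x w * f₀ x' w *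
        ∑ q, f x (w + (q - x) ^ 2) * f x' (w + (q - x') ^ 2) := by
    refine sum_congr rfl fun w _ => ?_
    simp_rw [sq (∑ x, _ : ℝ), sum_mul_sum, mul_sum]
    rw [sum_comm]
    refine sum_congr rfl fun x _ => ?_
    rw [sum_comm]
    exact sum_congr rfl fun x' _ => sum_congr rfl fun q _ => by ring
  have second : (∑ w, ∑ q, (∑ x, f₀ x w * f x (w + (q - x) ^ 2)) ^ 2) ^ 2 ≤
      N ^ 3 * ∑ w, ∑ x, ∑ x',
        (∑ q, f x (w + (q - x) ^ 2) * f x' (w + (q - x') ^ 2)) ^ 2 := by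
    rw [expand, ← sum_product', ← sum_product', ← sum_product', ← sum_product']
    refine (sq_sum_le_card_mul_sum_sq).trans ?_
    rw [card_product, card_product, card_univ]
    push_cast
    rw [← hN, show N * N * N = N ^ 3 by ring]
    refine mul_le_mul_of_nonneg_left (sum_le_sum fun z _ => ?_) (by positivity)
    refine hle ?_
    rw [abs_mul]
    exact mul_le_one₀ (hf₀ _ _) (abs_nonneg _) (hf₀ _ _)
  have flip : ∑ w, ∑ x, ∑ x', (∑ q, f x (w + (q - x) ^ 2) * f x' (w + (q - x') ^ 2)) ^ 2 =
      ∑ h, ∑ q, ∑ w, (∑ x, f x (w + (q - x) ^ 2) * f x (w + (q + h - x) ^ 2)) ^ 2 := by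
    have : ∀ w, ∑ x, ∑ x', (∑ q, f x (w + (q - x) ^ 2) * f x' (w + (q - x') ^ 2)) ^ 2 =
        ∑ h, ∑ q, (∑ x, f x (w + (q - x) ^ 2) * f x (w + (q + h - x) ^ 2)) ^ 2 := by
      intro w
      have shift : ∑ h, ∑ q, (∑ x, f x (w + (q - x) ^ 2) * f x (w + (q + h - x) ^ 2)) ^ 2 =
          ∑ q, ∑ q', (∑ x, f x (w + (q - x) ^ 2) * f x (w + (q' - x) ^ 2)) ^ 2 := by
        rw [sum_comm]
        exact sum_congr rfl fun q _ => Equiv.sum_comp (Equiv.addLeft q) fun q' =>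
          (∑ x, f x (w + (q - x) ^ 2) * f x (w + (q' - x) ^ 2)) ^ 2
      rw [shift]
      simp_rw [sq (∑ x, _ : ℝ), sum_mul_sum]
      calc ∑ x, ∑ x', ∑ q, ∑ q', (_ : ℝ) = ∑ x, ∑ q, ∑ x', ∑ q', _ :=
            sum_congr rfl fun x _ => sum_comm
        _ = ∑ q, ∑ x, ∑ x', ∑ q', _ := sum_comm
        _ = ∑ q, ∑ x, ∑ q', ∑ x', _ :=
            sum_congr rfl fun q _ => sum_congr rfl fun x _ => sum_comm
        _ = ∑ q, ∑ q', ∑ x, ∑ x', _ := sum_congr rfl fun q _ => sum_comm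
        _ = _ := sum_congr rfl fun q _ => sum_congr rfl fun q' _ => sum_congr rfl fun x _ =>
            sum_congr rfl fun x' _ => by ring
    simp_rw [this]
    rw [sum_comm]
    exact sum_congr rfl fun h _ => sum_comm
  have hbox := sum_box_le hψ h2 hf hmean
  rw [← flip] at hbox
  calc _ = ((∑ w, ∑ q, ∑ x, f₀ x w * f₁ q w * f x (w + (q - x) ^ 2)) ^ 2) ^ 2 := by ring
    _ ≤ (N ^ 2 * ∑ w, ∑ q, (∑ x, f₀ x w * f x (w + (q - x) ^ 2)) ^ 2) ^ 2 := by gcongr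
    _ = N ^ 4 * (∑ w, ∑ q, (∑ x, f₀ x w * f x (w + (q - x) ^ 2)) ^ 2) ^ 2 := by ring
    _ ≤ N ^ 4 * (N ^ 3 * (5 * (N ^ 4 * √N))) := by
        gcongr
        exact second.trans (by gcongr)
    _ = _ := by ring

end FiniteField

section Corners

variable {F : Type*} [DecidableEq F]

/-- The indicator function of a subset of the plane, as a real-valued function. -/
def planeIndicator (A : Finset (F × F)) (x w : F) : ℝ := if (x, w) ∈ A then 1 else 0

lemma planeIndicator_nonneg (A : Finset (F × F)) (x w : F) : 0 ≤ planeIndicator A x w := by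
  unfold planeIndicator; split_ifs <;> norm_num

lemma planeIndicator_le_one (A : Finset (F × F)) (x w : F) : planeIndicator A x w ≤ 1 := by
  unfold planeIndicator; split_ifs <;> norm_num

lemma abs_planeIndicator_le_one (A : Finset (F × F)) (x w : F) : |planeIndicator A x w| ≤ 1 := by
  rw [abs_of_nonneg (planeIndicator_nonneg A x w)]
  exact planeIndicator_le_one A x w

variable [Fintype F]

lemma sum_planeIndicator (A : Finset (F × F)) : ∑ x, ∑ w, planeIndicator A x w = #A := by
  rw [← sum_product']
  simp [planeIndicator]

variable [Field F]

/-- Lower bound for the average over a planar set of the product of its line densities. -/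
lemma card_pow_three_le_sum_lines (A : Finset (F × F)) :
    (#A : ℝ) ^ 3 / (32 * (Fintype.card F : ℝ) ^ 2) ≤
      ∑ x, ∑ w, planeIndicator A x w *
        ((∑ s, planeIndicator A x s) * ∑ z, planeIndicator A z w) := by
  set N : ℝ := (Fintype.card F : ℝ) with hN
  have hN0 : 0 < N := Nat.cast_pos.2 Fintype.card_pos
  set t : ℝ := #A / (4 * N) with ht
  have ht0 : 0 ≤ t := by positivity
  set u : F → ℝ := fun x => ∑ s, planeIndicator A x s with hu
  set v : F → ℝ := fun w => ∑ z, planeIndicator A z w with hv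
  have hu0 : ∀ x, 0 ≤ u x := fun x => sum_nonneg fun s _ => planeIndicator_nonneg A x s
  have hv0 : ∀ w, 0 ≤ v w := fun w => sum_nonneg fun z _ => planeIndicator_nonneg A z w
  have le_u : ∀ x w, planeIndicator A x w ≤ u x := fun x w =>
    single_le_sum (f := fun s => planeIndicator A x s)
      (fun s _ => planeIndicator_nonneg A x s) (mem_univ w)
  have le_v : ∀ x w, planeIndicator A x w ≤ v w := fun x w =>
    single_le_sum (f := fun z => planeIndicator A z w)
      (fun z _ => planeIndicator_nonneg A z w) (mem_univ x)
  have pointwise : ∀ a b : ℝ, 0 < a → 0 < b → t ^ 2 * (1 - t / a - t / b) ≤ a * b := by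
    intro a b ha hb
    have hab : 0 ≤ a * b := by positivity
    have hta : 0 ≤ t / a := by positivity
    have htb : 0 ≤ t / b := by positivity
    by_cases h : t ≤ a ∧ t ≤ b
    · have := mul_le_mul h.1 h.2 ht0 ha.le
      nlinarith [sq_nonneg t]
    · have : 1 ≤ t / a + t / b := by
        rw [not_and_or, not_le, not_le] at h
        rcases h with h | h
        · linarith [(one_le_div ha).2 h.le]
        · linarith [(one_le_div hb).2 h.le]
      nlinarith [sq_nonneg t]
  have hx : ∀ x, ∑ w, planeIndicator A x w * (t / u x) ≤ t := by
    intro x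
    rw [← sum_mul]
    change u x * (t / u x) ≤ t
    rcases (hu0 x).eq_or_lt with h | h
    · rw [← h, zero_mul]; exact ht0
    · rw [mul_div_cancel₀ _ h.ne']
  have hw : ∀ w, ∑ x, planeIndicator A x w * (t / v w) ≤ t := by
    intro w
    rw [← sum_mul]
    change v w * (t / v w) ≤ t
    rcases (hv0 w).eq_or_lt with h | h
    · rw [← h, zero_mul]; exact ht0
    · rw [mul_div_cancel₀ _ h.ne']
  have hsum : ∑ x, ∑ w, planeIndicator A x w * (t ^ 2 * (1 - t / u x - t / v w)) ≤
      ∑ x, ∑ w, planeIndicator A x w * (u x * v w) := by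
    refine sum_le_sum fun x _ => sum_le_sum fun w _ => ?_
    by_cases hA : (x, w) ∈ A
    · have h1 : planeIndicator A x w = 1 := if_pos hA
      have hux := le_u x w
      have hvw := le_v x w
      rw [h1] at hux hvw ⊢
      rw [one_mul, one_mul]
      exact pointwise _ _ (by linarith) (by linarith)
    · simp [planeIndicator, hA]
  have hsplit : ∑ x, ∑ w, planeIndicator A x w * (t ^ 2 * (1 - t / u x - t / v w)) =
      t ^ 2 * (#A - (∑ x, ∑ w, planeIndicator A x w * (t / u x)) -
        ∑ w, ∑ x, planeIndicator A x w * (t / v w)) := by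
    rw [sum_comm (s := univ) (t := univ) (f := fun w x => planeIndicator A x w * (t / v w)),
      ← sum_planeIndicator A, ← sum_sub_distrib, ← sum_sub_distrib, mul_sum]
    refine sum_congr rfl fun x _ => ?_
    rw [← sum_sub_distrib, ← sum_sub_distrib, mul_sum]
    exact sum_congr rfl fun w _ => by ring
  have hX : ∑ x, ∑ w, planeIndicator A x w * (t / u x) ≤ #A / 4 :=
    (sum_le_sum fun x _ => hx x).trans_eq (by
      rw [sum_const, card_univ, nsmul_eq_mul, ← hN, ht]; field_simp)
  have hW : ∑ w, ∑ x, planeIndicator A x w * (t / v w) ≤ #A / 4 :=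
    (sum_le_sum fun w _ => hw w).trans_eq (by
      rw [sum_const, card_univ, nsmul_eq_mul, ← hN, ht]; field_simp)
  calc (#A : ℝ) ^ 3 / (32 * N ^ 2) = t ^ 2 * (#A - #A / 4 - #A / 4) := by
        rw [ht]; field_simp; ring
    _ ≤ t ^ 2 * (#A - (∑ x, ∑ w, planeIndicator A x w * (t / u x)) -
        ∑ w, ∑ x, planeIndicator A x w * (t / v w)) := by gcongr
    _ ≤ _ := hsplit ▸ hsum

/-- A planar set without nontrivial corners along the parabola has few points. -/
lemma exists_error_of_corner_free {ψ : AddChar F ℂ} (hψ : ψ.IsPrimitive) (h2 : (2 : F) ≠ 0)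
    (A : Finset (F × F))
    (hA : ∀ x w y : F, y ≠ 0 → (x, w) ∈ A → (x + y, w) ∈ A → (x, w + y ^ 2) ∉ A) :
    ∃ E : ℝ, E ^ 4 ≤ 5 * ((Fintype.card F : ℝ) ^ 11 * √(Fintype.card F)) ∧
      (#A : ℝ) ^ 3 / (32 * (Fintype.card F : ℝ) ^ 3) ≤ (Fintype.card F : ℝ) ^ 2 + E := by
  set N : ℝ := (Fintype.card F : ℝ) with hN
  have hN0 : 0 < N := Nat.cast_pos.2 Fintype.card_pos
  set g := planeIndicator A
  set u : F → ℝ := fun x => ∑ s, g x s with hu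
  have hu0 : ∀ x, 0 ≤ u x / N := fun x =>
    div_nonneg (sum_nonneg fun s _ => planeIndicator_nonneg A x s) hN0.le
  have hu1 : ∀ x, u x / N ≤ 1 := fun x => by
    rw [div_le_one hN0]
    exact (sum_le_sum fun s _ => planeIndicator_le_one A x s).trans_eq (by simp [hN])
  set f : F → F → ℝ := fun x s => g x s - u x / N with hf
  have hf1 : ∀ x s, |f x s| ≤ 1 := fun x s =>
    abs_sub_le_iff.2 ⟨by linarith [hu0 x, planeIndicator_le_one A x s],
      by linarith [hu1 x, planeIndicator_nonneg A x s]⟩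
  have hmean : ∀ x, ∑ s, f x s = 0 := fun x => by
    simp only [hf, sum_sub_distrib, sum_const, card_univ, nsmul_eq_mul]
    rw [← hN, mul_div_cancel₀ _ hN0.ne', sub_self]
  refine ⟨-∑ w, ∑ q, ∑ x, g x w * g q w * f x (w + (q - x) ^ 2),
    (Even.neg_pow (by decide) _).trans_le (corner_sum_pow_four_le hψ h2
      (abs_planeIndicator_le_one A) (abs_planeIndicator_le_one A) hf1 hmean), ?_⟩
  have htriv : ∑ w, ∑ q, ∑ x, g x w * g q w * g x (w + (q - x) ^ 2) ≤ N ^ 2 := by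
    have : ∀ w q, ∑ x, g x w * g q w * g x (w + (q - x) ^ 2) ≤ 1 := fun w q => by
      rw [sum_eq_single q ?_ (by simp)]
      · exact mul_le_one₀ (mul_le_one₀ (planeIndicator_le_one A _ _)
          (planeIndicator_nonneg A _ _) (planeIndicator_le_one A _ _))
          (planeIndicator_nonneg A _ _) (planeIndicator_le_one A _ _)
      · intro x _ hx
        by_contra hne
        simp only [g, planeIndicator, mul_eq_zero, ite_eq_right_iff, one_ne_zero, imp_false,
          not_or, not_not] at hne
        exact hA x w (q - x) (sub_ne_zero.2 hx.symm) hne.1.1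
          (by rw [add_sub_cancel]; exact hne.1.2) hne.2
    calc _ ≤ ∑ _w : F, ∑ _q : F, (1 : ℝ) :=
          sum_le_sum fun w _ => sum_le_sum fun q _ => this w q
      _ = N ^ 2 := by simp [hN, sq]
  have hmain : ∑ w, ∑ q, ∑ x, g x w * g q w * (u x / N) =
      (∑ x, ∑ w, g x w * (u x * ∑ z, g z w)) / N := by
    rw [sum_comm (s := univ) (t := univ) (f := fun x w => g x w * (u x * ∑ z, g z w)), sum_div]
    refine sum_congr rfl fun w _ => ?_
    rw [sum_comm, sum_div]
    refine sum_congr rfl fun x _ => ?_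
    rw [show g x w * (u x * ∑ z, g z w) / N = g x w * (u x / N) * ∑ z, g z w by ring,
      mul_sum univ fun z => g z w]
    exact sum_congr rfl fun q _ => by ring
  have hsplit : ∑ w, ∑ q, ∑ x, g x w * g q w * g x (w + (q - x) ^ 2) =
      ∑ w, ∑ q, ∑ x, g x w * g q w * (u x / N) +
        ∑ w, ∑ q, ∑ x, g x w * g q w * f x (w + (q - x) ^ 2) := by
    simp only [← sum_add_distrib, hf]
    exact sum_congr rfl fun w _ => sum_congr rfl fun q _ => sum_congr rfl fun x _ => by ring
  have hlow := div_le_div_of_nonneg_right (card_pow_three_le_sum_lines A) hN0.le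
  rw [← hmain, div_div, ← hN, mul_assoc, ← pow_succ, show 2 + 1 = 3 from rfl] at hlow
  linarith

end Corners

theorem stmt18 : ∃ C c : ℝ, 0 < C ∧ 0 < c ∧
    ∀ (p : ℕ) [Fact p.Prime] [NeZero p], 4 < p →
    ∀ A : Finset (ZMod p × ZMod p),
      C * (p : ℝ) ^ (-c) ≤ (A.card : ℝ) / (p : ℝ) ^ 2 →
      ∃ x₁ x₂ y : ZMod p, y ≠ 0 ∧
        (x₁, x₂) ∈ A ∧ (x₁ + y, x₂) ∈ A ∧ (x₁, x₂ + y ^ 2) ∈ A := by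
  refine ⟨5, 1 / 24, by norm_num, by norm_num, ?_⟩
  intro p hprime _ hp A hA
  by_contra hcon
  push Not at hcon
  have h2 : (2 : ZMod p) ≠ 0 := by
    intro h
    have : ((2 : ℕ) : ZMod p) = 0 := by exact_mod_cast h
    rw [ZMod.natCast_eq_zero_iff] at this
    exact absurd (Nat.le_of_dvd two_pos this) (by omega)
  obtain ⟨E, hE, hcard⟩ := exists_error_of_corner_free (ZMod.isPrimitive_stdAddChar p) h2 A hcon
  rw [ZMod.card] at hE hcard
  set N : ℝ := (p : ℝ) with hN
  have hN0 : 0 < N := by positivity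
  have hN1 : 1 ≤ N := by rw [hN]; exact_mod_cast (by omega : 1 ≤ p)
  set β : ℝ := N ^ (-(1 / 24 : ℝ)) with hβ
  have hβ0 : 0 < β := by positivity
  have hβ1 : β ≤ 1 := Real.rpow_le_one_of_one_le_of_nonpos hN1 (by norm_num)
  have hβN : β ^ 24 * N = 1 := by
    rw [hβ, ← Real.rpow_natCast, ← Real.rpow_mul hN0.le]
    norm_num
    rw [Real.rpow_neg_one, inv_mul_cancel₀ hN0.ne']
  have hsqrt : √N = N * β ^ 12 := by
    rw [Real.sqrt_eq_iff_mul_self_eq hN0.le (by positivity)]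
    linear_combination -N * hβN
  have hEle : E ≤ 2 * (N ^ 3 * β ^ 3) := by
    by_contra! hlt
    have hpow := pow_lt_pow_left₀ hlt (by positivity) (four_ne_zero)
    rw [hsqrt] at hE
    have : 0 < N ^ 12 * β ^ 12 := by positivity
    nlinarith
  have hNX : N ^ 2 ≤ N ^ 3 * β ^ 3 := by
    have h1 : 1 ≤ β ^ 3 * N := by
      rw [← hβN]
      gcongr ?_ * N
      exact pow_le_pow_of_le_one hβ0.le hβ1 (by norm_num)
    nlinarith [sq_nonneg N]
  have hA' : 5 * β * N ^ 2 ≤ #A := (le_div_iff₀ (by positivity)).1 hA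
  have hlow : 125 / 32 * (N ^ 3 * β ^ 3) ≤ (#A : ℝ) ^ 3 / (32 * N ^ 3) := by
    rw [le_div_iff₀ (by positivity)]
    calc _ = (5 * β * N ^ 2) ^ 3 := by ring
      _ ≤ _ := by gcongr
  have : 0 < N ^ 3 * β ^ 3 := by positivity
  linarith
end
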